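/- Let n ≥ 2. The complex vector space of continuous, translation invariant valuations μ on ℂⁿ satisfying μ(gK) = (det g)² μ(K) for all g ∈ U(n) and all convex bodies K has dimension exactly 1. -/

import Mathlib

open MeasureTheory
open scoped ENNReal

noncomputable section

/-- `ℂⁿ`, regarded as a real inner product space via `Re⟨z,w⟫`. -/
abbrev Cn (n : ℕ) := EuclideanSpace ℂ (Fin n)

/-- `μ` is a valuation: it is finitely additive on convex bodies of `ℂⁿ`. -/
def IsValuation {n : ℕ} (μ : ConvexBody (Cn n) → ℂ) : Prop :=
  ∀ K L U I : ConvexBody (Cn n),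
    (U : Set (Cn n)) = (K : Set (Cn n)) ∪ (L : Set (Cn n)) →
    (I : Set (Cn n)) = (K : Set (Cn n)) ∩ (L : Set (Cn n)) →
    μ U + μ I = μ K + μ L

/-- `μ` is translation invariant. -/
def TranslationInvariant {n : ℕ} (μ : ConvexBody (Cn n) → ℂ) : Prop :=
  ∀ (x : Cn n) (K L : ConvexBody (Cn n)),
    (L : Set (Cn n)) = (fun y => x + y) '' (K : Set (Cn n)) → μ L = μ K

/-- `μ` has weight `l` : `μ (g K) = (det g)^l • μ K` for all `g ∈ U(n)`. -/
def HasWeight {n : ℕ} (l : ℤ) (μ : ConvexBody (Cn n) → ℂ) : Prop :=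
  ∀ g ∈ Matrix.unitaryGroup (Fin n) ℂ, ∀ K L : ConvexBody (Cn n),
    (L : Set (Cn n)) = (Matrix.toEuclideanLin g) '' (K : Set (Cn n)) →
    μ L = (Matrix.det g) ^ l * μ K

/-- The space of continuous, translation invariant valuations on `ℂⁿ` of weight `l`,
as a complex vector space. -/
def WeightValuations (n : ℕ) (l : ℤ) : Submodule ℂ (ConvexBody (Cn n) → ℂ) where
  carrier := {μ | IsValuation μ ∧ Continuous μ ∧ TranslationInvariant μ ∧ HasWeight l μ}
  add_mem' := by
    rintro μ ν ⟨h1, h2, h3, h4⟩ ⟨h1', h2', h3', h4'⟩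
    refine ⟨?_, h2.add h2', ?_, ?_⟩
    · intro K L U I hU hI
      have hμ := h1 K L U I hU hI
      have hν := h1' K L U I hU hI
      simp only [Pi.add_apply]
      linear_combination hμ + hν
    · intro x K L h
      simp [Pi.add_apply, h3 x K L h, h3' x K L h]
    · intro g hg K L h
      simp only [Pi.add_apply, h4 g hg K L h, h4' g hg K L h]
      ring
  zero_mem' := ⟨fun K L U I _ _ => rfl, continuous_const, fun x K L _ => rfl,
    fun g hg K L _ => by simp⟩
  smul_mem' := by
    rintro c μ ⟨h1, h2, h3, h4⟩
    refine ⟨?_, h2.const_smul c, ?_, ?_⟩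
    · intro K L U I hU hI
      simp only [Pi.smul_apply, smul_eq_mul]
      linear_combination c * h1 K L U I hU hI
    · intro x K L h
      simp [Pi.smul_apply, h3 x K L h]
    · intro g hg K L h
      simp only [Pi.smul_apply, smul_eq_mul, h4 g hg K L h]
      ring

set_option linter.unusedSectionVars false

open Set Filter Topology
open scoped Pointwise RealInnerProductSpace
open ProbabilityTheory (stdGaussian gaussianReal)

section

variable {E : Type*} [NormedAddCommGroup E] [InnerProductSpace ℝ E]

/-- The support function of a convex body. -/
def supp (K : ConvexBody E) (u : E) : ℝ := sSup ((fun x => ⟪x, u⟫) '' (K : Set E))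

theorem supp_bdd (K : ConvexBody E) (u : E) : BddAbove ((fun x => ⟪x, u⟫) '' (K : Set E)) :=
  (K.isCompact.image (by fun_prop)).bddAbove

theorem le_supp (K : ConvexBody E) {x : E} (hx : x ∈ K) (u : E) : ⟪x, u⟫ ≤ supp K u :=
  le_csSup (supp_bdd K u) ⟨x, hx, rfl⟩

theorem exists_supp (K : ConvexBody E) (u : E) : ∃ x ∈ K, ⟪x, u⟫ = supp K u := by
  obtain ⟨x, hx, h⟩ := (K.isCompact.image (f := fun x => ⟪x, u⟫) (by fun_prop)).sSup_mem
    (K.nonempty.image _)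
  exact ⟨x, hx, h⟩

theorem supp_le (K : ConvexBody E) (u : E) {c : ℝ} (h : ∀ x ∈ K, ⟪x, u⟫ ≤ c) : supp K u ≤ c := by
  obtain ⟨x, hx, e⟩ := exists_supp K u
  exact e ▸ h x hx

theorem mem_iff_supp [CompleteSpace E] (K : ConvexBody E) (x : E) :
    x ∈ K ↔ ∀ u, ⟪x, u⟫ ≤ supp K u := by
  refine ⟨fun hx u => le_supp K hx u, fun h => ?_⟩
  by_contra hx
  obtain ⟨f, s, h1, h2⟩ := geometric_hahn_banach_closed_point (s := (K : Set E)) (x := x)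
    K.convex K.isClosed hx
  let u := (InnerProductSpace.toDual ℝ E).symm f
  have hu : ∀ y, ⟪y, u⟫ = f y := fun y => by
    rw [real_inner_comm]; exact InnerProductSpace.toDual_symm_apply
  have h3 := h u
  have h4 : supp K u ≤ s := supp_le K u fun y hy => by rw [hu]; exact (h1 y hy).le
  rw [hu] at h3
  linarith

theorem subset_iff_supp [CompleteSpace E] (K L : ConvexBody E) :
    (K : Set E) ⊆ L ↔ ∀ u, supp K u ≤ supp L u :=
  ⟨fun h u => supp_le K u fun _ hx => le_supp L (h hx) u,
   fun h x hx => (mem_iff_supp L x).2 fun u => (le_supp K hx u).trans (h u)⟩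

theorem supp_inj [CompleteSpace E] {K L : ConvexBody E} (h : ∀ u, supp K u = supp L u) : K = L :=
  ConvexBody.ext (((subset_iff_supp K L).2 fun u => (h u).le).antisymm
    ((subset_iff_supp L K).2 fun u => (h u).ge))

/-- Sublinear functions. -/
structure Sublin (h : E → ℝ) : Prop where
  add_le : ∀ u v, h (u + v) ≤ h u + h v
  smul : ∀ (c : ℝ), 0 ≤ c → ∀ u, h (c • u) = c * h u

theorem Sublin.zero {h : E → ℝ} (hs : Sublin h) : h 0 = 0 := by
  simpa using hs.smul 0 le_rfl 0

theorem Sublin.const_mul {h : E → ℝ} (hs : Sublin h) {a : ℝ} (ha : 0 ≤ a) :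
    Sublin (fun u => a * h u) :=
  ⟨fun u v => by nlinarith [hs.add_le u v],
   fun c hc u => by rw [hs.smul c hc]; ring⟩

theorem Sublin.sup {h k : E → ℝ} (hs : Sublin h) (ks : Sublin k) :
    Sublin (fun u => max (h u) (k u)) :=
  ⟨fun u v => max_le
      ((hs.add_le u v).trans (add_le_add (le_max_left _ _) (le_max_left _ _)))
      ((ks.add_le u v).trans (add_le_add (le_max_right _ _) (le_max_right _ _))),
   fun c hc u => by rw [hs.smul c hc, ks.smul c hc, mul_max_of_nonneg _ _ hc]⟩

theorem sublin_norm : Sublin (fun u : E => ‖u‖) :=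
  ⟨norm_add_le, fun c hc u => by rw [norm_smul, Real.norm_of_nonneg hc]⟩

theorem sublin_abs_inner (v : E) : Sublin (fun u : E => |⟪u, v⟫|) :=
  ⟨fun u w => by rw [inner_add_left]; exact abs_add_le _ _,
   fun c hc u => by rw [inner_smul_left, abs_mul]; simp [abs_of_nonneg hc]⟩

theorem supp_sublin (K : ConvexBody E) : Sublin (supp K) := by
  have sm : ∀ c : ℝ, 0 ≤ c → ∀ u, supp K (c • u) ≤ c * supp K u := fun c hc u =>
    supp_le K _ fun x hx => by
      rw [inner_smul_right]; exact mul_le_mul_of_nonneg_left (le_supp K hx u) hc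
  refine ⟨fun u v => supp_le K _ fun x hx => ?_, fun c hc u => (sm c hc u).antisymm ?_⟩
  · rw [inner_add_right]; exact add_le_add (le_supp K hx u) (le_supp K hx v)
  · obtain ⟨x, hx, e⟩ := exists_supp K u
    rw [← e]
    have := le_supp K hx (c • u)
    rwa [inner_smul_right] at this

theorem supp_add (K L : ConvexBody E) (u : E) : supp (K + L) u = supp K u + supp L u := by
  apply le_antisymm
  · refine supp_le _ _ fun x hx => ?_
    obtain ⟨y, hy, z, hz, rfl⟩ := Set.mem_add.1 (show x ∈ (K : Set E) + L from hx)
    rw [inner_add_left]; exact add_le_add (le_supp K hy u) (le_supp L hz u)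
  · obtain ⟨y, hy, e1⟩ := exists_supp K u
    obtain ⟨z, hz, e2⟩ := exists_supp L u
    rw [← e1, ← e2, ← inner_add_left]
    exact le_supp (K + L) (show y + z ∈ (K : Set E) + L from Set.add_mem_add hy hz) u

theorem supp_zero (u : E) : supp (0 : ConvexBody E) u = 0 := by
  obtain ⟨y, hy, e1⟩ := exists_supp (0 : ConvexBody E) u
  have : y = 0 := hy
  rw [← e1, this, inner_zero_left]

/-- Singleton bodies. -/
def pt (x : E) : ConvexBody E := ⟨{x}, convex_singleton x, isCompact_singleton, singleton_nonempty x⟩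

theorem supp_pt (x u : E) : supp (pt x) u = ⟪x, u⟫ := by
  obtain ⟨y, hy, e1⟩ := exists_supp (pt x) u
  have : y = x := hy
  rw [← e1, this]

/-- Segments from the origin. -/
def seg (v : E) : ConvexBody E :=
  ⟨segment ℝ 0 v, convex_segment _ _, by
    rw [segment_eq_image]; exact isCompact_Icc.image (by fun_prop), ⟨0, left_mem_segment _ _ _⟩⟩

theorem mem_seg {v x : E} : x ∈ seg v ↔ ∃ t ∈ Icc (0 : ℝ) 1, x = t • v := by
  change x ∈ segment ℝ 0 v ↔ _
  rw [segment_eq_image]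
  simp [eq_comm]

theorem supp_seg (v u : E) : supp (seg v) u = max 0 ⟪v, u⟫ := by
  apply le_antisymm
  · refine supp_le _ _ fun x hx => ?_
    obtain ⟨t, ⟨h0, h1⟩, rfl⟩ := mem_seg.1 hx
    rw [inner_smul_left]
    simp only [conj_trivial]
    rcases le_total 0 ⟪v, u⟫ with h | h
    · rw [max_eq_right h]; nlinarith
    · rw [max_eq_left h]; nlinarith
  · refine max_le ?_ ?_
    · simpa using le_supp (seg v) (mem_seg.2 ⟨0, by simp, by simp⟩ : (0 : E) ∈ seg v) u
    · exact le_supp (seg v) (mem_seg.2 ⟨1, by simp, by simp⟩) u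

theorem seg_zero : seg (0 : E) = 0 := by
  ext x; change x ∈ segment ℝ (0 : E) 0 ↔ x = 0; simp

theorem abs_supp_sub_le (K L : ConvexBody E) (u : E) :
    |supp K u - supp L u| ≤ dist K L * ‖u‖ := by
  have key : ∀ K L : ConvexBody E, supp K u ≤ supp L u + dist K L * ‖u‖ := by
    intro K L
    obtain ⟨x, hx, e⟩ := exists_supp K u
    have h1 : Metric.infDist x (L : Set E) ≤ dist K L :=
      Metric.infDist_le_hausdorffDist_of_mem hx ConvexBody.hausdorffEDist_ne_top
    obtain ⟨y, hy, h2⟩ := L.isCompact.exists_infDist_eq_dist L.nonempty x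
    have h3 : ⟪x, u⟫ = ⟪y, u⟫ + ⟪x - y, u⟫ := by rw [← inner_add_left]; simp
    have h4 : ⟪x - y, u⟫ ≤ ‖x - y‖ * ‖u‖ := real_inner_le_norm _ _
    have h5 : ‖x - y‖ ≤ dist K L := by rw [← dist_eq_norm, ← h2]; exact h1
    have h6 := le_supp L hy u
    have h7 : ‖x - y‖ * ‖u‖ ≤ dist K L * ‖u‖ := by gcongr
    linarith
  rw [abs_le]
  have a := key K L
  have b := key L K
  rw [dist_comm] at b
  constructor <;> linarith

theorem continuous_supp_body (u : E) : Continuous fun K : ConvexBody E => supp K u := by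
  refine (LipschitzWith.of_dist_le_mul (K := ⟨‖u‖, norm_nonneg u⟩) fun K L => ?_).continuous
  rw [Real.dist_eq, mul_comm]
  exact abs_supp_sub_le K L u

theorem abs_supp_le (K : ConvexBody E) (u : E) : |supp K u| ≤ dist K 0 * ‖u‖ := by
  simpa [supp_zero] using abs_supp_sub_le K 0 u

theorem Sublin.lipschitz_of_bound {h : E → ℝ} (hs : Sublin h) {c : ℝ} (hc : ∀ u, h u ≤ c * ‖u‖)
    (u v : E) : |h u - h v| ≤ c * ‖u - v‖ := by
  have h1 := hs.add_le v (u - v)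
  have h2 := hs.add_le u (v - u)
  rw [add_sub_cancel] at h1 h2
  have h3 := hc (u - v)
  have h4 := hc (v - u)
  rw [norm_sub_rev] at h4
  rw [abs_le]; constructor <;> linarith

theorem Sublin.continuous_of_bound {h : E → ℝ} (hs : Sublin h) {c : ℝ} (hc : ∀ u, h u ≤ c * ‖u‖) :
    Continuous h := by
  have hc' : 0 ≤ max c 0 := le_max_right _ _
  refine (LipschitzWith.of_dist_le_mul (K := ⟨max c 0, hc'⟩) fun u v => ?_).continuous
  rw [Real.dist_eq, dist_eq_norm]
  refine (hs.lipschitz_of_bound hc u v).trans ?_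
  change c * _ ≤ max c 0 * _
  gcongr; exact le_max_left _ _

theorem continuous_supp (K : ConvexBody E) : Continuous (supp K) :=
  (supp_sublin K).continuous_of_bound fun u => (le_abs_self _).trans (abs_supp_le K u)

/-- Bodies from their support functions. -/
theorem dist_le_of_supp [CompleteSpace E] {K L : ConvexBody E} {c : ℝ} (hc : 0 ≤ c)
    (h : ∀ u, ‖u‖ = 1 → |supp K u - supp L u| ≤ c) : dist K L ≤ c := by
  have key : ∀ K L : ConvexBody E, (∀ u, ‖u‖ = 1 → |supp K u - supp L u| ≤ c) → ∀ x ∈ K,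
      Metric.infDist x (L : Set E) ≤ c := by
    intro K L h x hx
    obtain ⟨y, hy, h2⟩ := L.isCompact.exists_infDist_eq_dist L.nonempty x
    rw [h2, dist_eq_norm]
    by_cases h0 : x = y
    · simp [h0, hc]
    have hn : 0 < ‖x - y‖ := norm_pos_iff.2 (sub_ne_zero.2 h0)
    set u := ‖x - y‖⁻¹ • (x - y) with hu
    have hu1 : ‖u‖ = 1 := by rw [hu, norm_smul]; simp [hn.ne']
    have h3 : supp L u ≤ ⟪y, u⟫ := by
      refine supp_le L u fun w hw => ?_
      have := (norm_eq_iInf_iff_real_inner_le_zero L.convex hy (u := x)).1 (by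
        rw [← dist_eq_norm, ← h2, Metric.infDist_eq_iInf]
        simp [dist_eq_norm]) w hw
      have : ⟪w - y, u⟫ ≤ 0 := by
        rw [hu, inner_smul_right, real_inner_comm]
        exact mul_nonpos_of_nonneg_of_nonpos (by positivity) this
      rw [inner_sub_left] at this; linarith
    have h4 := le_supp K hx u
    have h5 := (abs_le.1 (h u hu1)).2
    have h6 : ⟪x - y, u⟫ = ‖x - y‖ := by
      rw [hu, inner_smul_right, real_inner_self_eq_norm_sq]; field_simp
    rw [inner_sub_left] at h6
    linarith
  apply Metric.hausdorffDist_le_of_infDist hc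
  · exact key K L h
  · exact key L K fun u hu => by rw [abs_sub_comm]; exact h u hu

section FD

variable [FiniteDimensional ℝ E]

theorem Sublin.exists_bound {h : E → ℝ} (hs : Sublin h) : ∃ c : ℝ, 0 ≤ c ∧ ∀ u, h u ≤ c * ‖u‖ := by
  have hconv : ConvexOn ℝ univ h := by
    refine ⟨convex_univ, fun x _ y _ a b ha hb _ => ?_⟩
    refine (hs.add_le _ _).trans ?_
    rw [hs.smul a ha, hs.smul b hb]; simp
  have hcont : Continuous h := by
    rw [← continuousOn_univ]
    exact hconv.continuousOn isOpen_univ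
  obtain ⟨c, hc⟩ := (isCompact_closedBall (0 : E) 1).bddAbove_image hcont.continuousOn
  refine ⟨c, hs.zero ▸ hc ⟨0, by simp, rfl⟩, fun u => ?_⟩
  by_cases h0 : u = 0
  · simp [h0, hs.zero]
  have hn : 0 < ‖u‖ := norm_pos_iff.2 h0
  have e : u = ‖u‖ • (‖u‖⁻¹ • u) := by rw [smul_smul, mul_inv_cancel₀ hn.ne', one_smul]
  have : h (‖u‖⁻¹ • u) ≤ c := hc ⟨_, by simp [norm_smul, hn.ne'], rfl⟩
  rw [e, hs.smul _ hn.le, ← e, mul_comm]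
  gcongr

theorem Sublin.continuous {h : E → ℝ} (hs : Sublin h) : Continuous h := by
  obtain ⟨c, -, hc⟩ := hs.exists_bound
  exact hs.continuous_of_bound hc

theorem Sublin.exists_touch {h : E → ℝ} (hs : Sublin h) (u : E) :
    ∃ x : E, ⟪x, u⟫ = h u ∧ ∀ v, ⟪x, v⟫ ≤ h v := by
  have hnn : 0 ≤ h u + h (-u) := by simpa [hs.zero] using hs.add_le u (-u)
  by_cases h0 : u = 0
  · obtain ⟨g, -, hg⟩ := exists_extension_of_le_sublinear (⟨⊥, 0⟩ : E →ₗ.[ℝ] ℝ) h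
      (fun c hc x => hs.smul c hc.le x) hs.add_le (by
        rintro ⟨x, hx⟩
        have : x = 0 := by simpa using hx
        subst this
        simp [hs.zero])
    refine ⟨(InnerProductSpace.toDual ℝ E).symm (LinearMap.toContinuousLinearMap g), ?_, fun v => ?_⟩
    · simp [h0, hs.zero]
    · rw [InnerProductSpace.toDual_symm_apply]; exact hg v
  · let f : E →ₗ.[ℝ] ℝ := LinearPMap.mkSpanSingleton u (h u) h0
    obtain ⟨g, hg1, hg⟩ := exists_extension_of_le_sublinear f h
      (fun c hc x => hs.smul c hc.le x) hs.add_le (by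
        rintro ⟨x, hx⟩
        obtain ⟨c, rfl⟩ := Submodule.mem_span_singleton.1 hx
        have : f ⟨c • u, hx⟩ = c • h u := LinearPMap.mkSpanSingleton'_apply _ _ _ _ _
        rw [this]
        change c * h u ≤ h (c • u)
        rcases le_total 0 c with hc | hc
        · rw [hs.smul c hc]
        · have e : c • u = (-c) • (-u) := by simp
          rw [e, hs.smul (-c) (by linarith)]
          nlinarith)
    refine ⟨(InnerProductSpace.toDual ℝ E).symm (LinearMap.toContinuousLinearMap g), ?_, fun v => ?_⟩
    · rw [InnerProductSpace.toDual_symm_apply]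
      have := hg1 ⟨u, Submodule.mem_span_singleton_self u⟩
      change g u = h u
      refine this.trans ?_
      exact LinearPMap.mkSpanSingleton'_apply_self _ _ _ _
    · rw [InnerProductSpace.toDual_symm_apply]; exact hg v

theorem Sublin.exists_body {h : E → ℝ} (hs : Sublin h) : ∃ K : ConvexBody E, ∀ u, supp K u = h u := by
  obtain ⟨c, hc0, hc⟩ := hs.exists_bound
  let K : ConvexBody E := ⟨{x | ∀ u, ⟪x, u⟫ ≤ h u}, by
      rw [ofPred_forall]
      refine convex_iInter fun u => ?_
      exact convex_halfSpace_le (f := fun x => ⟪x, u⟫)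
        ⟨fun x y => inner_add_left _ _ _, fun c x => by simp [inner_smul_left]⟩ _, by
      refine Metric.isCompact_of_isClosed_isBounded ?_ ?_
      · rw [ofPred_forall]
        exact isClosed_iInter fun u => isClosed_le (by fun_prop) continuous_const
      · refine (Metric.isBounded_closedBall (x := (0 : E)) (r := c)).subset fun x hx => ?_
        rw [mem_closedBall_zero_iff]
        by_contra! hlt
        have h1 := (hx x).trans (hc x)
        rw [real_inner_self_eq_norm_sq] at h1
        nlinarith, by
      obtain ⟨x, -, hx⟩ := hs.exists_touch 0
      exact ⟨x, hx⟩⟩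
  refine ⟨K, fun u => le_antisymm (supp_le K u fun x hx => hx u) ?_⟩
  obtain ⟨x, hx, hx'⟩ := hs.exists_touch u
  rw [← hx]
  exact le_supp K (show x ∈ K from hx') u

theorem union_of_supp {K L U I : ConvexBody E} (hU : ∀ u, supp U u = max (supp K u) (supp L u))
    (hI : ∀ u, supp I u = min (supp K u) (supp L u)) :
    (U : Set E) = (K : Set E) ∪ L ∧ (I : Set E) = (K : Set E) ∩ L := by
  constructor
  · apply Subset.antisymm
    · intro x hx
      by_contra hcon
      have hx' := fun u => le_supp U hx u
      have hK : ∃ u, supp K u < ⟪x, u⟫ := by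
        by_contra! h; exact hcon (Or.inl ((mem_iff_supp K x).2 h))
      have hL : ∃ u, supp L u < ⟪x, u⟫ := by
        by_contra! h; exact hcon (Or.inr ((mem_iff_supp L x).2 h))
      obtain ⟨u, hu⟩ := hK
      obtain ⟨v, hv⟩ := hL
      have cK := continuous_supp K
      have cL := continuous_supp L
      obtain ⟨w, -, hw1, hw2⟩ := (convex_segment (𝕜 := ℝ) u v).isPreconnected
        {w | supp K w < ⟪x, w⟫} {w | supp L w < ⟪x, w⟫}
        (isOpen_lt cK (by fun_prop)) (isOpen_lt cL (by fun_prop)) (by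
          rintro w ⟨a, b, ha, hb, hab, rfl⟩
          have h1 := (supp_sublin I).add_le (a • u) (b • v)
          rw [(supp_sublin I).smul a ha, (supp_sublin I).smul b hb] at h1
          have h2 : supp I u < ⟪x, u⟫ := by rw [hI]; exact (min_le_left _ _).trans_lt hu
          have h3 : supp I v < ⟪x, v⟫ := by rw [hI]; exact (min_le_right _ _).trans_lt hv
          have h4 : supp I (a • u + b • v) < ⟪x, a • u + b • v⟫ := by
            refine h1.trans_lt ?_
            rw [inner_add_right, inner_smul_right, inner_smul_right]
            rcases eq_or_lt_of_le ha with h | h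
            · have : b = 1 := by linarith
              subst this; rw [← h]; linarith
            · nlinarith
          rw [hI, min_lt_iff] at h4
          exact h4)
        ⟨u, left_mem_segment _ _ _, hu⟩ ⟨v, right_mem_segment _ _ _, hv⟩
      have h5 := hx' w
      rw [hU] at h5
      have := max_lt (show supp K w < ⟪x, w⟫ from hw1) (show supp L w < ⟪x, w⟫ from hw2)
      linarith
    · refine union_subset ((subset_iff_supp _ _).2 fun u => ?_) ((subset_iff_supp _ _).2 fun u => ?_)
      · rw [hU]; exact le_max_left _ _
      · rw [hU]; exact le_max_right _ _
  · apply Subset.antisymm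
    · refine subset_inter ((subset_iff_supp _ _).2 fun u => ?_) ((subset_iff_supp _ _).2 fun u => ?_)
      · rw [hI]; exact min_le_left _ _
      · rw [hI]; exact min_le_right _ _
    · rintro x ⟨h1, h2⟩
      exact (mem_iff_supp I x).2 fun u => by
        rw [hI]; exact le_min (le_supp K h1 u) (le_supp L h2 u)

theorem supp_of_union {K L U I : ConvexBody E} (hU : (U : Set E) = (K : Set E) ∪ L)
    (hI : (I : Set E) = (K : Set E) ∩ L) (u : E) :
    supp U u = max (supp K u) (supp L u) ∧ supp I u = min (supp K u) (supp L u) := by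
  have h1 : supp U u = max (supp K u) (supp L u) := by
    apply le_antisymm
    · refine supp_le U u fun x hx => ?_
      have : x ∈ (K : Set E) ∪ L := hU ▸ hx
      rcases this with h | h
      · exact (le_supp K h u).trans (le_max_left _ _)
      · exact (le_supp L h u).trans (le_max_right _ _)
    · refine max_le ?_ ?_
      · exact (subset_iff_supp K U).1 (by rw [hU]; exact subset_union_left) u
      · exact (subset_iff_supp L U).1 (by rw [hU]; exact subset_union_right) u
  refine ⟨h1, ?_⟩
  have h2 : supp I u ≤ min (supp K u) (supp L u) := le_min
    ((subset_iff_supp I K).1 (by rw [hI]; exact inter_subset_left) u)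
    ((subset_iff_supp I L).1 (by rw [hI]; exact inter_subset_right) u)
  have h3 : supp K u + supp L u ≤ supp U u + supp I u := by
    obtain ⟨x, hx, ex⟩ := exists_supp K u
    obtain ⟨y, hy, ey⟩ := exists_supp L u
    have hxU : x ∈ (U : Set E) := hU ▸ Or.inl hx
    have hyU : y ∈ (U : Set E) := hU ▸ Or.inr hy
    have hsub : segment ℝ x y ⊆ (K : Set E) ∪ L := hU ▸ U.convex.segment_subset hxU hyU
    obtain ⟨z, hz, hzK, hzL⟩ := (isPreconnected_closed_iff.1
      (convex_segment (𝕜 := ℝ) x y).isPreconnected) K L K.isClosed L.isClosed hsub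
      ⟨x, left_mem_segment _ _ _, hx⟩ ⟨y, right_mem_segment _ _ _, hy⟩
    have hzI : z ∈ (I : Set E) := hI ▸ ⟨hzK, hzL⟩
    have hw : x + y - z ∈ U := by
      obtain ⟨a, b, ha, hb, hab, rfl⟩ := hz
      have : x + y - (a • x + b • y) = b • x + a • y := by
        have : b = 1 - a := by linarith
        subst this; module
      rw [this]
      exact U.convex hxU hyU hb ha (by linarith)
    have h4 := le_supp U hw u
    have h5 := le_supp I hzI u
    rw [inner_sub_left, inner_add_left] at h4
    linarith
  have := max_add_min (supp K u) (supp L u)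
  apply le_antisymm h2
  linarith

/-- Continuous translation invariant valuations. -/
structure CTV (μ : ConvexBody E → ℂ) : Prop where
  val : ∀ K L U I : ConvexBody E, (U : Set E) = (K : Set E) ∪ L → (I : Set E) = (K : Set E) ∩ L →
    μ U + μ I = μ K + μ L
  cont : Continuous μ
  tinv : ∀ x K, μ (K + pt x) = μ K

theorem CTV.val_supp {μ : ConvexBody E → ℂ} (h : CTV μ) {K L U I : ConvexBody E}
    (hU : ∀ u, supp U u = max (supp K u) (supp L u))
    (hI : ∀ u, supp I u = min (supp K u) (supp L u)) : μ U + μ I = μ K + μ L :=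
  h.val K L U I (union_of_supp hU hI).1 (union_of_supp hU hI).2

theorem CTV.mk' {μ : ConvexBody E → ℂ}
    (h1 : ∀ K L U I : ConvexBody E, (∀ u, supp U u = max (supp K u) (supp L u)) →
      (∀ u, supp I u = min (supp K u) (supp L u)) → μ U + μ I = μ K + μ L)
    (h2 : Continuous μ) (h3 : ∀ x K, μ (K + pt x) = μ K) : CTV μ :=
  ⟨fun K L U I hU hI => h1 K L U I (fun u => (supp_of_union hU hI u).1)
    fun u => (supp_of_union hU hI u).2, h2, h3⟩

theorem dist_add_le (K L M N : ConvexBody E) : dist (K + M) (L + N) ≤ dist K L + dist M N := by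
  refine dist_le_of_supp (by positivity) fun u hu => ?_
  have h1 := abs_supp_sub_le K L u
  have h2 := abs_supp_sub_le M N u
  rw [hu, mul_one] at h1 h2
  rw [supp_add, supp_add, add_sub_add_comm]
  exact (abs_add_le _ _).trans (add_le_add h1 h2)

instance : ContinuousAdd (ConvexBody E) := by
  refine ⟨(LipschitzWith.of_dist_le_mul (K := 2) fun x y => ?_).continuous⟩
  refine (dist_add_le _ _ _ _).trans ?_
  rw [Prod.dist_eq]
  have h1 := le_max_left (dist x.1 y.1) (dist x.2 y.2)
  have h2 := le_max_right (dist x.1 y.1) (dist x.2 y.2)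
  simp only [NNReal.coe_ofNat]
  linarith

theorem dist_seg_le (v w : E) : dist (seg v) (seg w) ≤ ‖v - w‖ := by
  refine dist_le_of_supp (norm_nonneg _) fun u hu => ?_
  rw [supp_seg, supp_seg]
  rw [max_comm, max_comm 0 ⟪w, u⟫]
  refine (abs_max_sub_max_le_abs _ _ _).trans ?_
  rw [← inner_sub_left]
  refine (abs_real_inner_le_norm _ _).trans ?_
  rw [hu, mul_one]

theorem continuous_seg : Continuous (seg : E → ConvexBody E) := by
  refine (LipschitzWith.of_dist_le_mul (K := 1) fun x y => ?_).continuous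
  rw [dist_eq_norm]; simpa using dist_seg_le x y

/-- Shift of a functional by a body. -/
def shift (M : ConvexBody E) (μ : ConvexBody E → ℂ) (K : ConvexBody E) : ℂ := μ (K + M)

theorem CTV.shift {μ : ConvexBody E → ℂ} (h : CTV μ) (M : ConvexBody E) : CTV (shift M μ) := by
  refine CTV.mk' (fun K L U I hU hI => ?_) ?_ fun x K => ?_
  · refine h.val_supp (fun u => ?_) fun u => ?_
    · rw [supp_add, supp_add, supp_add, hU, max_add_add_right]
    · rw [supp_add, supp_add, supp_add, hI, min_add_add_right]
  · exact h.cont.comp (continuous_id.add continuous_const)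
  · change μ (K + pt x + M) = μ (K + M)
    rw [add_right_comm, h.tinv]

theorem CTV.sub {μ ν : ConvexBody E → ℂ} (h : CTV μ) (k : CTV ν) : CTV (fun K => μ K - ν K) :=
  ⟨fun K L U I hU hI => by linear_combination h.val K L U I hU hI - k.val K L U I hU hI,
   h.cont.sub k.cont, fun x K => by rw [h.tinv, k.tinv]⟩

theorem CTV.const_mul {μ : ConvexBody E → ℂ} (h : CTV μ) (c : ℂ) : CTV (fun K => c * μ K) :=
  ⟨fun K L U I hU hI => by linear_combination c * h.val K L U I hU hI,
   h.cont.const_smul c, fun x K => by rw [h.tinv]⟩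

theorem CTV.const (c : ℂ) : CTV (fun _ : ConvexBody E => c) :=
  ⟨fun _ _ _ _ _ _ => rfl, continuous_const, fun _ _ => rfl⟩

end FD

end

section

variable {E : Type*} [NormedAddCommGroup E] [InnerProductSpace ℝ E] [FiniteDimensional ℝ E]

/-- The difference operator along a segment. -/
def dl (v : E) (μ : ConvexBody E → ℂ) (K : ConvexBody E) : ℂ := μ (K + seg v) - μ K

theorem CTV.dl {μ : ConvexBody E → ℂ} (h : CTV μ) (v : E) : CTV (dl v μ) := (h.shift (seg v)).sub h

theorem dl_comm (v w : E) (μ : ConvexBody E → ℂ) : dl v (dl w μ) = dl w (dl v μ) := by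
  funext K
  simp only [dl]
  rw [add_right_comm]; ring

theorem dl_zero_vec (μ : ConvexBody E → ℂ) : dl 0 μ = 0 := by
  funext K; simp [dl, seg_zero]

theorem dl_zero_fun (v : E) : dl v (0 : ConvexBody E → ℂ) = 0 := by
  funext K; simp [dl]

theorem seg_neg (v : E) : seg (-v) + pt v = seg v := by
  refine supp_inj fun u => ?_
  rw [supp_add, supp_seg, supp_seg, supp_pt, inner_neg_left, ← max_add_add_right]
  simp [max_comm]

theorem CTV.dl_neg {μ : ConvexBody E → ℂ} (h : CTV μ) (v : E) : _root_.dl (-v) μ = _root_.dl v μ := by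
  funext K
  simp only [_root_.dl]
  rw [← seg_neg v, ← add_assoc, h.tinv]

theorem CTV.seg_add_nonneg {μ : ConvexBody E → ℂ} (h : CTV μ) (v : E) {s t : ℝ} (hs : 0 ≤ s)
    (ht : 0 ≤ t) (K : ConvexBody E) :
    μ (K + seg ((s + t) • v)) + μ K = μ (K + seg (s • v)) + μ (K + seg (t • v)) := by
  have := h.val_supp (K := K + seg (s • v)) (L := K + seg (t • v) + pt (s • v))
    (U := K + seg ((s + t) • v)) (I := K + pt (s • v)) (fun u => ?_) fun u => ?_
  · rwa [h.tinv, h.tinv] at this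
  · simp only [supp_add, supp_seg, supp_pt, inner_smul_left, conj_trivial]
    set a := ⟪v, u⟫
    rcases le_total 0 a with ha | ha
    · have h1 : 0 ≤ s * a := by positivity
      have h2 : 0 ≤ t * a := by positivity
      rw [max_eq_right (by nlinarith : 0 ≤ (s + t) * a), max_eq_right h1, max_eq_right h2,
        max_eq_right (by linarith)]
      ring
    · have h1 : s * a ≤ 0 := by nlinarith
      have h2 : t * a ≤ 0 := by nlinarith
      rw [max_eq_left (by nlinarith : (s + t) * a ≤ 0), max_eq_left h1, max_eq_left h2,
        max_eq_left (by linarith)]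
  · simp only [supp_add, supp_seg, supp_pt, inner_smul_left, conj_trivial]
    set a := ⟪v, u⟫
    rcases le_total 0 a with ha | ha
    · have h1 : 0 ≤ s * a := by positivity
      have h2 : 0 ≤ t * a := by positivity
      rw [max_eq_right h1, max_eq_right h2, min_eq_left (by linarith)]
    · have h1 : s * a ≤ 0 := by nlinarith
      have h2 : t * a ≤ 0 := by nlinarith
      rw [max_eq_left h1, max_eq_left h2, min_eq_right (by linarith)]
      ring

theorem CTV.dl_smul {μ : ConvexBody E → ℂ} (h : CTV μ) (t : ℝ) (v : E) (K : ConvexBody E) :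
    _root_.dl (t • v) μ K = |t| * _root_.dl v μ K := by
  have key : ∀ s : ℝ, 0 ≤ s → _root_.dl (s • v) μ K = s * _root_.dl v μ K := by
    let g : ℝ → ℂ := fun s => _root_.dl (s • v) μ K
    have gadd : ∀ s t : ℝ, 0 ≤ s → 0 ≤ t → g (s + t) = g s + g t := fun s t hs ht => by
      have := h.seg_add_nonneg v hs ht K
      simp only [g, _root_.dl]
      linear_combination this
    have gc : Continuous g := by
      have : Continuous fun s : ℝ => μ (K + seg (s • v)) :=
        h.cont.comp (continuous_const.add (continuous_seg.comp (by fun_prop)))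
      exact this.sub continuous_const
    let G : ℝ →+ ℂ := AddMonoidHom.mk' (fun s => g (max s 0) - g (max (-s) 0)) fun s t => by
      have e1 := gadd (max (s + t) 0 + max (-s) 0) (max (-t) 0) (by positivity) (by positivity)
      have e2 := gadd (max (s + t) 0) (max (-s) 0) (by positivity) (by positivity)
      have e3 := gadd (max (-(s + t)) 0 + max s 0) (max t 0) (by positivity) (by positivity)
      have e4 := gadd (max (-(s + t)) 0) (max s 0) (by positivity) (by positivity)
      have e5 : max (s + t) 0 + max (-s) 0 + max (-t) 0 = max (-(s + t)) 0 + max s 0 + max t 0 := by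
        have f : ∀ x : ℝ, max x 0 - max (-x) 0 = x := fun x => by
          rcases le_total 0 x with hx | hx
          · rw [max_eq_left hx, max_eq_right (by linarith)]; ring
          · rw [max_eq_right hx, max_eq_left (by linarith)]; ring
        linarith [f s, f t, f (s + t)]
      rw [e5] at e1
      linear_combination e3 + e4 - e1 - e2
    intro s hs
    have Gc : Continuous G := by
      change Continuous fun s => g (max s 0) - g (max (-s) 0)
      fun_prop
    have h1 := map_real_smul G Gc s 1
    have g0 : g 0 = 0 := by simp [g, dl_zero_vec]
    have e : ∀ s : ℝ, 0 ≤ s → G s = g s := fun s hs => by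
      change g (max s 0) - g (max (-s) 0) = g s
      rw [max_eq_left hs, max_eq_right (by linarith), g0, sub_zero]
    rw [smul_eq_mul, mul_one, e s hs, e 1 zero_le_one] at h1
    simpa [g] using h1
  rcases le_total 0 t with ht | ht
  · rw [abs_of_nonneg ht, key t ht]
  · have := key (-t) (by linarith)
    rw [neg_smul, h.dl_neg] at this
    rw [this, abs_of_nonpos ht]

theorem CTV.dl_add_one {μ : ConvexBody E → ℂ} (h : CTV μ) (v w : E) :
    _root_.dl v (_root_.dl (w + v) μ) = _root_.dl v (_root_.dl w μ) := by
  funext K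
  obtain ⟨T, hT⟩ := (((supp_sublin (seg v)).sup (supp_sublin (seg w))).sup
    (supp_sublin (pt (w + (2 : ℝ) • v)))).exists_body
  obtain ⟨D, hD⟩ := ((supp_sublin (seg w)).sup (supp_sublin (pt (w + v)))).exists_body
  have h0 := (h.shift K).val_supp (K := seg w + seg v) (L := D + pt v) (U := T)
    (I := seg w + pt v) (fun u => ?_) fun u => ?_
  have h1 := (h.shift K).val_supp (K := seg (w + v) + seg v) (L := D) (U := T)
    (I := seg (w + v)) (fun u => ?_) fun u => ?_
  · rw [(h.shift K).tinv, (h.shift K).tinv] at h0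
    simp only [_root_.shift] at h0 h1
    simp only [_root_.dl]
    have e1 : K + seg v + seg (w + v) = seg (w + v) + seg v + K := by abel
    have e2 : K + seg v + seg w = seg w + seg v + K := by abel
    rw [e1, e2, add_comm K (seg (w + v)), add_comm K (seg w)]
    linear_combination h0 - h1
  all_goals
    simp only [supp_add, hT, hD, supp_seg, supp_pt, inner_add_left, inner_smul_left, conj_trivial]
    set a := ⟪v, u⟫
    set b := ⟪w, u⟫
    grind

end

section

variable {E : Type*} [NormedAddCommGroup E] [InnerProductSpace ℝ E] [FiniteDimensional ℝ E]

theorem CTV.dl_add {μ : ConvexBody E → ℂ} (h : CTV μ) (v w : E) (t : ℝ) :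
    _root_.dl v (_root_.dl (w + t • v) μ) = _root_.dl v (_root_.dl w μ) := by
  rcases eq_or_ne t 0 with rfl | ht
  · simp
  · have h1 := h.dl_add_one (t • v) w
    funext K
    have h2 := congrFun h1 K
    rw [(h.dl _).dl_smul, (h.dl _).dl_smul] at h2
    exact mul_left_cancel₀ (by simpa using ht) h2

/-- Iterated segment differences. -/
def dls (L : List E) (μ : ConvexBody E → ℂ) : ConvexBody E → ℂ := L.foldr dl μ

@[simp] theorem dls_nil (μ : ConvexBody E → ℂ) : dls [] μ = μ := rfl

@[simp] theorem dls_cons (v : E) (L : List E) (μ : ConvexBody E → ℂ) :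
    dls (v :: L) μ = dl v (dls L μ) := rfl

theorem dls_append (L M : List E) (μ : ConvexBody E → ℂ) : dls (L ++ M) μ = dls L (dls M μ) := by
  simp [dls]

theorem dls_perm {L M : List E} (p : L.Perm M) (μ : ConvexBody E → ℂ) : dls L μ = dls M μ := by
  induction p with
  | nil => rfl
  | cons x _ ih => simp [ih]
  | swap x y l => exact dl_comm _ _ _
  | trans _ _ h1 h2 => rw [h1, h2]

theorem CTV.dls {μ : ConvexBody E → ℂ} (h : CTV μ) (L : List E) : CTV (dls L μ) := by
  induction L with
  | nil => exact h
  | cons v L ih => exact ih.dl v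

theorem dls_zero_fun (L : List E) : dls L (0 : ConvexBody E → ℂ) = 0 := by
  induction L with
  | nil => rfl
  | cons v L ih => rw [dls_cons, ih, dl_zero_fun]

theorem dls_dl (L : List E) (v : E) (μ : ConvexBody E → ℂ) : dls L (dl v μ) = dl v (dls L μ) := by
  rw [← dls_cons, ← dls_perm (List.perm_append_singleton v L), dls_append]; rfl

theorem CTV.dl_dls_add_of_mem {μ : ConvexBody E → ℂ} (h : CTV μ) {L : List E} {v : E} (hv : v ∈ L)
    (w : E) (t : ℝ) : _root_.dl (w + t • v) (_root_.dls L μ) = _root_.dl w (_root_.dls L μ) := by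
  obtain ⟨M, hM⟩ : ∃ M, L.Perm (v :: M) := by
    obtain ⟨s, t, rfl⟩ := List.append_of_mem hv
    exact ⟨s ++ t, List.perm_middle⟩
  rw [dls_perm hM, dls_cons, dl_comm, (h.dls M).dl_add, dl_comm]

theorem CTV.dl_dls_add_of_span {μ : ConvexBody E → ℂ} (h : CTV μ) {L : List E} {v : E}
    (hv : v ∈ Submodule.span ℝ {x | x ∈ L}) (w : E) :
    _root_.dl (w + v) (_root_.dls L μ) = _root_.dl w (_root_.dls L μ) := by
  have : ∀ (t : ℝ) w, _root_.dl (w + t • v) (_root_.dls L μ) = _root_.dl w (_root_.dls L μ) := by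
    induction hv using Submodule.span_induction with
    | mem x hx => exact fun t w => h.dl_dls_add_of_mem hx w t
    | zero => simp
    | add x y _ _ hx hy =>
      intro t w
      rw [smul_add, ← add_assoc, hy, hx]
    | smul a x _ hx =>
      intro t w
      rw [smul_smul, hx]
  simpa using this 1 w

theorem CTV.dl_dls_of_span {μ : ConvexBody E → ℂ} (h : CTV μ) {L : List E} {v : E}
    (hv : v ∈ Submodule.span ℝ {x | x ∈ L}) : _root_.dl v (_root_.dls L μ) = 0 := by
  have := h.dl_dls_add_of_span hv 0
  rwa [zero_add, dl_zero_vec] at this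

theorem CTV.length_le_of_dls_ne {μ : ConvexBody E → ℂ} (h : CTV μ) (L : List E)
    (hL : _root_.dls L μ ≠ 0) : L.length ≤ Module.finrank ℝ (Submodule.span ℝ {x | x ∈ L}) := by
  induction L with
  | nil => simp
  | cons v L ih =>
    have h1 := ih fun h0 => hL (by rw [dls_cons, h0, dl_zero_fun])
    have h2 : v ∉ Submodule.span ℝ {x | x ∈ L} := fun hv => hL (h.dl_dls_of_span hv)
    have h3 : Submodule.span ℝ {x | x ∈ L} < Submodule.span ℝ {x | x ∈ v :: L} := by
      refine lt_of_le_of_ne (Submodule.span_mono fun x hx => List.mem_cons_of_mem _ hx) fun he => ?_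
      exact h2 (he ▸ Submodule.subset_span List.mem_cons_self)
    have := Submodule.finrank_lt_finrank_of_lt h3
    simp only [List.length_cons]; omega

theorem CTV.dls_eq_zero {μ : ConvexBody E → ℂ} (h : CTV μ) (L : List E)
    (hL : Module.finrank ℝ E < L.length) : _root_.dls L μ = 0 := by
  by_contra h0
  have := h.length_le_of_dls_ne L h0
  have := Submodule.finrank_le (Submodule.span ℝ {x | x ∈ L})
  omega

/-- The zonotope spanned by a list of vectors. -/
def zon (L : List E) : ConvexBody E := (L.map seg).sum

@[simp] theorem zon_nil : zon ([] : List E) = 0 := rfl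

@[simp] theorem zon_cons (v : E) (L : List E) : zon (v :: L) = seg v + zon L := by simp [zon]

theorem zon_append (L M : List E) : zon (L ++ M) = zon L + zon M := by simp [zon]

theorem eval_zon_of_dls {μ : ConvexBody E → ℂ} (h : ∀ L, dls L μ 0 = 0) (L : List E) :
    μ (zon L) = 0 := by
  have : ∀ M, dls M μ (zon L) = 0 := by
    induction L with
    | nil => exact h
    | cons v L ih =>
      intro M
      have h1 := ih (v :: M)
      rw [dls_cons] at h1
      simp only [dl] at h1
      rw [ih M, sub_zero] at h1
      rw [zon_cons, add_comm, h1]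
  exact this []

/-- A function killed by all `k`-fold segment differences. -/
def Nil (k : ℕ) (μ : ConvexBody E → ℂ) : Prop := ∀ L : List E, L.length = k → dls L μ = 0

theorem dl_add_fun (v : E) (μ ν : ConvexBody E → ℂ) : dl v (μ + ν) = dl v μ + dl v ν :=
  fwdDiff_add _ _ _

theorem dls_add_fun (L : List E) (μ ν : ConvexBody E → ℂ) : dls L (μ + ν) = dls L μ + dls L ν := by
  induction L with
  | nil => rfl
  | cons v L ih => rw [dls_cons, ih, dl_add_fun]; rfl

theorem Nil.succ {k : ℕ} {μ : ConvexBody E → ℂ} (h : Nil k μ) : Nil (k + 1) μ := by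
  intro L hL
  cases L with
  | nil => simp at hL
  | cons v L => rw [dls_cons, h L (by simpa using hL), dl_zero_fun]

theorem Nil.fwdDiff_zon {k : ℕ} {μ : ConvexBody E → ℂ} (h : Nil (k + 1) μ) (L : List E) :
    Nil k (fwdDiff (zon L) μ) := by
  induction L generalizing μ with
  | nil =>
    intro M hM
    have : fwdDiff (zon []) μ = (0 : ConvexBody E → ℂ) := by funext K; simp [fwdDiff]
    rw [this, dls_zero_fun]
  | cons v L ih =>
    have h1 : Nil k (dl v μ) := fun M hM => by
      rw [dls_dl, ← dls_cons]; exact h _ (by simp [hM])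
    have h2 : Nil (k + 1) (μ + dl v μ) := fun M hM => by
      rw [dls_add_fun, h M hM, h1.succ M hM, add_zero]
    intro M hM
    have h3 : fwdDiff (zon (v :: L)) μ = fwdDiff (zon L) (μ + dl v μ) + dl v μ := by
      funext K
      simp only [fwdDiff, dl, Pi.add_apply, zon_cons]
      rw [add_comm (seg v), ← add_assoc]
      ring
    rw [h3, dls_add_fun, ih h2 M hM, h1 M hM, add_zero]

theorem Nil.fwdDiff_iter {k : ℕ} {μ : ConvexBody E → ℂ} (h : Nil k μ) (L : List E) :
    (fwdDiff (zon L))^[k] μ = 0 := by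
  induction k generalizing μ with
  | zero => exact h [] rfl
  | succ k ih => rw [Function.iterate_succ_apply]; exact ih (h.fwdDiff_zon L)

/-- Limits of zonotopes. -/
def Zonoid : Set (ConvexBody E) := closure (range zon)

theorem zonoid_add {K L : ConvexBody E} (hK : K ∈ Zonoid) (hL : L ∈ Zonoid) :
    K + L ∈ (Zonoid : Set (ConvexBody E)) := by
  refine map_mem_closure₂ continuous_add hK hL ?_
  rintro _ ⟨a, rfl⟩ _ ⟨b, rfl⟩
  exact ⟨a ++ b, zon_append a b⟩

theorem zonoid_zero : (0 : ConvexBody E) ∈ (Zonoid : Set (ConvexBody E)) :=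
  subset_closure ⟨[], rfl⟩

theorem zonoid_nsmul {K : ConvexBody E} (hK : K ∈ Zonoid) (k : ℕ) :
    k • K ∈ (Zonoid : Set (ConvexBody E)) := by
  induction k with
  | zero => simpa using zonoid_zero
  | succ k ih => rw [succ_nsmul]; exact zonoid_add ih hK

theorem CTV.fwdDiff_iter_zonoid {μ : ConvexBody E → ℂ} (h : CTV μ) {Z : ConvexBody E}
    (hZ : Z ∈ Zonoid) (K : ConvexBody E) :
    (fwdDiff Z)^[Module.finrank ℝ E + 1] μ K = 0 := by
  have hc : IsClosed {Z : ConvexBody E | (fwdDiff Z)^[Module.finrank ℝ E + 1] μ K = 0} := by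
    simp only [fwdDiff_iter_eq_sum_shift]
    refine isClosed_eq ?_ continuous_const
    refine continuous_finsetSum _ fun i _ => Continuous.const_smul ?_ _
    exact h.cont.comp (continuous_const.add (continuous_nsmul i))
  refine closure_minimal ?_ hc hZ
  rintro _ ⟨L, rfl⟩
  have : Nil (Module.finrank ℝ E + 1) μ := fun M hM => h.dls_eq_zero M (by omega)
  exact congrFun (this.fwdDiff_iter L) K

theorem CTV.eval_zonoid {μ : ConvexBody E → ℂ} (h : CTV μ) (h0 : ∀ L, μ (zon L) = 0)
    {Z : ConvexBody E} (hZ : Z ∈ Zonoid) : μ Z = 0 :=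
  closure_minimal (t := {Z | μ Z = 0}) (by rintro _ ⟨L, rfl⟩; exact h0 L)
    (isClosed_eq h.cont continuous_const) hZ

/-- A function vanishing on zonotopes vanishes on generalized zonoids. -/
theorem CTV.eval_gen_zonoid {μ : ConvexBody E → ℂ} (h : CTV μ) (h0 : ∀ L, μ (zon L) = 0)
    {K Y Z : ConvexBody E} (hY : Y ∈ Zonoid) (hZ : Z ∈ Zonoid) (e : K + Y = Z) : μ K = 0 := by
  have h1 := h.fwdDiff_iter_zonoid hY K
  rw [fwdDiff_iter_eq_sum_shift, Finset.sum_eq_single 0] at h1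
  · rcases neg_one_pow_eq_or ℤ (Module.finrank ℝ E + 1) with h2 | h2 <;> simpa [h2] using h1
  · intro i _ hi
    obtain ⟨j, rfl⟩ := Nat.exists_eq_succ_of_ne_zero hi
    rw [succ_nsmul', ← add_assoc, e, h.eval_zonoid h0 (zonoid_add hZ (zonoid_nsmul hY j)),
      smul_zero]
  · simp

end

section

variable {E : Type*} [NormedAddCommGroup E] [InnerProductSpace ℝ E]

/-- Even translation invariant valuations on compact convex sets vanishing on symmetric sets. -/
structure SymNull (ν : Set E → ℂ) : Prop where
  val : ∀ A B : Set E, IsCompact A → IsCompact B → Convex ℝ A → Convex ℝ B → Convex ℝ (A ∪ B) →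
    ν (A ∪ B) + ν (A ∩ B) = ν A + ν B
  refl : ∀ (c : E) (A : Set E), IsCompact A → Convex ℝ A → ν ((fun x => c - x) '' A) = ν A
  sym : ∀ (c : E) (A : Set E), IsCompact A → Convex ℝ A → (fun x => c - x) '' A = A → ν A = 0

theorem SymNull.empty {ν : Set E → ℂ} (h : SymNull ν) : ν ∅ = 0 :=
  h.sym 0 ∅ isCompact_empty convex_empty (by simp)

theorem SymNull.trans {ν : Set E → ℂ} (h : SymNull ν) (c : E) {A : Set E} (hA : IsCompact A)
    (hc : Convex ℝ A) : ν ((fun x => c + x) '' A) = ν A := by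
  have h1 := h.refl 0 A hA hc
  have h2 := h.refl c ((fun x => 0 - x) '' A) (hA.image (by fun_prop)) ?_
  · rw [image_image] at h2
    rw [← h1, ← h2]
    simp
  · have : (fun x : E => 0 - x) '' A = -A := by ext; simp
    rw [this]; exact hc.neg

theorem image_inter_of_convex_union {F : Type*} [NormedAddCommGroup F] [NormedSpace ℝ F]
    (T : F →ₗ[ℝ] E) {A B : Set F} (hA : IsClosed A) (hB : IsClosed B)
    (hc : Convex ℝ (A ∪ B)) : T '' (A ∩ B) = T '' A ∩ T '' B := by
  refine subset_antisymm (image_inter_subset _ _ _) ?_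
  rintro y ⟨⟨a, ha, rfl⟩, b, hb, hab⟩
  have h1 : segment ℝ a b ⊆ A ∪ B := hc.segment_subset (Or.inl ha) (Or.inr hb)
  have h2 := (convex_segment (𝕜 := ℝ) a b).isPreconnected
  rw [isPreconnected_closed_iff] at h2
  obtain ⟨c, hc1, hc2⟩ := h2 A B hA hB h1 ⟨a, left_mem_segment ℝ a b, ha⟩
    ⟨b, right_mem_segment ℝ a b, hb⟩
  refine ⟨c, hc2, ?_⟩
  obtain ⟨s, t, hs, ht, hst, rfl⟩ := hc1
  rw [map_add, map_smul, map_smul, hab, ← add_smul, hst, one_smul]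

theorem SymNull.val_map {ν : Set E → ℂ} (h : SymNull ν) {ι : Type*} [Fintype ι]
    (T : (ι → ℝ) →ₗ[ℝ] E) {A B : Set (ι → ℝ)} (hA : IsCompact A) (hB : IsCompact B)
    (cA : Convex ℝ A) (cB : Convex ℝ B) (hc : Convex ℝ (A ∪ B)) :
    ν (T '' (A ∪ B)) + ν (T '' (A ∩ B)) = ν (T '' A) + ν (T '' B) := by
  have hT : Continuous T := LinearMap.continuous_of_finiteDimensional T
  rw [image_inter_of_convex_union T hA.isClosed hB.isClosed hc, image_union]
  exact h.val _ _ (hA.image hT) (hB.image hT) (cA.linear_image T) (cB.linear_image T)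
    (by rw [← image_union]; exact hc.linear_image T)

variable {ι : Type*} [Fintype ι]

/-- The cutting identity for a compact convex set along an affine hyperplane. -/
theorem SymNull.cut {ν : Set E → ℂ} (h : SymNull ν)
    (T : (ι → ℝ) →ₗ[ℝ] E) {A : Set (ι → ℝ)} (hA : IsCompact A) (cA : Convex ℝ A)
    (f : (ι → ℝ) →ₗ[ℝ] ℝ) (c : ℝ) :
    ν (T '' A) + ν (T '' (A ∩ {w | f w = c})) =
      ν (T '' (A ∩ {w | f w ≤ c})) + ν (T '' (A ∩ {w | c ≤ f w})) := by
  have hf : Continuous f := LinearMap.continuous_of_finiteDimensional f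
  have e1 : A ∩ {w | f w ≤ c} ∪ A ∩ {w | c ≤ f w} = A := by
    ext w; simp only [mem_union, mem_inter_iff, mem_ofPred_eq]
    have := le_total (f w) c
    tauto
  have e2 : A ∩ {w | f w ≤ c} ∩ (A ∩ {w | c ≤ f w}) = A ∩ {w | f w = c} := by
    ext w; simp only [mem_inter_iff, mem_ofPred_eq, le_antisymm_iff]
    tauto
  have := h.val_map T (A := A ∩ {w | f w ≤ c}) (B := A ∩ {w | c ≤ f w})
    (hA.inter_right (isClosed_le hf continuous_const))
    (hA.inter_right (isClosed_le continuous_const hf))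
    (cA.inter (convex_halfSpace_le f.isLinear c)) (cA.inter (convex_halfSpace_ge f.isLinear c))
    (by rwa [e1])
  rwa [e1, e2] at this

/-- The face of the standard simplex with vertex set `s`. -/
def face (s : Finset ι) : Set (ι → ℝ) := {w | (∀ k, 0 ≤ w k) ∧ (∀ k ∉ s, w k = 0) ∧ ∑ k, w k = 1}

/-- The unit cube with coordinates in `s`. -/
def cube (s : Finset ι) : Set (ι → ℝ) := {w | (∀ k, 0 ≤ w k ∧ w k ≤ 1) ∧ (∀ k ∉ s, w k = 0)}

theorem isCompact_cube (s : Finset ι) : IsCompact (cube s) := by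
  refine IsCompact.of_isClosed_subset (isCompact_Icc (a := (0 : ι → ℝ)) (b := 1)) ?_ ?_
  · have : cube s = (⋂ k, {w | 0 ≤ w k ∧ w k ≤ 1}) ∩ ⋂ k ∈ {k | k ∉ s}, {w : ι → ℝ | w k = 0} := by
      ext w; simp [cube]
    rw [this]
    refine IsClosed.inter (isClosed_iInter fun k => ?_) (isClosed_biInter fun k _ => ?_)
    · exact (isClosed_le continuous_const (continuous_apply k)).inter
        (isClosed_le (continuous_apply k) continuous_const)
    · exact isClosed_eq (continuous_apply k) continuous_const
  · exact fun w hw => ⟨fun k => (hw.1 k).1, fun k => (hw.1 k).2⟩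

theorem convex_cube (s : Finset ι) : Convex ℝ (cube s) := by
  intro x hx y hy a b ha hb hab
  refine ⟨fun k => ?_, fun k hk => ?_⟩
  · have := hx.1 k; have := hy.1 k
    simp only [Pi.add_apply, Pi.smul_apply, smul_eq_mul]
    constructor <;> nlinarith
  · simp [hx.2 k hk, hy.2 k hk]

/-- Sum of coordinates. -/
def csum : (ι → ℝ) →ₗ[ℝ] ℝ := ∑ k, LinearMap.proj k

theorem csum_apply (w : ι → ℝ) : csum w = ∑ k, w k := by simp [csum]

theorem face_eq (s : Finset ι) : face s = cube s ∩ {w | csum w = 1} := by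
  ext w
  simp only [face, cube, mem_ofPred_eq, mem_inter_iff, csum_apply]
  constructor
  · rintro ⟨h1, h2, h3⟩
    exact ⟨⟨fun k => ⟨h1 k, h3 ▸ Finset.single_le_sum (fun i _ => h1 i) (Finset.mem_univ k)⟩, h2⟩, h3⟩
  · rintro ⟨⟨h1, h2⟩, h3⟩
    exact ⟨fun k => (h1 k).1, h2, h3⟩

theorem continuous_csum : Continuous (csum : (ι → ℝ) →ₗ[ℝ] ℝ) :=
  LinearMap.continuous_of_finiteDimensional _

theorem isCompact_face (s : Finset ι) : IsCompact (face s) := by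
  rw [face_eq]
  exact (isCompact_cube s).inter_right (isClosed_eq continuous_csum continuous_const)

theorem convex_face (s : Finset ι) : Convex ℝ (face s) := by
  rw [face_eq]
  exact (convex_cube s).inter (convex_hyperplane csum.isLinear 1)

theorem face_empty : face (∅ : Finset ι) = ∅ := by
  ext w
  simp only [face, mem_ofPred_eq, mem_empty_iff_false, iff_false]
  rintro ⟨_, h2, h3⟩
  simp [h2] at h3

/-- Reflection of the cube. -/
theorem cube_refl (s : Finset ι) {w : ι → ℝ} (hw : w ∈ cube s) :
    (fun k => (s : Set ι).indicator 1 k - w k) ∈ cube s := by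
  refine ⟨fun k => ?_, fun k hk => ?_⟩
  · have := hw.1 k
    by_cases hk : k ∈ s
    · simp [hk]; constructor <;> linarith
    · simp [hk, hw.2 k hk]
  · simp [hk, hw.2 k hk]

theorem csum_refl (s : Finset ι) (w : ι → ℝ) :
    csum (fun k => (s : Set ι).indicator 1 k - w k) = s.card - csum w := by
  classical
  simp [csum_apply, Finset.sum_sub_distrib, Set.indicator_apply]

theorem refl_image (T : (ι → ℝ) →ₗ[ℝ] E) (s : Finset ι) (P Q : ℝ → Prop)
    (h : ∀ x, Q x ↔ P (s.card - x)) :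
    (fun x => T ((s : Set ι).indicator 1) - x) '' (T '' (cube s ∩ {w | P (csum w)})) =
      T '' (cube s ∩ {w | Q (csum w)}) := by
  have hr : ∀ w : ι → ℝ, (fun k => (s : Set ι).indicator 1 k - w k) =
      (s : Set ι).indicator 1 - w := fun w => rfl
  rw [image_image]
  ext y
  constructor
  · rintro ⟨w, ⟨hw, hp⟩, rfl⟩
    refine ⟨_, ⟨cube_refl s hw, ?_⟩, ?_⟩
    · rw [mem_ofPred_eq, csum_refl, h]; simpa using hp
    · simp only [hr, map_sub]
  · rintro ⟨w, ⟨hw, hp⟩, rfl⟩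
    refine ⟨_, ⟨cube_refl s hw, ?_⟩, ?_⟩
    · rw [mem_ofPred_eq, csum_refl, ← h]; exact hp
    · simp only [hr, map_sub, sub_sub_cancel]

theorem SymNull.simplex {ν : Set E → ℂ} (h : SymNull ν) (m : ℕ) :
    ∀ (s : Finset ι) (T : (ι → ℝ) →ₗ[ℝ] E), s.card = m → ν (T '' face s) = 0 := by
  classical
  induction m with
  | zero =>
    intro s T hs
    rw [Finset.card_eq_zero.1 hs, face_empty, image_empty, h.empty]
  | succ m ih =>
    intro s T hs
    obtain ⟨j, hj⟩ : s.Nonempty := Finset.card_pos.1 (by omega)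
    set s' := s.erase j with hs'
    have hcard : s'.card = m := by rw [Finset.card_erase_of_mem hj]; omega
    let T' : (ι → ℝ) →ₗ[ℝ] E := T - csum.smulRight (T (Pi.single j 1))
    have hT' : ∀ w, T' w = T w - csum w • T (Pi.single j 1) := fun w => rfl
    have cT : Continuous T' := LinearMap.continuous_of_finiteDimensional T'
    have key : T '' face s = (fun x => T (Pi.single j 1) + x) '' (T' '' (cube s' ∩ {w | csum w ≤ 1})) := by
      rw [image_image]
      ext y
      constructor
      · rintro ⟨w, hw, rfl⟩
        have hw1 := hw
        rw [face_eq] at hw1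
        obtain ⟨⟨hw1, hw2⟩, hw3⟩ := hw1
        refine ⟨w - Pi.single j (w j), ⟨⟨fun k => ?_, fun k hk => ?_⟩, ?_⟩, ?_⟩
        · by_cases hk : k = j
          · subst hk; simp
          · simpa [hk] using hw1 k
        · by_cases hk2 : k = j
          · subst hk2; simp
          · simp [hk2]; exact hw2 k fun hk3 => hk (Finset.mem_erase.2 ⟨hk2, hk3⟩)
        · have : csum w = 1 := hw3
          rw [mem_ofPred_eq, map_sub, this, csum_apply (Pi.single j (w j))]
          simpa using (hw1 j).1
        · have : csum w = 1 := hw3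
          have e : Pi.single j (w j) = w j • (Pi.single j 1 : ι → ℝ) := by
            ext k; by_cases hk : k = j <;> simp [hk]
          have e2 : csum (Pi.single j 1 : ι → ℝ) = 1 := by simp [csum_apply]
          beta_reduce
          rw [hT', map_sub, map_sub, this, e, map_smul, map_smul, e2]
          simp only [smul_eq_mul, mul_one]
          module
      · rintro ⟨w, ⟨⟨hw1, hw2⟩, hw3⟩, rfl⟩
        have hw3 : csum w ≤ 1 := hw3
        have e2 : csum (Pi.single j 1 : ι → ℝ) = 1 := by simp [csum_apply]
        refine ⟨w + (1 - csum w) • Pi.single j 1, ⟨fun k => ?_, fun k hk => ?_, ?_⟩, ?_⟩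
        · have := (hw1 k).1
          by_cases hk : k = j
          · subst hk; simp; linarith
          · simpa [hk] using this
        · have hk2 : k ≠ j := fun e => hk (e ▸ hj)
          simp [hk2]
          exact hw2 k fun h => hk (Finset.mem_of_mem_erase h)
        · rw [← csum_apply, map_add, map_smul, e2]; simp
        · beta_reduce; rw [map_add, map_smul, hT']; module
    have hcl : ∀ c : ℝ, IsClosed {w : ι → ℝ | csum w ≤ c} := fun c =>
      isClosed_le continuous_csum continuous_const
    have hcg : ∀ c : ℝ, IsClosed {w : ι → ℝ | c ≤ csum w} := fun c =>
      isClosed_le continuous_const continuous_csum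
    have kA := (isCompact_cube s').inter_right (hcl 1)
    have vA := (convex_cube s').inter (convex_halfSpace_le csum.isLinear 1)
    have kB := (isCompact_cube s').inter_right (hcg 1)
    have vB := (convex_cube s').inter (convex_halfSpace_ge csum.isLinear 1)
    rw [key, h.trans _ (kA.image cT) (vA.linear_image T')]
    have hQ : ν (T' '' cube s') = 0 := by
      have := refl_image T' s' (fun _ => True) (fun _ => True) (by simp)
      simp only [ofPred_true, inter_univ] at this
      exact h.sym _ _ ((isCompact_cube s').image cT) ((convex_cube s').linear_image T') this
    rcases Nat.lt_or_ge m 2 with hm | hm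
    · have : cube s' ∩ {w | csum w ≤ 1} = cube s' := by
        refine inter_eq_left.2 fun w hw => ?_
        have h1 : csum w = ∑ k ∈ s', w k := by
          rw [csum_apply]
          exact (Finset.sum_subset (Finset.subset_univ _) fun k _ hk => hw.2 k hk).symm
        have h2 : ∑ k ∈ s', w k ≤ ∑ k ∈ s', 1 := Finset.sum_le_sum fun k _ => (hw.1 k).2
        rw [mem_ofPred_eq, h1]
        refine h2.trans ?_
        have : (m : ℝ) ≤ 1 := by exact_mod_cast (by omega : m ≤ 1)
        simpa [hcard] using this
      rw [this, hQ]
    · have hm1 : (2 : ℝ) ≤ m := by exact_mod_cast hm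
      have c1 := h.cut T' (isCompact_cube s') (convex_cube s') csum 1
      rw [hQ, ← face_eq, ih s' T' hcard] at c1
      have c2 := h.cut T' kB vB csum (m - 1)
      have e1 : cube s' ∩ {w | 1 ≤ csum w} ∩ {w | csum w = (m : ℝ) - 1} =
          cube s' ∩ {w | csum w = (m : ℝ) - 1} := by
        ext w; simp only [mem_inter_iff, mem_ofPred_eq]
        constructor
        · tauto
        · rintro ⟨h1, h2⟩; exact ⟨⟨h1, by linarith⟩, h2⟩
      have e2 : cube s' ∩ {w | 1 ≤ csum w} ∩ {w | (m : ℝ) - 1 ≤ csum w} =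
          cube s' ∩ {w | (m : ℝ) - 1 ≤ csum w} := by
        ext w; simp only [mem_inter_iff, mem_ofPred_eq]
        constructor
        · tauto
        · rintro ⟨h1, h2⟩; exact ⟨⟨h1, by linarith⟩, h2⟩
      have e3 : cube s' ∩ {w | 1 ≤ csum w} ∩ {w | csum w ≤ (m : ℝ) - 1} =
          cube s' ∩ {w | 1 ≤ csum w ∧ csum w ≤ (m : ℝ) - 1} := by
        rw [inter_assoc]; rfl
      have r1 := refl_image T' s' (fun x => x = 1) (fun x => x = m - 1) fun x => by
        rw [hcard]; constructor <;> intro <;> linarith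
      have r2 := refl_image T' s' (fun x => x ≤ 1) (fun x => m - 1 ≤ x) fun x => by
        rw [hcard]; constructor <;> intro <;> linarith
      have r3 := refl_image T' s' (fun x => 1 ≤ x ∧ x ≤ m - 1) (fun x => 1 ≤ x ∧ x ≤ m - 1)
        fun x => by
          rw [hcard]; constructor <;> rintro ⟨_, _⟩ <;> constructor <;> linarith
      have kC := kB.inter_right (hcl (m - 1))
      have vC := vB.inter (convex_halfSpace_le csum.isLinear ((m : ℝ) - 1))
      rw [e3] at kC vC
      rw [e1, e2, e3, ← r1, ← r2, h.sym _ _ (kC.image cT) (vC.linear_image T') r3,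
        h.refl _ _ (kA.image cT) (vA.linear_image T'), ← face_eq,
        h.refl _ _ ((isCompact_face s').image cT) ((convex_face s').linear_image T'),
        ih s' T' hcard] at c2
      have : 2 * ν (T' '' (cube s' ∩ {w | csum w ≤ 1})) = 0 := by linear_combination - c1 - c2
      simpa using this

end

section

variable {E : Type*} [NormedAddCommGroup E] [InnerProductSpace ℝ E]

open Classical in
/-- Extension of a function on convex bodies to all sets. -/
def ext0 (μ : ConvexBody E → ℂ) (A : Set E) : ℂ :=
  if h : Convex ℝ A ∧ IsCompact A ∧ A.Nonempty then μ ⟨A, h.1, h.2.1, h.2.2⟩ else 0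

theorem ext0_coe (μ : ConvexBody E → ℂ) (K : ConvexBody E) : ext0 μ K = μ K := by
  rw [ext0, dif_pos ⟨K.convex, K.isCompact, K.nonempty⟩]
  rfl

theorem ext0_empty (μ : ConvexBody E → ℂ) : ext0 μ ∅ = 0 := by
  rw [ext0, dif_neg]; simp

theorem supp_of_image_sub {K L : ConvexBody E} {c : E} (h : (L : Set E) = (fun x => c - x) '' K)
    (u : E) : supp L u = supp K (-u) + ⟪c, u⟫ := by
  refine le_antisymm (supp_le _ _ fun x hx => ?_) ?_
  · have hx : x ∈ (L : Set E) := hx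
    rw [h] at hx
    obtain ⟨y, hy, rfl⟩ := hx
    have := le_supp K hy (-u)
    rw [inner_neg_right] at this
    rw [inner_sub_left]; linarith
  · obtain ⟨y, hy, e⟩ := exists_supp K (-u)
    have : c - y ∈ (L : Set E) := by rw [h]; exact ⟨y, hy, rfl⟩
    have := le_supp L this u
    rw [← e, inner_neg_right]
    rw [inner_sub_left] at this; linarith

/-- A valuation is even if it is invariant under the reflection in the origin. -/
def Ev (μ : ConvexBody E → ℂ) : Prop := ∀ K L, (∀ u, supp L u = supp K (-u)) → μ L = μ K

theorem symNull_ext0 [CompleteSpace E] {μ : ConvexBody E → ℂ} (h : CTV μ) (he : Ev μ)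
    (hs : ∀ K, (∀ u, supp K (-u) = supp K u) → μ K = 0) : SymNull (ext0 μ) where
  val := by
    intro A B kA kB vA vB vU
    rcases A.eq_empty_or_nonempty with rfl | nA
    · simp [ext0_empty]
    rcases B.eq_empty_or_nonempty with rfl | nB
    · simp [ext0_empty]
    have nI : (A ∩ B).Nonempty := by
      have := vU.isPreconnected
      rw [isPreconnected_closed_iff] at this
      obtain ⟨x, _, hx⟩ := this A B kA.isClosed kB.isClosed subset_rfl
        (nA.mono fun x hx => ⟨Or.inl hx, hx⟩) (nB.mono fun x hx => ⟨Or.inr hx, hx⟩)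
      exact ⟨x, hx⟩
    exact (by
      have := h.val ⟨A, vA, kA, nA⟩ ⟨B, vB, kB, nB⟩ ⟨A ∪ B, vU, kA.union kB, nA.mono subset_union_left⟩
        ⟨A ∩ B, vA.inter vB, kA.inter kB, nI⟩ rfl rfl
      simp only [← ext0_coe] at this
      exact this)
  refl := by
    intro c A kA vA
    rcases A.eq_empty_or_nonempty with rfl | nA
    · simp
    have v2 : Convex ℝ ((fun x => c - x) '' A) := by
      have : (fun x : E => c - x) '' A = (fun x => c + x) '' (-A) := by
        rw [← image_neg_eq_neg, image_image]; simp [sub_eq_add_neg]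
      rw [this]; exact vA.neg.translate c
    let K : ConvexBody E := ⟨A, vA, kA, nA⟩
    let L : ConvexBody E := ⟨(fun x => c - x) '' A, v2, kA.image (by fun_prop), nA.image _⟩
    have e1 : ext0 μ A = μ K := ext0_coe μ K
    have e2 : ext0 μ ((fun x => c - x) '' A) = μ L := ext0_coe μ L
    rw [e1, e2, ← h.tinv (-c) L]
    refine he _ _ fun u => ?_
    rw [supp_add, supp_pt, supp_of_image_sub (K := K) (L := L) (c := c) rfl, inner_neg_left]; ring
  sym := by
    intro c A kA vA e
    rcases A.eq_empty_or_nonempty with rfl | nA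
    · exact ext0_empty μ
    let K : ConvexBody E := ⟨A, vA, kA, nA⟩
    have e1 : ext0 μ A = μ K := ext0_coe μ K
    rw [e1, ← h.tinv (-((1 / 2 : ℝ) • c))]
    refine hs _ fun u => ?_
    have := supp_of_image_sub (K := K) (L := K) (c := c) e.symm u
    rw [supp_add, supp_add, this, supp_pt, supp_pt]
    simp only [inner_neg_left, inner_neg_right, inner_smul_left, conj_trivial]
    ring

theorem exists_polytope_near (K : ConvexBody E) {ε : ℝ} (hε : 0 < ε) :
    ∃ (m : ℕ) (T : (Fin m → ℝ) →ₗ[ℝ] E) (P : ConvexBody E),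
      (P : Set E) = T '' face Finset.univ ∧ ∀ u, ‖u‖ = 1 → |supp P u - supp K u| ≤ ε := by
  obtain ⟨t, htK, hfin, hcov⟩ := K.isCompact.finite_cover_balls hε
  obtain ⟨m, x, hx⟩ := hfin.fin_embedding
  let T : (Fin m → ℝ) →ₗ[ℝ] E := Fintype.linearCombination ℝ x
  have hT : ∀ w, T w = ∑ k, w k • x k := fun w => Fintype.linearCombination_apply _ _ _
  have hsing : ∀ k, Pi.single k 1 ∈ face (Finset.univ : Finset (Fin m)) := fun k =>
    ⟨fun i => by by_cases h : i = k <;> simp [h], by simp, by simp⟩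
  have hnear : ∀ y ∈ K, ∃ k, dist y (x k) < ε := fun y hy => by
    have := hcov hy
    simp only [mem_iUnion, Metric.mem_ball] at this
    obtain ⟨z, hz, hd⟩ := this
    rw [← hx] at hz
    obtain ⟨k, rfl⟩ := hz
    exact ⟨k, hd⟩
  have hne : (face (Finset.univ : Finset (Fin m))).Nonempty := by
    obtain ⟨y, hy⟩ := K.nonempty
    exact ⟨_, hsing (hnear y hy).choose⟩
  let P : ConvexBody E := ⟨T '' face Finset.univ, (convex_face _).linear_image T,
    (isCompact_face _).image (LinearMap.continuous_of_finiteDimensional T), hne.image _⟩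
  refine ⟨m, T, P, rfl, fun u hu => ?_⟩
  have h1 : supp P u ≤ supp K u := by
    refine supp_le _ _ ?_
    rintro _ ⟨w, ⟨w1, _, w3⟩, rfl⟩
    refine le_supp K ?_ u
    rw [hT]
    refine K.convex.sum_mem (fun k _ => w1 k) w3 fun k _ => htK ?_
    rw [← hx]; exact mem_range_self k
  have h2 : supp K u ≤ supp P u + ε := by
    refine supp_le _ _ fun y hy => ?_
    obtain ⟨k, hk⟩ := hnear y hy
    have h3 : x k ∈ P := ⟨_, hsing k, by simp [hT, Pi.single_apply]⟩
    have h4 := le_supp P h3 u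
    have h5 : ⟪y, u⟫ = ⟪x k, u⟫ + ⟪y - x k, u⟫ := by rw [← inner_add_left]; simp
    have h6 := real_inner_le_norm (y - x k) u
    rw [hu, mul_one, ← dist_eq_norm] at h6
    linarith
  rw [abs_le]; constructor <;> linarith

/-- An even valuation vanishing on centrally symmetric bodies vanishes. -/
theorem CTV.eq_zero_of_symm [CompleteSpace E] {μ : ConvexBody E → ℂ} (h : CTV μ) (he : Ev μ)
    (hs : ∀ K, (∀ u, supp K (-u) = supp K u) → μ K = 0) (K : ConvexBody E) : μ K = 0 := by
  have hN := symNull_ext0 h he hs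
  have hd : K ∈ closure {P | μ P = 0} := by
    rw [Metric.mem_closure_iff]
    intro ε hε
    obtain ⟨m, T, P, hP, hd⟩ := exists_polytope_near K (half_pos hε)
    refine ⟨P, ?_, ?_⟩
    · rw [mem_ofPred_eq, ← ext0_coe μ P, hP]
      exact hN.simplex _ _ _ rfl
    · rw [dist_comm]
      exact (dist_le_of_supp (half_pos hε).le hd).trans_lt (by linarith)
  exact closure_minimal (t := {P | μ P = 0}) subset_rfl (isClosed_eq h.cont continuous_const) hd

end

section

variable {E : Type*} [NormedAddCommGroup E] [InnerProductSpace ℝ E] [FiniteDimensional ℝ E]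
  [MeasurableSpace E] [BorelSpace E]

/-- The standard normal law on the line. -/
abbrev nu1 : Measure ℝ := gaussianReal 0 1

theorem charFun_gauss_inner (t : E) :
    ∫ g, Complex.exp (⟪g, t⟫ * Complex.I) ∂stdGaussian E = Complex.exp (-(‖t‖ : ℂ) ^ 2 / 2) := by
  rw [← charFun_apply, ProbabilityTheory.charFun_stdGaussian]

theorem charFun_gauss_real (v : NNReal) (t : ℝ) :
    ∫ g, Complex.exp ((g * t : ℝ) * Complex.I) ∂gaussianReal 0 v = Complex.exp (-(v * t ^ 2) / 2) := by
  have := ProbabilityTheory.charFun_gaussianReal (μ := 0) (v := v) t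
  rw [charFun_apply_real] at this
  simp only [Complex.ofReal_zero, mul_zero, zero_mul, zero_sub] at this
  rw [← neg_div] at this
  rw [← this]
  refine integral_congr_ae (Eventually.of_forall fun x => ?_)
  simp only; congr 2; push_cast; ring

/-- Projection off the unit vector `x`. -/
def offx (x g : E) : E := g - ⟪x, g⟫ • x

theorem inner_offx {x : E} (hx : ‖x‖ = 1) (g : E) : ⟪x, offx x g⟫ = 0 := by
  simp [offx, inner_sub_right, inner_smul_right, hx]

theorem offx_inner_comm (x g t : E) : ⟪offx x g, t⟫ = ⟪g, offx x t⟫ := by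
  simp only [offx, inner_sub_left, inner_sub_right, inner_smul_left, inner_smul_right, conj_trivial]
  rw [real_inner_comm g x]; ring

theorem norm_offx_sq {x : E} (hx : ‖x‖ = 1) (t : E) : ‖offx x t‖ ^ 2 = ‖t‖ ^ 2 - ⟪x, t⟫ ^ 2 := by
  rw [← real_inner_self_eq_norm_sq, ← real_inner_self_eq_norm_sq]
  simp only [offx, inner_sub_left, inner_sub_right, inner_smul_left, inner_smul_right, conj_trivial,
    real_inner_self_eq_norm_sq, hx]
  rw [real_inner_comm t x]; ring

theorem continuous_offx (x : E) : Continuous (offx x) := by unfold offx; fun_prop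

theorem charFun_decomp {x : E} (hx : ‖x‖ = 1) (v : NNReal) (t : E) :
    charFun (((gaussianReal 0 v).prod (stdGaussian E)).map fun p => p.1 • x + offx x p.2) t =
      Complex.exp (-(v * ⟪x, t⟫ ^ 2 + (‖t‖ ^ 2 - ⟪x, t⟫ ^ 2) : ℝ) / 2) := by
  have hm : Continuous fun p : ℝ × E => p.1 • x + offx x p.2 := by
    have := continuous_offx x; fun_prop
  rw [charFun_apply, integral_map hm.measurable.aemeasurable (by fun_prop)]
  have : ∀ p : ℝ × E, Complex.exp (⟪p.1 • x + offx x p.2, t⟫ * Complex.I) =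
      Complex.exp ((p.1 * ⟪x, t⟫ : ℝ) * Complex.I) * Complex.exp (⟪p.2, offx x t⟫ * Complex.I) := by
    intro p
    rw [← Complex.exp_add, inner_add_left, inner_smul_left, offx_inner_comm]
    congr 1; push_cast; simp; ring
  simp only [this]
  rw [integral_prod_mul (fun a : ℝ => Complex.exp ((a * ⟪x, t⟫ : ℝ) * Complex.I))
    (fun b : E => Complex.exp (⟪b, offx x t⟫ * Complex.I)), charFun_gauss_real, charFun_gauss_inner,
    ← Complex.exp_add]
  congr 1
  have := norm_offx_sq hx t
  rw [← this]; push_cast; ring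

theorem map_decomp {x : E} (hx : ‖x‖ = 1) :
    (nu1.prod (stdGaussian E)).map (fun p => p.1 • x + offx x p.2) = stdGaussian E := by
  have hm : Continuous fun p : ℝ × E => p.1 • x + offx x p.2 := by
    have := continuous_offx x; fun_prop
  have : IsProbabilityMeasure ((nu1.prod (stdGaussian E)).map fun p => p.1 • x + offx x p.2) :=
    Measure.isProbabilityMeasure_map hm.measurable.aemeasurable
  refine Measure.ext_of_charFun (funext fun t => ?_)
  rw [charFun_decomp hx, ProbabilityTheory.charFun_stdGaussian]
  congr 1; push_cast; ring

/-- Integrals against the Gaussian measure, split along a unit vector. -/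
theorem integral_decomp {F : Type*} [NormedAddCommGroup F] [NormedSpace ℝ F] {x : E} (hx : ‖x‖ = 1)
    {f : E → F} (hf : AEStronglyMeasurable f (stdGaussian E)) :
    ∫ y, f y ∂stdGaussian E = ∫ p, f (p.1 • x + offx x p.2) ∂(nu1.prod (stdGaussian E)) := by
  have hm : Continuous fun p : ℝ × E => p.1 • x + offx x p.2 := by
    have := continuous_offx x; fun_prop
  rw [← integral_map hm.measurable.aemeasurable (by rwa [map_decomp hx]), map_decomp hx]

theorem integrable_decomp {F : Type*} [NormedAddCommGroup F] {x : E} (hx : ‖x‖ = 1)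
    {f : E → F} (hf : Integrable f (stdGaussian E)) :
    Integrable (fun p : ℝ × E => f (p.1 • x + offx x p.2)) (nu1.prod (stdGaussian E)) := by
  have hm : Continuous fun p : ℝ × E => p.1 • x + offx x p.2 := by
    have := continuous_offx x; fun_prop
  rw [← map_decomp hx] at hf
  exact hf.comp_measurable hm.measurable

theorem integrable_exp_sq_real {a : ℝ} (ha : a < 1 / 2) :
    Integrable (fun x : ℝ => Real.exp (a * x ^ 2)) nu1 := by
  unfold nu1
  rw [ProbabilityTheory.gaussianReal_of_var_ne_zero _ one_ne_zero,
    integrable_withDensity_iff (ProbabilityTheory.measurable_gaussianPDF 0 1)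
      (Eventually.of_forall fun x => ProbabilityTheory.gaussianPDF_lt_top)]
  have := (integrable_exp_neg_mul_sq (b := 1 / 2 - a) (by linarith)).const_mul ((√(2 * Real.pi * 1))⁻¹)
  refine this.congr (Eventually.of_forall fun x => ?_)
  simp only [ProbabilityTheory.toReal_gaussianPDF, ProbabilityTheory.gaussianPDFReal, NNReal.coe_one]
  rw [mul_left_comm, ← Real.exp_add]
  congr 2; ring

theorem integrable_exp_sq {a : ℝ} (ha : a < 1 / 2) :
    Integrable (fun x : E => Real.exp (a * ‖x‖ ^ 2)) (stdGaussian E) := by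
  let b := stdOrthonormalBasis ℝ E
  rw [ProbabilityTheory.stdGaussian_eq_map_pi_orthonormalBasis b]
  rw [integrable_map_measure (by fun_prop) (Continuous.measurable (by fun_prop)).aemeasurable]
  have := Integrable.fintype_prod (μ := fun _ : Fin (Module.finrank ℝ E) => nu1)
    (f := fun _ x => Real.exp (a * x ^ 2)) fun _ => integrable_exp_sq_real ha
  refine this.congr (Eventually.of_forall fun x => ?_)
  simp only [Function.comp]
  rw [← Real.exp_sum, ← Finset.mul_sum, ← b.sum_sq_norm_inner_right]
  congr 2
  refine Finset.sum_congr rfl fun i _ => ?_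
  rw [inner_sum, Finset.sum_eq_single i]
  · rw [inner_smul_right, real_inner_self_eq_norm_sq]; simp
  · intro j _ hj
    rw [inner_smul_right, b.inner_eq_zero hj.symm, mul_zero]
  · simp

theorem le_exp_sq {ε : ℝ} (hε : 0 < ε) (k : ℕ) : ∃ C : ℝ, 0 ≤ C ∧ ∀ r : ℝ, 0 ≤ r →
    (1 + r) ^ k ≤ C * Real.exp (ε * r ^ 2) := by
  refine ⟨k.factorial * Real.exp (1 + 1 / (4 * ε)), by positivity, fun r hr => ?_⟩
  have h1 := Real.pow_div_factorial_le_exp (1 + r) (by linarith) k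
  rw [div_le_iff₀ (by positivity)] at h1
  refine h1.trans ?_
  rw [mul_comm, mul_assoc, ← Real.exp_add]
  refine mul_le_mul_of_nonneg_left (Real.exp_le_exp.2 ?_) (by positivity)
  have : 0 ≤ ε * (r - 1 / (2 * ε)) ^ 2 := by positivity
  have e : ε * (r - 1 / (2 * ε)) ^ 2 = ε * r ^ 2 - r + 1 / (4 * ε) := by field_simp; ring
  linarith

/-- A continuous function of polynomial times exponential-square growth is integrable. -/
theorem integrable_of_growth {F : Type*} [NormedAddCommGroup F] {f : E → F}
    (hf : AEStronglyMeasurable f (stdGaussian E)) (c a : ℝ) (ha : a < 1 / 2) (k : ℕ)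
    (h : ∀ x, ‖f x‖ ≤ c * (1 + ‖x‖) ^ k * Real.exp (a * ‖x‖ ^ 2)) :
    Integrable f (stdGaussian E) := by
  obtain ⟨C, hC0, hC⟩ := le_exp_sq (ε := (1 / 2 - a) / 2) (by linarith) k
  refine ((integrable_exp_sq (E := E) (a := a + (1 / 2 - a) / 2) (by linarith)).const_mul
    (|c| * C)).mono' hf (Eventually.of_forall fun x => (h x).trans ?_)
  rw [add_mul, Real.exp_add]
  have h1 := hC ‖x‖ (norm_nonneg _)
  have h2 : c * (1 + ‖x‖) ^ k ≤ |c| * (C * Real.exp ((1 / 2 - a) / 2 * ‖x‖ ^ 2)) :=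
    (mul_le_mul_of_nonneg_right (le_abs_self c) (by positivity)).trans
      (mul_le_mul_of_nonneg_left h1 (abs_nonneg c))
  have := mul_le_mul_of_nonneg_right h2 (Real.exp_nonneg (a * ‖x‖ ^ 2))
  linarith

theorem integrable_of_poly {F : Type*} [NormedAddCommGroup F] {f : E → F}
    (hf : AEStronglyMeasurable f (stdGaussian E)) (c : ℝ) (k : ℕ)
    (h : ∀ x, ‖f x‖ ≤ c * (1 + ‖x‖) ^ k) : Integrable f (stdGaussian E) :=
  integrable_of_growth hf c 0 (by norm_num) k (by simpa using h)

end

section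

variable {E : Type*} [NormedAddCommGroup E] [InnerProductSpace ℝ E] [FiniteDimensional ℝ E]
  [MeasurableSpace E] [BorelSpace E]

theorem stdGaussian_real : stdGaussian ℝ = nu1 := by
  refine Measure.ext_of_charFun (funext fun t => ?_)
  rw [ProbabilityTheory.charFun_stdGaussian, ProbabilityTheory.charFun_gaussianReal]
  congr 1
  have : ((‖t‖ ^ 2 : ℝ) : ℂ) = ((t ^ 2 : ℝ) : ℂ) := by rw [Real.norm_eq_abs, sq_abs]
  push_cast at this ⊢
  rw [this]; ring

theorem nu1_eq : nu1 = volume.withDensity (ProbabilityTheory.gaussianPDF 0 1) :=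
  ProbabilityTheory.gaussianReal_of_var_ne_zero _ one_ne_zero

theorem pdf_eq (x : ℝ) : ProbabilityTheory.gaussianPDFReal 0 1 x =
    (√(2 * Real.pi))⁻¹ * Real.exp (-(x ^ 2) / 2) := by
  simp [ProbabilityTheory.gaussianPDFReal]

theorem integrable_nu1 {f : ℝ → ℝ} (h : Integrable f nu1) :
    Integrable fun x => Real.exp (-(x ^ 2) / 2) * f x := by
  rw [nu1_eq, integrable_withDensity_iff (ProbabilityTheory.measurable_gaussianPDF 0 1)
      (Eventually.of_forall fun x => ProbabilityTheory.gaussianPDF_lt_top)] at h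
  refine (h.const_mul (√(2 * Real.pi))).congr (Eventually.of_forall fun x => ?_)
  simp only [ProbabilityTheory.toReal_gaussianPDF, pdf_eq]
  have : √(2 * Real.pi) ≠ 0 := by positivity
  field_simp

theorem integral_nu1 (f : ℝ → ℝ) :
    ∫ x, f x ∂nu1 = (√(2 * Real.pi))⁻¹ * ∫ x, Real.exp (-(x ^ 2) / 2) * f x := by
  rw [ProbabilityTheory.integral_gaussianReal_eq_integral_smul one_ne_zero, ← integral_const_mul]
  simp only [pdf_eq, smul_eq_mul, mul_assoc]

theorem integrable_nu1_poly {f : ℝ → ℝ} (hf : Continuous f) (c : ℝ) (k : ℕ)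
    (h : ∀ x, |f x| ≤ c * (1 + |x|) ^ k) : Integrable f nu1 := by
  rw [← stdGaussian_real]
  exact integrable_of_poly hf.aestronglyMeasurable c k h

theorem hasDerivAt_gauss_mul {f : ℝ → ℝ} {f' x : ℝ} (h : HasDerivAt f f' x) :
    HasDerivAt (fun x => Real.exp (-(x ^ 2) / 2) * f x)
      (Real.exp (-(x ^ 2) / 2) * (f' - x * f x)) x := by
  have h1 : HasDerivAt (fun x : ℝ => -(x ^ 2) / 2) (-x) x := by
    have := ((hasDerivAt_pow 2 x).neg).div_const 2
    refine this.congr_deriv ?_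
    norm_num
    ring
  refine (h1.exp.mul h).congr_deriv ?_
  ring

/-- Gaussian integration by parts. -/
theorem nu1_ibp {f f' : ℝ → ℝ} (hd : ∀ x, HasDerivAt f (f' x) x) (hf : Integrable f nu1)
    (hf' : Integrable f' nu1) (hx : Integrable (fun x => x * f x) nu1) :
    ∫ x, x * f x ∂nu1 = ∫ x, f' x ∂nu1 := by
  have := integral_eq_zero_of_hasDerivAt_of_integrable (fun x => hasDerivAt_gauss_mul (hd x))
    (integrable_nu1 (hf'.sub hx)) (integrable_nu1 hf)
  have h2 := integral_nu1 fun x => f' x - x * f x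
  rw [this, mul_zero, integral_sub hf' hx] at h2
  linarith

theorem half_ibp {f f' : ℝ → ℝ} (hd : ∀ x, HasDerivAt f (f' x) x) (hf : Integrable f nu1)
    (hf' : Integrable f' nu1) (hx : Integrable (fun x => x * f x) nu1) :
    ∫ x in Ioi (0 : ℝ), Real.exp (-(x ^ 2) / 2) * (x * f x - f' x) = f 0 := by
  have hi := (integrable_nu1 (hf'.sub hx))
  have h1 := tendsto_zero_of_hasDerivAt_of_integrableOn_Ioi (a := 0)
    (fun x _ => hasDerivAt_gauss_mul (hd x)) hi.integrableOn (integrable_nu1 hf).integrableOn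
  have := integral_Ioi_of_hasDerivAt_of_tendsto' (a := 0)
    (fun x _ => hasDerivAt_gauss_mul (hd x)) hi.integrableOn h1
  have e : ∀ x, Real.exp (-(x ^ 2) / 2) * (x * f x - f' x) =
    -(Real.exp (-(x ^ 2) / 2) * (f' x - x * f x)) := fun x => by ring
  simp only [e]
  rw [integral_neg, this]; simp

theorem integrable_trig (k : ℕ) (a s : ℝ) (t : ℝ → ℝ) (ht : t = Real.cos ∨ t = Real.sin) :
    Integrable (fun x : ℝ => x ^ k * t (a + s * x)) nu1 := by
  have hc : Continuous t := by
    rcases ht with rfl | rfl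
    exacts [Real.continuous_cos, Real.continuous_sin]
  have hb : ∀ x, |t x| ≤ 1 := by
    rcases ht with rfl | rfl
    exacts [Real.abs_cos_le_one, Real.abs_sin_le_one]
  refine integrable_nu1_poly (by fun_prop) 1 k fun x => ?_
  rw [abs_mul, abs_pow, one_mul]
  calc |x| ^ k * |t (a + s * x)| ≤ |x| ^ k * 1 := by gcongr; exact hb _
    _ ≤ (1 + |x|) ^ k := by rw [mul_one]; gcongr; linarith

theorem nu1_cos (a s : ℝ) : ∫ x, Real.cos (a + s * x) ∂nu1 = Real.cos a * Real.exp (-(s ^ 2) / 2) ∧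
    ∫ x, Real.sin (a + s * x) ∂nu1 = Real.sin a * Real.exp (-(s ^ 2) / 2) := by
  have h := charFun_gauss_real 1 s
  have hi : Integrable (fun x : ℝ => Complex.exp ((x * s : ℝ) * Complex.I)) nu1 := by
    refine Integrable.of_bound (C := 1) (by fun_prop) (Eventually.of_forall fun x => ?_)
    rw [Complex.norm_exp_ofReal_mul_I]
  have hr : ((Real.exp (-(s ^ 2) / 2) : ℝ) : ℂ) = Complex.exp (-((1 : NNReal) * s ^ 2) / 2) := by
    push_cast; simp
  rw [← hr] at h
  have hc : ∫ x, Real.cos (x * s) ∂nu1 = Real.exp (-(s ^ 2) / 2) := by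
    have h1 := congrArg Complex.re h
    rw [Complex.ofReal_re, ← RCLike.re_eq_complex_re, ← integral_re hi] at h1
    rw [← h1]
    refine integral_congr_ae (Eventually.of_forall fun x => ?_)
    simp only [RCLike.re_eq_complex_re, Complex.exp_ofReal_mul_I_re]
  have hs : ∫ x, Real.sin (x * s) ∂nu1 = 0 := by
    have h1 := congrArg Complex.im h
    rw [Complex.ofReal_im, ← RCLike.im_eq_complex_im, ← integral_im hi] at h1
    rw [← h1]
    refine integral_congr_ae (Eventually.of_forall fun x => ?_)
    simp only [RCLike.im_eq_complex_im, Complex.exp_ofReal_mul_I_im]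
  have ic : Integrable (fun x => Real.cos (x * s)) nu1 := by
    simpa [mul_comm] using integrable_trig 0 0 s _ (Or.inl rfl)
  have is : Integrable (fun x => Real.sin (x * s)) nu1 := by
    simpa [mul_comm] using integrable_trig 0 0 s _ (Or.inr rfl)
  constructor
  · simp only [mul_comm s, Real.cos_add]
    rw [integral_sub (ic.const_mul _) (is.const_mul _), integral_const_mul, integral_const_mul, hc, hs]
    ring
  · simp only [mul_comm s, Real.sin_add]
    rw [integral_add (ic.const_mul _) (is.const_mul _), integral_const_mul, integral_const_mul, hc, hs]
    ring

theorem nu1_mul_sin (a s : ℝ) :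
    ∫ x, x * Real.sin (a + s * x) ∂nu1 = s * (Real.cos a * Real.exp (-(s ^ 2) / 2)) := by
  rw [nu1_ibp (f' := fun x => s * Real.cos (a + s * x)), integral_const_mul, (nu1_cos a s).1]
  · intro x
    have := (((hasDerivAt_id x).const_mul s).const_add a).sin
    convert this using 1; simp; ring_nf; simp
  · simpa using integrable_trig 0 a s _ (Or.inr rfl)
  · simpa using (integrable_trig 0 a s _ (Or.inl rfl)).const_mul s
  · simpa using integrable_trig 1 a s _ (Or.inr rfl)

theorem nu1_abs (c : ℝ) :
    ∫ x, |x| * ((1 - c ^ 2) * Real.cos (c * x) + c * x * Real.sin (c * x)) ∂nu1 = √(2 / Real.pi) := by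
  rw [integral_nu1]
  set G : ℝ → ℝ := fun r => Real.exp (-(r ^ 2) / 2) *
      (r * ((1 - c ^ 2) * Real.cos (c * r) + c * r * Real.sin (c * r))) with hG
  have e : ∀ x : ℝ, Real.exp (-(x ^ 2) / 2) *
      (|x| * ((1 - c ^ 2) * Real.cos (c * x) + c * x * Real.sin (c * x))) = G |x| := by
    intro x
    simp only [hG, sq_abs]
    rcases abs_choice x with h | h <;> rw [h]
    simp
  rw [integral_congr_ae (Eventually.of_forall e), integral_comp_abs (f := G)]
  have h := half_ibp (f := fun x => Real.cos (c * x) + c * x * Real.sin (c * x))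
    (f' := fun x => c ^ 2 * x * Real.cos (c * x)) ?_ ?_ ?_ ?_
  · have e2 : ∀ x : ℝ, Real.exp (-(x ^ 2) / 2) *
        (x * ((1 - c ^ 2) * Real.cos (c * x) + c * x * Real.sin (c * x))) =
        Real.exp (-(x ^ 2) / 2) * (x * (Real.cos (c * x) + c * x * Real.sin (c * x)) -
          c ^ 2 * x * Real.cos (c * x)) := fun x => by ring
    simp only [hG, e2]
    rw [h]
    simp only [mul_zero, Real.cos_zero, zero_mul, add_zero, mul_one]
    rw [Real.sqrt_div (by norm_num), Real.sqrt_mul (by norm_num)]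
    have : √(2 : ℝ) * √2 = 2 := Real.mul_self_sqrt (by norm_num)
    have h2 : √(2 : ℝ) ≠ 0 := by positivity
    have h3 : √Real.pi ≠ 0 := by positivity
    field_simp; linarith
  · intro x
    have h1 := ((hasDerivAt_id x).const_mul c)
    have := h1.cos.add (h1.mul h1.sin)
    refine this.congr_deriv ?_
    simp; ring
  · have := (integrable_trig 0 0 c _ (Or.inl rfl)).add
      ((integrable_trig 1 0 c _ (Or.inr rfl)).const_mul c)
    refine this.congr (Eventually.of_forall fun x => ?_)
    simp; ring
  · refine ((integrable_trig 1 0 c _ (Or.inl rfl)).const_mul (c ^ 2)).congr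
      (Eventually.of_forall fun x => ?_)
    simp; ring
  · have := (integrable_trig 1 0 c _ (Or.inl rfl)).add
      ((integrable_trig 2 0 c _ (Or.inr rfl)).const_mul c)
    refine this.congr (Eventually.of_forall fun x => ?_)
    simp; ring

theorem integral_inner_unit {x : E} (hx : ‖x‖ = 1) {f : ℝ → ℝ} (hf : Continuous f) :
    ∫ y, f ⟪y, x⟫ ∂stdGaussian E = ∫ t, f t ∂nu1 := by
  rw [integral_decomp hx (by fun_prop)]
  have : ∀ p : ℝ × E, ⟪p.1 • x + offx x p.2, x⟫ = p.1 := by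
    intro p
    rw [inner_add_left, inner_smul_left, real_inner_self_eq_norm_sq, hx, real_inner_comm,
      inner_offx hx]; simp
  simp only [this]
  rw [integral_fun_fst (fun t => f t)]; simp

end

section

variable {E : Type*} [NormedAddCommGroup E] [InnerProductSpace ℝ E] [FiniteDimensional ℝ E]
  [MeasurableSpace E] [BorelSpace E]

theorem gauss_trig (a : ℝ) (v : E) :
    ∫ g, Real.cos (a + ⟪g, v⟫) ∂stdGaussian E = Real.cos a * Real.exp (-(‖v‖ ^ 2) / 2) ∧
    ∫ g, Real.sin (a + ⟪g, v⟫) ∂stdGaussian E = Real.sin a * Real.exp (-(‖v‖ ^ 2) / 2) ∧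
    ∫ g, ⟪g, v⟫ * Real.sin (a + ⟪g, v⟫) ∂stdGaussian E =
      ‖v‖ ^ 2 * (Real.cos a * Real.exp (-(‖v‖ ^ 2) / 2)) := by
  rcases eq_or_ne v 0 with rfl | hv
  · simp
  have hn : ‖v‖ ≠ 0 := norm_ne_zero_iff.2 hv
  set x := ‖v‖⁻¹ • v with hxd
  have hx : ‖x‖ = 1 := by rw [hxd, norm_smul, norm_inv, norm_norm, inv_mul_cancel₀ hn]
  have e : ∀ g, ⟪g, v⟫ = ‖v‖ * ⟪g, x⟫ := by
    intro g; rw [hxd, inner_smul_right, mul_inv_cancel_left₀ hn]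
  simp only [e]
  refine ⟨?_, ?_, ?_⟩
  · rw [integral_inner_unit hx (f := fun t => Real.cos (a + ‖v‖ * t)) (by fun_prop), (nu1_cos a ‖v‖).1]
  · rw [integral_inner_unit hx (f := fun t => Real.sin (a + ‖v‖ * t)) (by fun_prop), (nu1_cos a ‖v‖).2]
  · rw [integral_inner_unit hx (f := fun t => ‖v‖ * t * Real.sin (a + ‖v‖ * t)) (by fun_prop)]
    simp only [mul_assoc]
    rw [integral_const_mul, nu1_mul_sin]; ring

/-- The weight whose cosine transform is a Gaussian exponential. -/
def qw (w z : E) : ℝ := Real.exp (‖w‖ ^ 2 / 2) *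
  ((1 - ‖w‖ ^ 2) * Real.cos ⟪z, w⟫ + ⟪z, w⟫ * Real.sin ⟪z, w⟫)

theorem continuous_qw : Continuous fun p : E × E => qw p.1 p.2 := by unfold qw; fun_prop

theorem abs_qw_le (w z : E) :
    |qw w z| ≤ Real.exp (‖w‖ ^ 2 / 2) * (1 + ‖w‖) ^ 2 * (1 + ‖z‖) := by
  unfold qw
  rw [abs_mul, Real.abs_exp, mul_assoc]
  refine mul_le_mul_of_nonneg_left ?_ (Real.exp_nonneg _)
  refine (abs_add_le _ _).trans ?_
  rw [abs_mul, abs_mul]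
  have h1 := Real.abs_cos_le_one ⟪z, w⟫
  have h2 := Real.abs_sin_le_one ⟪z, w⟫
  have h3 := abs_real_inner_le_norm z w
  have h4 : |1 - ‖w‖ ^ 2| ≤ 1 + ‖w‖ ^ 2 := by
    rw [abs_le]; constructor <;> nlinarith [sq_nonneg ‖w‖]
  have h5 : |1 - ‖w‖ ^ 2| * |Real.cos ⟪z, w⟫| ≤ (1 + ‖w‖ ^ 2) * 1 := by gcongr
  have h6 : |⟪z, w⟫| * |Real.sin ⟪z, w⟫| ≤ (‖z‖ * ‖w‖) * 1 := by gcongr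
  nlinarith [norm_nonneg z, norm_nonneg w, mul_nonneg (norm_nonneg z) (norm_nonneg w),
    mul_nonneg (norm_nonneg z) (sq_nonneg ‖w‖)]

theorem integrable_abs_qw (x w : E) : Integrable (fun z => |⟪z, x⟫| * qw w z) (stdGaussian E) := by
  have hc : Continuous fun z : E => qw w z := continuous_qw.comp (by fun_prop : Continuous fun z : E => (w, z))
  refine integrable_of_poly (by fun_prop) (‖x‖ * (Real.exp (‖w‖ ^ 2 / 2) * (1 + ‖w‖) ^ 2)) 2 fun z => ?_
  rw [Real.norm_eq_abs, abs_mul, abs_abs]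
  calc |⟪z, x⟫| * |qw w z| ≤ ((1 + ‖z‖) * ‖x‖) * (Real.exp (‖w‖ ^ 2 / 2) * (1 + ‖w‖) ^ 2 * (1 + ‖z‖)) := by
        gcongr
        · exact (abs_real_inner_le_norm z x).trans (by gcongr; linarith)
        · exact abs_qw_le w z
    _ = _ := by ring

theorem cos_qw {x : E} (hx : ‖x‖ = 1) (w : E) :
    ∫ z, |⟪z, x⟫| * qw w z ∂stdGaussian E = √(2 / Real.pi) * Real.exp (⟪x, w⟫ ^ 2 / 2) := by
  have hi := integrable_abs_qw x w
  rw [integral_decomp hx hi.1]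
  have hi2 := integrable_decomp hx hi
  rw [integral_prod _ hi2]
  set c := ⟪x, w⟫ with hc
  set v := offx x w with hv
  have hw : ‖w‖ ^ 2 = c ^ 2 + ‖v‖ ^ 2 := by rw [hv, norm_offx_sq hx]; ring
  have key : ∀ ξ : ℝ, ∫ g, |⟪ξ • x + offx x g, x⟫| * qw w (ξ • x + offx x g) ∂stdGaussian E =
      Real.exp (c ^ 2 / 2) * (|ξ| * ((1 - c ^ 2) * Real.cos (c * ξ) + c * ξ * Real.sin (c * ξ))) := by
    intro ξ
    have e1 : ∀ g, ⟪ξ • x + offx x g, x⟫ = ξ := by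
      intro p
      rw [inner_add_left, inner_smul_left, real_inner_self_eq_norm_sq, hx, real_inner_comm,
        inner_offx hx]; simp
    have e2 : ∀ g, ⟪ξ • x + offx x g, w⟫ = c * ξ + ⟪g, v⟫ := by
      intro g
      rw [inner_add_left, inner_smul_left, offx_inner_comm]; simp [hc, hv]; ring
    have hic : Integrable (fun g => Real.cos (c * ξ + ⟪g, v⟫)) (stdGaussian E) :=
      Integrable.of_bound (C := 1) (by fun_prop) (Eventually.of_forall fun g => Real.abs_cos_le_one _)
    have his : Integrable (fun g => Real.sin (c * ξ + ⟪g, v⟫)) (stdGaussian E) :=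
      Integrable.of_bound (C := 1) (by fun_prop) (Eventually.of_forall fun g => Real.abs_sin_le_one _)
    have hig : Integrable (fun g => ⟪g, v⟫ * Real.sin (c * ξ + ⟪g, v⟫)) (stdGaussian E) := by
      refine integrable_of_poly (by fun_prop) ‖v‖ 1 fun g => ?_
      rw [norm_mul, pow_one]
      calc ‖⟪g, v⟫‖ * ‖Real.sin (c * ξ + ⟪g, v⟫)‖ ≤ (‖g‖ * ‖v‖) * 1 := by
            gcongr
            · exact abs_real_inner_le_norm g v
            · exact Real.abs_sin_le_one _
        _ ≤ _ := by nlinarith [norm_nonneg v]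
    have e3 : ∀ g, |⟪ξ • x + offx x g, x⟫| * qw w (ξ • x + offx x g) =
        (|ξ| * Real.exp (‖w‖ ^ 2 / 2)) * ((1 - ‖w‖ ^ 2) * Real.cos (c * ξ + ⟪g, v⟫) +
          (c * ξ * Real.sin (c * ξ + ⟪g, v⟫) + ⟪g, v⟫ * Real.sin (c * ξ + ⟪g, v⟫))) := by
      intro g; rw [qw, e1, e2]; ring
    have hsum : Integrable (fun g => c * ξ * Real.sin (c * ξ + ⟪g, v⟫) +
      ⟪g, v⟫ * Real.sin (c * ξ + ⟪g, v⟫)) (stdGaussian E) := (his.const_mul _).add hig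
    simp only [e3]
    rw [integral_const_mul, integral_add (hic.const_mul _) hsum,
      integral_const_mul, integral_add (his.const_mul _) hig, integral_const_mul,
      (gauss_trig _ v).1, (gauss_trig _ v).2.1, (gauss_trig _ v).2.2]
    have : Real.exp (‖w‖ ^ 2 / 2) * Real.exp (-(‖v‖ ^ 2) / 2) = Real.exp (c ^ 2 / 2) := by
      rw [← Real.exp_add, hw]; congr 1; ring
    rw [← this, hw]; ring
  simp only [key]
  rw [integral_const_mul, nu1_abs]; ring

end

section

variable {E : Type*} [NormedAddCommGroup E] [InnerProductSpace ℝ E] [FiniteDimensional ℝ E]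

theorem supp_zon_symm (L : List E) (u : E) :
    supp (zon (L ++ L.map Neg.neg)) u = (L.map fun v => |⟪v, u⟫|).sum := by
  rw [zon_append, supp_add]
  induction L with
  | nil => simp [supp_zero]
  | cons v L ih =>
    simp only [List.map_cons, zon_cons, supp_add, List.sum_cons, supp_seg, ← ih, inner_neg_left]
    have : max 0 ⟪v, u⟫ + max 0 (-⟪v, u⟫) = |⟪v, u⟫| := by
      rcases le_total 0 ⟪v, u⟫ with h | h
      · rw [max_eq_right h, max_eq_left (by linarith), abs_of_nonneg h, add_zero]
      · rw [max_eq_left h, max_eq_right (by linarith), abs_of_nonpos h, zero_add]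
    linarith

/-- The cosine function of a vector on the unit sphere. -/
def cosf (v : E) : C(Metric.sphere (0 : E) 1, ℝ) := ⟨fun u => |⟪v, (u : E)⟫|, by fun_prop⟩

theorem dist_cosf_le (v w : E) : dist (cosf v) (cosf w) ≤ 1 * dist v w := by
  rw [ContinuousMap.dist_le (by positivity)]
  intro u
  have hu : ‖(u : E)‖ = 1 := by simpa using u.2
  rw [Real.dist_eq, one_mul]
  refine (abs_abs_sub_abs_le _ _).trans ?_
  rw [← inner_sub_left]
  refine (abs_real_inner_le_norm _ _).trans ?_
  rw [hu, mul_one, dist_eq_norm]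

theorem continuous_cosf : Continuous (cosf : E → _) :=
  (LipschitzWith.of_dist_le_mul (K := 1) (by simp only [NNReal.coe_one]; exact dist_cosf_le)).continuous

theorem sublin_integral_abs {Ω : Type*} [MeasurableSpace Ω] {P : Measure Ω} {V : Ω → E}
    (hV : Integrable V P) : Sublin fun u => ∫ ω, |⟪V ω, u⟫| ∂P := by
  have hi : ∀ u, Integrable (fun ω => |⟪V ω, u⟫|) P := fun u => (hV.inner_const u).abs
  constructor
  · intro u v
    rw [← integral_add (hi u) (hi v)]
    refine integral_mono (hi _) ((hi u).add (hi v)) fun ω => ?_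
    simp only [inner_add_right]
    exact abs_add_le _ _
  · intro a ha u
    rw [← integral_const_mul]
    refine integral_congr_ae (Eventually.of_forall fun ω => ?_)
    simp only [inner_smul_right, abs_mul, abs_of_nonneg ha]

theorem exists_zonoid {Ω : Type*} [MeasurableSpace Ω] {P : Measure Ω} [IsProbabilityMeasure P]
    {V : Ω → E} (hV : Integrable V P) :
    ∃ Z ∈ (Zonoid : Set (ConvexBody E)), ∀ u, supp Z u = ∫ ω, |⟪V ω, u⟫| ∂P := by
  obtain ⟨Z, hZ⟩ := (sublin_integral_abs hV).exists_body
  refine ⟨Z, ?_, hZ⟩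
  let A : Set C(Metric.sphere (0 : E) 1, ℝ) := {g | ∃ L : List E, ∀ u, g u = (L.map fun v => |⟪v, (u : E)⟫|).sum}
  have hA : Convex ℝ A := by
    rintro g ⟨L, hL⟩ k ⟨M, hM⟩ a b ha hb _
    refine ⟨L.map (a • ·) ++ M.map (b • ·), fun u => ?_⟩
    have hs : ∀ (c : ℝ) (hc : 0 ≤ c) (N : List E),
        ((N.map (c • ·)).map fun v => |⟪v, (u : E)⟫|).sum = c * (N.map fun v => |⟪v, (u : E)⟫|).sum := by
      intro c hc N
      rw [← List.sum_map_mul_left, List.map_map]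
      congr 1
      refine List.map_congr_left fun v _ => ?_
      simp [inner_smul_left, abs_mul, abs_of_nonneg hc]
    rw [List.map_append, List.sum_append, hs a ha, hs b hb]
    simp [hL, hM]
  have hi : Integrable (fun ω => cosf (V ω)) P := by
    refine (hV.norm).mono' (continuous_cosf.comp_aestronglyMeasurable hV.1)
      (Eventually.of_forall fun ω => ?_)
    have := dist_cosf_le (V ω) 0
    have h0 : cosf (0 : E) = 0 := by ext u; simp [cosf]
    rwa [h0, dist_zero_right, dist_zero_right, one_mul] at this
  have hmem := hA.closure.integral_mem isClosed_closure
    (Eventually.of_forall fun ω => subset_closure ⟨[V ω], fun u => by simp [cosf]⟩) hi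
  rw [Metric.mem_closure_iff] at hmem
  refine Metric.mem_closure_iff.2 fun ε hε => ?_
  obtain ⟨g, ⟨L, hL⟩, hg⟩ := hmem (ε / 2) (by linarith)
  refine ⟨_, mem_range_self (L ++ L.map Neg.neg), lt_of_le_of_lt (dist_le_of_supp (by linarith : 0 ≤ ε / 2)
    fun u hu => ?_) (by linarith)⟩
  rw [supp_zon_symm, hZ]
  have h1 := (ContinuousMap.dist_apply_le_dist (f := ∫ ω, cosf (V ω) ∂P) (g := g) ⟨u, by simpa using hu⟩).trans hg.le
  rw [hL, Real.dist_eq] at h1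
  have h2 : (∫ ω, cosf (V ω) ∂P) ⟨u, by simpa using hu⟩ = ∫ ω, |⟪V ω, u⟫| ∂P :=
    ((ContinuousMap.evalCLM ℝ (⟨u, by simpa using hu⟩ : Metric.sphere (0 : E) 1)).integral_comp_comm hi).symm
  rwa [h2] at h1

end

section

variable {E : Type*} [NormedAddCommGroup E] [InnerProductSpace ℝ E] [FiniteDimensional ℝ E]
  [MeasurableSpace E] [BorelSpace E]

variable (E) in
/-- The law of a Gaussian matrix together with an independent Gaussian number. -/
abbrev PG : Measure ((Fin (Module.finrank ℝ E) → E) × ℝ) :=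
  (Measure.pi fun _ => stdGaussian E).prod nu1

/-- A Gaussian matrix plus a Gaussian multiple of the identity, applied to `x`. -/
def gm (s : ℝ) (x : E) (p : (Fin (Module.finrank ℝ E) → E) × ℝ) : E :=
  ∑ i, ⟪stdOrthonormalBasis ℝ E i, x⟫ • p.1 i + (s * p.2) • x

theorem continuous_gm (s : ℝ) (x : E) : Continuous (gm s x) := by unfold gm; fun_prop

/-- The variance `1 + s²`. -/
def vs (s : ℝ) : NNReal := Real.toNNReal (1 + s ^ 2)

theorem vs_coe (s : ℝ) : (vs s : ℝ) = 1 + s ^ 2 := Real.coe_toNNReal _ (by positivity)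

theorem map_gm (s : ℝ) {x : E} (hx : ‖x‖ = 1) :
    (PG E).map (gm s x) =
      ((gaussianReal 0 (vs s)).prod (stdGaussian E)).map fun p => p.1 • x + offx x p.2 := by
  have hm : Continuous fun p : ℝ × E => p.1 • x + offx x p.2 := by
    have := continuous_offx x; fun_prop
  have i1 : IsProbabilityMeasure (((gaussianReal 0 (vs s)).prod (stdGaussian E)).map
      fun p => p.1 • x + offx x p.2) :=
    Measure.isProbabilityMeasure_map hm.measurable.aemeasurable
  have i2 : IsProbabilityMeasure ((PG E).map (gm s x)) :=
    Measure.isProbabilityMeasure_map (continuous_gm s x).measurable.aemeasurable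
  refine Measure.ext_of_charFun (funext fun t => ?_)
  rw [charFun_decomp hx, charFun_apply,
    integral_map (continuous_gm s x).measurable.aemeasurable (by fun_prop)]
  set b := stdOrthonormalBasis ℝ E
  have e : ∀ p, Complex.exp (⟪gm s x p, t⟫ * Complex.I) =
      (∏ i, Complex.exp (⟪p.1 i, ⟪b i, x⟫ • t⟫ * Complex.I)) *
        Complex.exp ((p.2 * (s * ⟪x, t⟫) : ℝ) * Complex.I) := by
    intro p
    rw [← Complex.exp_sum, ← Complex.exp_add, gm, inner_add_left, sum_inner, ← Finset.sum_mul]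
    congr 1
    rw [← add_mul]
    congr 1
    rw [Complex.ofReal_add, Complex.ofReal_sum]
    congr 1
    · refine Finset.sum_congr rfl fun i _ => ?_
      rw [inner_smul_left, inner_smul_right]; rfl
    · rw [inner_smul_left]; simp; ring
  simp only [e]
  rw [integral_prod_mul (fun g : Fin (Module.finrank ℝ E) → E =>
      ∏ i, Complex.exp (⟪g i, ⟪b i, x⟫ • t⟫ * Complex.I))
    (fun a : ℝ => Complex.exp ((a * (s * ⟪x, t⟫) : ℝ) * Complex.I)), charFun_gauss_real,
    integral_fintype_prod_eq_prod (fun i (g : E) => Complex.exp (⟪g, ⟪b i, x⟫ • t⟫ * Complex.I))]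
  simp only [charFun_gauss_inner]
  rw [← Complex.exp_sum, ← Complex.exp_add]
  congr 1
  have h1 : ∑ i, ⟪b i, x⟫ ^ 2 = 1 := by
    have := b.sum_sq_norm_inner_right x
    simpa [hx] using this
  have h2 : ∑ i, (-(‖⟪b i, x⟫ • t‖ ^ 2) / 2 : ℝ) = -(‖t‖ ^ 2) / 2 := by
    rw [← Finset.sum_div, Finset.sum_neg_distrib]
    simp only [norm_smul, mul_pow, Real.norm_eq_abs, sq_abs]
    rw [← Finset.sum_mul, h1, one_mul]
  have h3 : ((vs s : ℝ) * ⟪x, t⟫ ^ 2 + (‖t‖ ^ 2 - ⟪x, t⟫ ^ 2)) = ‖t‖ ^ 2 + (s * ⟪x, t⟫) ^ 2 := by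
    rw [vs_coe]; ring
  rw [h3]
  have h4 : ∑ i, (-((‖⟪b i, x⟫ • t‖ : ℝ) : ℂ) ^ 2 / 2 : ℂ) = ((-(‖t‖ ^ 2) / 2 : ℝ) : ℂ) := by
    rw [← h2]; push_cast; rfl
  rw [h4]; push_cast; ring

/-- The parameter `s² / (1 + s²)`. -/
def ks (s : ℝ) : ℝ := s ^ 2 / (1 + s ^ 2)

theorem gaussian_change (s : ℝ) (f : ℝ → ℝ) :
    ∫ t, f t ∂gaussianReal 0 (vs s) =
      (√(1 + s ^ 2))⁻¹ * ∫ t, Real.exp (ks s * t ^ 2 / 2) * f t ∂nu1 := by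
  have hp : 0 < 1 + s ^ 2 := by positivity
  have hv : vs s ≠ 0 := by
    intro h; have := congrArg NNReal.toReal h; rw [vs_coe] at this; simp at this; linarith
  rw [ProbabilityTheory.integral_gaussianReal_eq_integral_smul hv, integral_nu1, ← integral_const_mul,
    ← integral_const_mul]
  refine integral_congr_ae (Eventually.of_forall fun t => ?_)
  simp only [ProbabilityTheory.gaussianPDFReal, smul_eq_mul, sub_zero, vs_coe]
  have e : Real.exp (-t ^ 2 / (2 * (1 + s ^ 2))) =
      Real.exp (-(t ^ 2) / 2) * Real.exp (ks s * t ^ 2 / 2) := by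
    rw [← Real.exp_add, ks]; congr 1; field_simp; ring
  rw [e, Real.sqrt_mul (by positivity)]
  field_simp

theorem ks_nonneg (s : ℝ) : 0 ≤ ks s := by unfold ks; positivity

theorem ks_lt (s : ℝ) : ks s < 1 := by
  unfold ks; rw [div_lt_one (by positivity)]; linarith

theorem integrable_gm (s : ℝ) (x : E) : Integrable (gm s x) (PG E) := by
  have h1 : ∀ i, Integrable (fun p : (Fin (Module.finrank ℝ E) → E) × ℝ => p.1 i) (PG E) := by
    intro i
    have : Integrable (fun g : E => g) (stdGaussian E) :=
      integrable_of_poly (by fun_prop) 1 1 fun x => by simp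
    exact (integrable_comp_eval (μ := fun _ : Fin (Module.finrank ℝ E) => stdGaussian E) this).comp_fst nu1
  have h2 : Integrable (fun p : (Fin (Module.finrank ℝ E) → E) × ℝ => p.2) (PG E) := by
    have : Integrable (fun t : ℝ => t) nu1 := integrable_nu1_poly (by fun_prop) 1 1 fun x => by simp
    exact this.comp_snd _
  unfold gm
  exact (integrable_finsetSum _ fun i _ => (h1 i).smul _).add ((h2.const_mul s).smul_const x)

end

section

variable {E : Type*} [NormedAddCommGroup E] [InnerProductSpace ℝ E] [FiniteDimensional ℝ E]
  [MeasurableSpace E] [BorelSpace E]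

/-- Gaussian smoothing of a support function. -/
def Hs (s : ℝ) (h : E → ℝ) (x : E) : ℝ := ∫ p, h (gm s x p) ∂PG E

theorem integrable_sublin {Ω : Type*} [MeasurableSpace Ω] {P : Measure Ω} {h : E → ℝ} (hs : Sublin h)
    {V : Ω → E} (hV : Integrable V P) : Integrable (fun ω => h (V ω)) P := by
  obtain ⟨K, hK⟩ := hs.exists_body
  refine (hV.norm.const_mul (dist K 0)).mono' (hs.continuous.comp_aestronglyMeasurable hV.1)
    (Eventually.of_forall fun ω => ?_)
  rw [← hK, Real.norm_eq_abs]; exact abs_supp_le K _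

theorem sublin_Hs (s : ℝ) {h : E → ℝ} (hs : Sublin h) : Sublin (Hs s h) := by
  constructor
  · intro x y
    rw [Hs, Hs, Hs, ← integral_add (integrable_sublin hs (integrable_gm s x)) (integrable_sublin hs (integrable_gm s y))]
    refine integral_mono (integrable_sublin hs (integrable_gm s _))
      ((integrable_sublin hs (integrable_gm s x)).add (integrable_sublin hs (integrable_gm s y))) fun p => ?_
    have : gm s (x + y) p = gm s x p + gm s y p := by
      simp only [gm, inner_add_right, add_smul, smul_add, Finset.sum_add_distrib]; abel
    simp only [this]; exact hs.add_le _ _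
  · intro a ha x
    rw [Hs, Hs, ← integral_const_mul]
    refine integral_congr_ae (Eventually.of_forall fun p => ?_)
    have : gm s (a • x) p = a • gm s x p := by
      simp only [gm, inner_smul_right, smul_add, Finset.smul_sum, smul_smul]
      congr 2; ring
    simp only [this]; exact hs.smul a ha _

theorem abs_sublin_le {h : E → ℝ} (hs : Sublin h) : ∃ c : ℝ, 0 ≤ c ∧ ∀ u, |h u| ≤ c * ‖u‖ := by
  obtain ⟨K, hK⟩ := hs.exists_body
  exact ⟨_, dist_nonneg, fun u => hK u ▸ abs_supp_le K u⟩

theorem Hs_eq_gauss (s : ℝ) {h : E → ℝ} (hs : Sublin h) {x : E} (hx : ‖x‖ = 1) :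
    Hs s h x = (√(1 + s ^ 2))⁻¹ * ∫ y, Real.exp (ks s * ⟪y, x⟫ ^ 2 / 2) * h y ∂stdGaussian E := by
  obtain ⟨c, hc0, hc⟩ := abs_sublin_le hs
  have hcont := hs.continuous
  have hm : Continuous fun p : ℝ × E => p.1 • x + offx x p.2 := by
    have := continuous_offx x; fun_prop
  have hgi : Integrable (fun y : E => Real.exp (ks s * ⟪y, x⟫ ^ 2 / 2) * h y) (stdGaussian E) := by
    refine integrable_of_growth (by fun_prop) c (ks s / 2) (by linarith [ks_lt s]) 1 fun y => ?_
    rw [norm_mul, Real.norm_eq_abs, Real.abs_exp, mul_comm]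
    have h1 : ⟪y, x⟫ ^ 2 ≤ ‖y‖ ^ 2 := by
      have := abs_real_inner_le_norm y x
      rw [hx, mul_one] at this
      exact sq_le_sq.2 (by rwa [abs_norm])
    gcongr
    · refine (hc y).trans ?_
      rw [pow_one]; gcongr; linarith
    · have := mul_le_mul_of_nonneg_left h1 (ks_nonneg s); linarith
  have i1 : Integrable (fun p : ℝ × E => h (p.1 • x + offx x p.2))
      ((gaussianReal 0 (vs s)).prod (stdGaussian E)) := by
    have := integrable_sublin hs (integrable_gm s x)
    have h2 := (integrable_map_measure (μ := PG E) (f := gm s x) (g := h) hcont.aestronglyMeasurable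
      (continuous_gm s x).measurable.aemeasurable).2 this
    rw [map_gm s hx] at h2
    exact h2.comp_measurable hm.measurable
  have i2 := integrable_decomp hx hgi
  rw [Hs, ← integral_map (f := h) (continuous_gm s x).measurable.aemeasurable hcont.aestronglyMeasurable,
    map_gm s hx, integral_map hm.measurable.aemeasurable hcont.aestronglyMeasurable,
    integral_prod_symm _ i1, integral_decomp hx hgi.1, integral_prod_symm _ i2, ← integral_const_mul]
  refine integral_congr_ae (Eventually.of_forall fun g => ?_)
  simp only
  rw [gaussian_change]
  have e1 : ∀ t : ℝ, ⟪t • x + offx x g, x⟫ = t := by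
    intro p
    rw [inner_add_left, inner_smul_left, real_inner_self_eq_norm_sq, hx, real_inner_comm,
      inner_offx hx]; simp
  simp only [e1]

/-- The signed density on pairs representing the smoothed support function. -/
def Wd (s : ℝ) (h : E → ℝ) (p : E × E) : ℝ :=
  (√(1 + s ^ 2))⁻¹ * (√(2 / Real.pi))⁻¹ * (h p.1 * qw (√(ks s) • p.1) p.2)

theorem continuous_Wd (s : ℝ) {h : E → ℝ} (hs : Sublin h) : Continuous (Wd s h) := by
  have h1 := hs.continuous
  have h2 : Continuous fun p : E × E => qw (√(ks s) • p.1) p.2 :=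
    continuous_qw.comp (by fun_prop : Continuous fun p : E × E => (√(ks s) • p.1, p.2))
  unfold Wd; fun_prop

theorem integrable_Wd (s : ℝ) {h : E → ℝ} (hs : Sublin h) :
    Integrable (fun p : E × E => Wd s h p • p.2) ((stdGaussian E).prod (stdGaussian E)) := by
  obtain ⟨c, hc0, hc⟩ := abs_sublin_le hs
  have j1 : Integrable (fun y : E => Real.exp (ks s / 2 * ‖y‖ ^ 2) * (1 + ‖y‖) ^ 3) (stdGaussian E) := by
    refine integrable_of_growth (by fun_prop) 1 (ks s / 2) (by linarith [ks_lt s]) 3 fun y => ?_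
    rw [Real.norm_of_nonneg (by positivity)]; apply le_of_eq; ring
  have j2 : Integrable (fun y : E => (1 + ‖y‖) ^ 2) (stdGaussian E) := by
    refine integrable_of_poly (by fun_prop) 1 2 fun y => ?_
    rw [Real.norm_of_nonneg (by positivity)]; apply le_of_eq; ring
  set A := |(√(1 + s ^ 2))⁻¹ * (√(2 / Real.pi))⁻¹|
  refine ((j1.mul_prod j2).const_mul (A * c)).mono'
    (by have := continuous_Wd s hs; fun_prop) (Eventually.of_forall fun p => ?_)
  have hsq : ‖√(ks s) • p.1‖ ^ 2 = ks s * ‖p.1‖ ^ 2 := by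
    rw [norm_smul, mul_pow, Real.norm_eq_abs, sq_abs, Real.sq_sqrt (ks_nonneg s)]
  have hle : ‖√(ks s) • p.1‖ ≤ ‖p.1‖ := by
    refine le_of_sq_le_sq ?_ (norm_nonneg _)
    rw [hsq]; nlinarith [ks_lt s, sq_nonneg ‖p.1‖]
  have hq := abs_qw_le (√(ks s) • p.1) p.2
  rw [hsq] at hq
  rw [norm_smul, Real.norm_eq_abs, Wd, abs_mul (_ * _) (h _ * _), abs_mul (h _)]
  change A * _ * _ ≤ A * c * (Real.exp (ks s / 2 * ‖p.1‖ ^ 2) * (1 + ‖p.1‖) ^ 3 * (1 + ‖p.2‖) ^ 2)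
  calc A * (|h p.1| * |qw (√(ks s) • p.1) p.2|) * ‖p.2‖
      ≤ A * ((c * (1 + ‖p.1‖)) * (Real.exp (ks s * ‖p.1‖ ^ 2 / 2) * (1 + ‖p.1‖) ^ 2 * (1 + ‖p.2‖))) * (1 + ‖p.2‖) := by
        gcongr
        · refine (hc _).trans ?_
          gcongr; linarith
        · refine hq.trans ?_
          gcongr
        · linarith
    _ = A * c * (Real.exp (ks s / 2 * ‖p.1‖ ^ 2) * (1 + ‖p.1‖) ^ 3 * (1 + ‖p.2‖) ^ 2) := by
        have : ks s * ‖p.1‖ ^ 2 / 2 = ks s / 2 * ‖p.1‖ ^ 2 := by ring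
        rw [this]; ring

theorem Hs_eq_cos (s : ℝ) {h : E → ℝ} (hs : Sublin h) {x : E} (hx : ‖x‖ = 1) :
    Hs s h x = ∫ p, |⟪p.2, x⟫| * Wd s h p ∂((stdGaussian E).prod (stdGaussian E)) := by
  have hi : Integrable (fun p : E × E => |⟪p.2, x⟫| * Wd s h p) ((stdGaussian E).prod (stdGaussian E)) := by
    refine (integrable_Wd s hs).norm.mono' (by have := continuous_Wd s hs; fun_prop)
      (Eventually.of_forall fun p => ?_)
    rw [norm_mul, norm_smul, mul_comm, Real.norm_eq_abs |_|, abs_abs]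
    gcongr
    simpa [hx] using abs_real_inner_le_norm p.2 x
  rw [integral_prod _ hi, Hs_eq_gauss s hs hx, ← integral_const_mul]
  refine integral_congr_ae (Eventually.of_forall fun y => ?_)
  have e : ∀ z, |⟪z, x⟫| * Wd s h (y, z) =
    ((√(1 + s ^ 2))⁻¹ * (√(2 / Real.pi))⁻¹ * h y) * (|⟪z, x⟫| * qw (√(ks s) • y) z) := by
    intro z; simp only [Wd]; ring
  simp only [e]
  rw [integral_const_mul, cos_qw hx, inner_smul_right, mul_pow, Real.sq_sqrt (ks_nonneg s), real_inner_comm]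
  have : √(2 / Real.pi) ≠ 0 := by positivity
  field_simp

end

section

variable {E : Type*} [NormedAddCommGroup E] [InnerProductSpace ℝ E] [FiniteDimensional ℝ E]

theorem smul_zero_of_unit {h k : E → ℝ} (hh : ∀ (c : ℝ), 0 ≤ c → ∀ u, h (c • u) = c * h u)
    (hk : ∀ (c : ℝ), 0 ≤ c → ∀ u, k (c • u) = c * k u) (e : ∀ u, ‖u‖ = 1 → h u = k u) (u : E) :
    h u = k u := by
  rcases eq_or_ne u 0 with rfl | hu
  · have h1 := hh 0 le_rfl 0
    have h2 := hk 0 le_rfl 0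
    simp only [zero_smul, zero_mul] at h1 h2
    rw [h1, h2]
  · have hn : ‖u‖ ≠ 0 := norm_ne_zero_iff.2 hu
    have h1 : u = ‖u‖ • (‖u‖⁻¹ • u) := by rw [smul_smul, mul_inv_cancel₀ hn, one_smul]
    rw [h1, hh _ (norm_nonneg u), hk _ (norm_nonneg u), e]
    rw [norm_smul, norm_inv, norm_norm, inv_mul_cancel₀ hn]

variable [MeasurableSpace E] [BorelSpace E]

theorem abs_max_zero (a : ℝ) : |max a 0| = max a 0 := abs_of_nonneg (le_max_right a 0)

theorem CTV.eval_Hs {μ : ConvexBody E → ℂ} (hμ : CTV μ) (h0 : ∀ L, μ (zon L) = 0) (s a : ℝ) (ha : 0 ≤ a)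
    {h : E → ℝ} (hs : Sublin h) {K : ConvexBody E} (hK : ∀ u, supp K u = a * Hs s h u) : μ K = 0 := by
  set P := (stdGaussian E).prod (stdGaussian E)
  have hW := (integrable_Wd s hs).smul a
  have hc := continuous_Wd s hs
  have hpos : Integrable (fun p : E × E => (a * max (Wd s h p) 0) • p.2) P := by
    refine hW.norm.mono' (by fun_prop) (Eventually.of_forall fun p => ?_)
    simp only [Pi.smul_apply, norm_smul, norm_mul, Real.norm_eq_abs, ← mul_assoc]
    gcongr ?_ * _
    refine mul_le_mul_of_nonneg_left ?_ (abs_nonneg _)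
    rw [abs_max_zero]
    exact max_le (le_abs_self _) (abs_nonneg _)
  have hneg : Integrable (fun p : E × E => (a * max (-Wd s h p) 0) • p.2) P := by
    refine hW.norm.mono' (by fun_prop) (Eventually.of_forall fun p => ?_)
    simp only [Pi.smul_apply, norm_smul, norm_mul, Real.norm_eq_abs, ← mul_assoc]
    gcongr ?_ * _
    refine mul_le_mul_of_nonneg_left ?_ (abs_nonneg _)
    rw [abs_max_zero]
    exact max_le (neg_le_abs _) (abs_nonneg _)
  obtain ⟨Z, hZ, eZ⟩ := exists_zonoid hpos
  obtain ⟨Y, hY, eY⟩ := exists_zonoid hneg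
  refine hμ.eval_gen_zonoid h0 hY hZ (supp_inj ?_)
  refine smul_zero_of_unit (fun c hc u => (supp_sublin _).smul c hc u)
    (fun c hc u => (supp_sublin _).smul c hc u) fun u hu => ?_
  rw [supp_add, hK, eZ, eY, Hs_eq_cos s hs hu, ← integral_const_mul]
  have i1 : Integrable (fun p : E × E => a * (|⟪p.2, u⟫| * Wd s h p)) P := by
    refine hW.norm.mono' (by fun_prop) (Eventually.of_forall fun p => ?_)
    simp only [Pi.smul_apply, norm_smul, norm_mul, Real.norm_eq_abs, abs_abs]
    have h1 : |⟪p.2, u⟫| ≤ ‖p.2‖ := by simpa [hu] using abs_real_inner_le_norm p.2 u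
    rw [mul_comm |⟪p.2, u⟫|, ← mul_assoc, ← mul_assoc]
    exact mul_le_mul_of_nonneg_left h1 (by positivity)
  rw [← integral_add i1 (hneg.inner_const u).abs]
  refine integral_congr_ae (Eventually.of_forall fun p => ?_)
  simp only [inner_smul_left, conj_trivial, abs_mul, abs_of_nonneg ha, abs_max_zero]
  have : Wd s h p + max (-Wd s h p) 0 = max (Wd s h p) 0 := by
    rcases le_total 0 (Wd s h p) with h | h
    · rw [max_eq_left h, max_eq_right (by linarith), add_zero]
    · rw [max_eq_right h, max_eq_left (by linarith), add_neg_cancel]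
  rw [← this]; ring

/-- The first absolute moment of the Gaussian. -/
theorem nu1_abs_one : ∫ x : ℝ, |x| ∂nu1 = √(2 / Real.pi) := by
  simpa using nu1_abs 0

theorem abs_Hs_sub_le {h : E → ℝ} (hs : Sublin h) (he : ∀ u, h (-u) = h u) :
    ∃ C : ℝ, 0 ≤ C ∧ ∀ s : ℝ, 0 ≤ s → ∀ x, ‖x‖ = 1 → |Hs s h x - s * √(2 / Real.pi) * h x| ≤ C := by
  obtain ⟨c, hc0, hc⟩ := abs_sublin_le hs
  have hg : ∀ i, Integrable (fun p : (Fin (Module.finrank ℝ E) → E) × ℝ => ‖p.1 i‖) (PG E) := by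
    intro i
    have : Integrable (fun g : E => ‖g‖) (stdGaussian E) :=
      integrable_of_poly (by fun_prop) 1 1 fun x => by simp
    exact (integrable_comp_eval (μ := fun _ : Fin (Module.finrank ℝ E) => stdGaussian E) this).comp_fst nu1
  have hsum := (integrable_finsetSum Finset.univ fun i _ => hg i).const_mul c
  refine ⟨∫ p, c * ∑ i, ‖p.1 i‖ ∂PG E, integral_nonneg fun p => by positivity, fun s h_s x hx => ?_⟩
  have hz : Integrable (fun p : (Fin (Module.finrank ℝ E) → E) × ℝ => s * |p.2| * h x) (PG E) := by
    have : Integrable (fun t : ℝ => s * |t| * h x) nu1 := by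
      have : Integrable (fun t : ℝ => |t|) nu1 := integrable_nu1_poly (by fun_prop) 1 1 fun x => by simp
      exact (this.const_mul s).mul_const _
    exact this.comp_snd _
  have e1 : s * √(2 / Real.pi) * h x = ∫ p, s * |p.2| * h x ∂PG E := by
    rw [integral_mul_const, integral_const_mul]
    have := integral_fun_snd (μ := Measure.pi fun _ : Fin (Module.finrank ℝ E) => stdGaussian E)
      (ν := nu1) (fun t : ℝ => |t|)
    rw [this, nu1_abs_one]; simp
  rw [e1, Hs, ← integral_sub (integrable_sublin hs (integrable_gm s x)) hz]
  refine (abs_integral_le_integral_abs).trans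
    (integral_mono ((integrable_sublin hs (integrable_gm s x)).sub hz).abs hsum fun p => ?_)
  have e2 : s * |p.2| * h x = h ((s * p.2) • x) := by
    rcases le_total 0 p.2 with h1 | h1
    · rw [hs.smul _ (by positivity), abs_of_nonneg h1]
    · rw [← he ((s * p.2) • x), ← neg_smul, hs.smul _ (by nlinarith), abs_of_nonpos h1]; ring
  simp only
  rw [e2]
  refine (hs.lipschitz_of_bound (fun u => (le_abs_self _).trans (hc u)) _ _).trans ?_
  gcongr
  rw [gm, add_sub_cancel_right]
  refine (norm_sum_le _ _).trans (Finset.sum_le_sum fun i _ => ?_)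
  rw [norm_smul]
  have : ‖⟪stdOrthonormalBasis ℝ E i, x⟫‖ ≤ 1 := by
    have := norm_inner_le_norm (𝕜 := ℝ) (stdOrthonormalBasis ℝ E i) x
    simpa [hx] using this
  nlinarith [norm_nonneg (p.1 i)]

theorem CTV.eval_symm_of_zon {μ : ConvexBody E → ℂ} (hμ : CTV μ) (h0 : ∀ L, μ (zon L) = 0)
    (K : ConvexBody E) (hK : ∀ u, supp K (-u) = supp K u) : μ K = 0 := by
  obtain ⟨C, hC0, hC⟩ := abs_Hs_sub_le (supp_sublin K) hK
  set m := √(2 / Real.pi)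
  have hm : 0 < m := by positivity
  have hb : ∀ k : ℕ, ∃ L : ConvexBody E, ∀ u, supp L u = ((k + 1 : ℝ) * m)⁻¹ * Hs (k + 1) (supp K) u :=
    fun k => ((sublin_Hs _ (supp_sublin K)).const_mul (by positivity)).exists_body
  choose L hL using hb
  have ht : Tendsto L atTop (𝓝 K) := by
    rw [tendsto_iff_dist_tendsto_zero]
    have hz : Tendsto (fun k : ℕ => C / m * (1 / ((k : ℝ) + 1))) atTop (𝓝 0) := by
      simpa using tendsto_one_div_add_atTop_nhds_zero_nat.const_mul (C / m)
    refine squeeze_zero (fun _ => dist_nonneg) (fun k => ?_) hz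
    refine dist_le_of_supp (by positivity) fun u hu => ?_
    have hk : (0 : ℝ) < (k + 1) * m := by positivity
    have h1 := hC (k + 1) (by positivity) u hu
    have e : supp (L k) u - supp K u =
        ((k + 1 : ℝ) * m)⁻¹ * (Hs (k + 1) (supp K) u - (k + 1) * m * supp K u) := by
      rw [hL]; field_simp
    rw [e, abs_mul, abs_of_nonneg (by positivity)]
    calc _ ≤ ((k + 1 : ℝ) * m)⁻¹ * C := by gcongr
      _ = _ := by field_simp
  have h1 : ∀ k, μ (L k) = 0 := fun k =>
    hμ.eval_Hs h0 (k + 1) _ (by positivity) (supp_sublin K) (hL k)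
  have := (hμ.cont.tendsto K).comp ht
  simp only [Function.comp_def, h1] at this
  exact tendsto_nhds_unique this tendsto_const_nhds

/-- An even valuation vanishing on zonotopes vanishes. -/
theorem CTV.eq_zero_of_zon {μ : ConvexBody E → ℂ} (hμ : CTV μ) (he : Ev μ) (h0 : ∀ L, μ (zon L) = 0)
    (K : ConvexBody E) : μ K = 0 :=
  hμ.eq_zero_of_symm he (hμ.eval_symm_of_zon h0) K

theorem CTV.eq_zero_of_dls {μ : ConvexBody E → ℂ} (hμ : CTV μ) (he : Ev μ) (h0 : ∀ L, _root_.dls L μ 0 = 0)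
    (K : ConvexBody E) : μ K = 0 :=
  hμ.eq_zero_of_zon he (eval_zon_of_dls h0) K

end

section lmap

variable {E F : Type*} [NormedAddCommGroup E] [InnerProductSpace ℝ E] [FiniteDimensional ℝ E]
  [NormedAddCommGroup F] [InnerProductSpace ℝ F] [FiniteDimensional ℝ F]

/-- The image of a convex body under a linear map. -/
def lmap (f : E →ₗ[ℝ] F) (K : ConvexBody E) : ConvexBody F :=
  ⟨f '' K, K.convex.linear_image f, K.isCompact.image f.continuous_of_finiteDimensional,
    K.nonempty.image f⟩

theorem coe_lmap (f : E →ₗ[ℝ] F) (K : ConvexBody E) : (lmap f K : Set F) = f '' K := rfl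

theorem supp_lmap (f : E →ₗ[ℝ] F) (K : ConvexBody E) (u : F) :
    supp (lmap f K) u = supp K (LinearMap.adjoint f u) := by
  rw [supp, supp, coe_lmap, image_image]
  simp only [LinearMap.adjoint_inner_right]

theorem lmap_add (f : E →ₗ[ℝ] F) (K L : ConvexBody E) : lmap f (K + L) = lmap f K + lmap f L :=
  supp_inj fun u => by simp only [supp_add, supp_lmap]

theorem lmap_zero (f : E →ₗ[ℝ] F) : lmap f 0 = 0 :=
  supp_inj fun u => by simp only [supp_lmap, supp_zero]

theorem lmap_seg (f : E →ₗ[ℝ] F) (v : E) : lmap f (seg v) = seg (f v) :=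
  supp_inj fun u => by simp only [supp_lmap, supp_seg, LinearMap.adjoint_inner_right]

theorem lmap_pt (f : E →ₗ[ℝ] F) (v : E) : lmap f (pt v) = pt (f v) :=
  supp_inj fun u => by simp only [supp_lmap, supp_pt, LinearMap.adjoint_inner_right]

theorem continuous_lmap (f : E →ₗ[ℝ] F) : Continuous (lmap f) := by
  set g := LinearMap.toContinuousLinearMap (LinearMap.adjoint f)
  refine (LipschitzWith.of_dist_le_mul (K := ‖g‖₊) fun K L => ?_).continuous
  refine dist_le_of_supp (by positivity) fun u hu => ?_
  rw [supp_lmap, supp_lmap]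
  refine (abs_supp_sub_le K L _).trans ?_
  rw [mul_comm]
  have := g.le_opNorm u
  rw [hu, mul_one] at this
  exact mul_le_mul_of_nonneg_right this dist_nonneg

theorem CTV.comp {μ : ConvexBody F → ℂ} (h : CTV μ) (f : E →ₗ[ℝ] F) : CTV fun K => μ (lmap f K) := by
  refine CTV.mk' (fun K L U I hU hI => h.val_supp (fun u => ?_) fun u => ?_)
    (h.cont.comp (continuous_lmap f)) fun x K => ?_
  · rw [supp_lmap, supp_lmap, supp_lmap, hU]
  · rw [supp_lmap, supp_lmap, supp_lmap, hI]
  · rw [lmap_add, lmap_pt, h.tinv]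

theorem dls_comp (f : E →ₗ[ℝ] F) (μ : ConvexBody F → ℂ) (L : List E) (K : ConvexBody E) :
    dls L (fun K => μ (lmap f K)) K = dls (L.map f) μ (lmap f K) := by
  induction L generalizing K with
  | nil => rfl
  | cons v L ih =>
    rw [dls_cons, List.map_cons, dls_cons]
    simp only [dl]
    rw [ih, ih, lmap_add, lmap_seg]

theorem dls_const_mul (c : ℂ) (μ : ConvexBody E → ℂ) (L : List E) (K : ConvexBody E) :
    dls L (fun K => c * μ K) K = c * dls L μ K := by
  induction L generalizing K with
  | nil => rfl
  | cons v L ih =>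
    rw [dls_cons, dls_cons]
    simp only [dl]
    rw [ih, ih]; ring

theorem Ev.dl {μ : ConvexBody E → ℂ} (h : CTV μ) (he : Ev μ) (v : E) : Ev (dl v μ) := by
  intro K L hKL
  have h1 : μ (L + seg v) = μ (K + seg (-v)) := he _ _ fun u => by
    rw [supp_add, supp_add, hKL, supp_seg, supp_seg, inner_neg_left, inner_neg_right, neg_neg]
  have h2 := congrFun (h.dl_neg v) K
  simp only [_root_.dl] at h2 ⊢
  rw [h1, he K L hKL, h2]

theorem Ev.dls {μ : ConvexBody E → ℂ} (h : CTV μ) (he : Ev μ) (L : List E) : Ev (dls L μ) := by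
  induction L with
  | nil => exact he
  | cons v L ih => exact ih.dl (h.dls L) v

/-- Exchange of the directions of an iterated difference inside their span. -/
theorem CTV.dls_exchange {μ : ConvexBody E → ℂ} (h : CTV μ) (K : ConvexBody E) (A B C : List E)
    (hlen : B.length = C.length) (hB : ∀ b ∈ B, b ∈ Submodule.span ℝ {x | x ∈ A ++ C})
    (h0 : _root_.dls (A ++ C) μ K = 0) :
    _root_.dls (A ++ B) μ K = 0 := by
  induction B generalizing A C with
  | nil =>
    have : C = [] := List.length_eq_zero_iff.1 (by simpa using hlen.symm)
    rwa [this] at h0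
  | cons b B ih =>
    have hp : (A ++ b :: B).Perm (b :: A ++ B) := List.perm_middle
    rw [dls_perm hp]
    have hb := hB b (by simp)
    by_cases hA : b ∈ Submodule.span ℝ {x | x ∈ A ++ B}
    · rw [List.cons_append, dls_cons, h.dl_dls_of_span hA]; rfl
    -- choose an element of `C` occurring in `b`
    have : ∀ C : List E, b ∈ Submodule.span ℝ {x | x ∈ A ++ C} → ∃ c C', C.Perm (c :: C') ∧
        ∃ t : ℝ, t ≠ 0 ∧ b - t • c ∈ Submodule.span ℝ {x | x ∈ A ++ C'} := by
      intro C
      induction C with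
      | nil =>
        intro hb
        refine absurd (Submodule.span_mono ?_ hb) hA
        intro x hx; simp at hx ⊢; exact Or.inl hx
      | cons c C ihC =>
        intro hb
        have e : {x | x ∈ A ++ c :: C} = insert c {x | x ∈ A ++ C} := by ext x; simp; tauto
        rw [e, Submodule.mem_span_insert] at hb
        obtain ⟨t, z, hz, e2⟩ := hb
        rcases eq_or_ne t 0 with rfl | ht
        · obtain ⟨c', C', hp, t, ht, hm⟩ := ihC (by rw [e2, zero_smul, zero_add]; exact hz)
          refine ⟨c', c :: C', (List.Perm.cons c hp).trans (List.Perm.swap _ _ _), t, ht, ?_⟩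
          refine Submodule.span_mono ?_ hm
          intro x hx; simp at hx ⊢; tauto
        · exact ⟨c, C, List.Perm.refl _, t, ht, by rwa [e2, add_sub_cancel_left]⟩
    obtain ⟨c, C', hp, t, ht, hm⟩ := this C hb
    refine ih (b :: A) C' ?_ ?_ ?_
    · have := hp.length_eq; simp at this hlen; omega
    · intro x hx
      have hx' := hB x (by simp [hx])
      have e : {x | x ∈ A ++ C} = insert c {x | x ∈ A ++ C'} := by
        ext x; simp [hp.mem_iff]; tauto
      have e' : {x | x ∈ b :: A ++ C'} = insert b {x | x ∈ A ++ C'} := by ext x; simp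
      rw [e, Submodule.mem_span_insert] at hx'
      obtain ⟨s, z, hz, rfl⟩ := hx'
      rw [e']
      refine Submodule.add_mem _ (Submodule.smul_mem _ _ ?_)
        (Submodule.span_mono (subset_insert _ _) hz)
      have : c = t⁻¹ • (b - (b - t • c)) := by
        rw [sub_sub_cancel, smul_smul, inv_mul_cancel₀ ht, one_smul]
      rw [this]
      exact Submodule.smul_mem _ _ (Submodule.sub_mem _ (Submodule.subset_span (by simp))
        (Submodule.span_mono (subset_insert _ _) hm))
    · have e : b = t • c + (b - t • c) := by abel
      rw [List.cons_append, dls_cons, e, h.dl_dls_add_of_span hm, (h.dls _).dl_smul, ← dls_cons,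
        dls_perm (List.perm_middle.symm.trans ((hp.symm.append_left A))), h0, mul_zero]

end lmap

section

/-- The real linear map given by a complex matrix. -/
def ml {m n : ℕ} (M : Matrix (Fin m) (Fin n) ℂ) : Cn n →ₗ[ℝ] Cn m :=
  (Matrix.toEuclideanLin M).restrictScalars ℝ

/-- Continuous translation invariant valuations of weight two. -/
structure W2 {n : ℕ} (μ : ConvexBody (Cn n) → ℂ) : Prop where
  ctv : CTV μ
  wt : ∀ g ∈ Matrix.unitaryGroup (Fin n) ℂ, ∀ K, μ (lmap (ml g) K) = g.det ^ 2 * μ K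

theorem inner_re {n : ℕ} (x y : Cn n) : ⟪x, y⟫ = (inner ℂ x y).re := by simp [PiLp.inner_apply]

theorem mem_weightValuations_iff {n : ℕ} (μ : ConvexBody (Cn n) → ℂ) :
    μ ∈ WeightValuations n 2 ↔ W2 μ := by
  constructor
  · rintro ⟨h1, h2, h3, h4⟩
    refine ⟨⟨h1, h2, fun x K => ?_⟩, fun g hg K => by rw [h4 g hg K (lmap (ml g) K) rfl]; norm_cast⟩
    refine h3 x K _ ?_
    change (K : Set (Cn n)) + {x} = _
    rw [Set.add_singleton]
    exact image_congr' fun y => add_comm y x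
  · rintro ⟨h, hw⟩
    refine ⟨h.val, h.cont, fun x K L hL => ?_, fun g hg K L hL => ?_⟩
    · have : L = K + pt x := by
        refine SetLike.coe_injective ?_
        rw [hL]
        change _ = (K : Set (Cn n)) + {x}
        rw [Set.add_singleton]
        exact image_congr' fun y => add_comm x y
      rw [this, h.tinv]
    · have : L = lmap (ml g) K := SetLike.coe_injective hL
      rw [this, hw g hg]; norm_cast

theorem W2.even {n : ℕ} {μ : ConvexBody (Cn n) → ℂ} (h : W2 μ) : Ev μ := by
  intro K L hKL
  have h1 := h.wt (-1) (by simp [Matrix.mem_unitaryGroup_iff]) K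
  rw [Matrix.det_neg, Matrix.det_one, mul_one, ← pow_mul, mul_comm _ 2, pow_mul, neg_one_sq, one_pow,
    one_mul] at h1
  rw [← h1]
  congr 1
  refine supp_inj fun u => ?_
  rw [hKL, supp, supp, coe_lmap, image_image]
  congr 1
  refine image_congr fun x _ => ?_
  rw [inner_neg_right, ← inner_neg_left]
  simp [ml]

theorem W2.dls_image {n : ℕ} {μ : ConvexBody (Cn n) → ℂ} (h : W2 μ) {g : Matrix (Fin n) (Fin n) ℂ}
    (hg : g ∈ Matrix.unitaryGroup (Fin n) ℂ) (L : List (Cn n)) (K : ConvexBody (Cn n)) :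
    dls (L.map (ml g)) μ (lmap (ml g) K) = g.det ^ 2 * dls L μ K := by
  rw [← dls_comp, ← dls_const_mul]
  congr 1
  funext K
  exact h.wt g hg K

theorem ml_mul {m n k : ℕ} (A : Matrix (Fin m) (Fin n) ℂ) (B : Matrix (Fin n) (Fin k) ℂ) (x : Cn k) :
    ml (A * B) x = ml A (ml B x) := by
  simp [ml, Matrix.toLpLin_apply]

theorem ml_single {m n : ℕ} (A : Matrix (Fin m) (Fin n) ℂ) (j : Fin n) (i : Fin m) :
    ml A (EuclideanSpace.single j 1) i = A i j := by
  simp [ml, Matrix.toLpLin_apply]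

/-- Extension of a unitary map of a subspace by the identity on its complement. -/
def extU {n k : ℕ} (I : Matrix (Fin n) (Fin k) ℂ) (g : Matrix (Fin k) (Fin k) ℂ) :
    Matrix (Fin n) (Fin n) ℂ := 1 + I * (g - 1) * I.conjTranspose

theorem extU_mem {n k : ℕ} {I : Matrix (Fin n) (Fin k) ℂ} (hI : I.conjTranspose * I = 1)
    {g : Matrix (Fin k) (Fin k) ℂ} (hg : g ∈ Matrix.unitaryGroup (Fin k) ℂ) :
    extU I g ∈ Matrix.unitaryGroup (Fin n) ℂ := by
  rw [Matrix.mem_unitaryGroup_iff, Matrix.star_eq_conjTranspose] at hg ⊢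
  simp only [extU, Matrix.conjTranspose_add, Matrix.conjTranspose_mul, Matrix.conjTranspose_sub,
    Matrix.conjTranspose_one, Matrix.conjTranspose_conjTranspose]
  have e : I * (g - 1) * I.conjTranspose * (I * ((g.conjTranspose - 1) * I.conjTranspose)) =
      I * ((g - 1) * (g.conjTranspose - 1)) * I.conjTranspose := by
    calc _ = I * (g - 1) * (I.conjTranspose * I) * ((g.conjTranspose - 1) * I.conjTranspose) := by
          simp only [Matrix.mul_assoc]
      _ = _ := by rw [hI]; simp only [Matrix.mul_assoc, Matrix.one_mul]
  have e2 : (g - 1) * (g.conjTranspose - 1) = -(g - 1) - (g.conjTranspose - 1) := by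
    rw [sub_mul, mul_sub, hg]; simp
  rw [add_mul, mul_add, mul_add, e, e2]
  simp only [one_mul, mul_one, ← Matrix.mul_assoc]
  simp only [Matrix.mul_assoc, Matrix.mul_sub, Matrix.mul_neg, Matrix.sub_mul, Matrix.neg_mul]
  abel

theorem det_extU {n k : ℕ} {I : Matrix (Fin n) (Fin k) ℂ} (hI : I.conjTranspose * I = 1)
    (g : Matrix (Fin k) (Fin k) ℂ) : (extU I g).det = g.det := by
  rw [extU, Matrix.mul_assoc, Matrix.det_one_add_mul_comm, Matrix.mul_assoc, hI]
  simp

theorem extU_image {n k : ℕ} {I : Matrix (Fin n) (Fin k) ℂ} (hI : I.conjTranspose * I = 1)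
    (g : Matrix (Fin k) (Fin k) ℂ) (x : Cn k) : ml (extU I g) (ml I x) = ml I (ml g x) := by
  rw [← ml_mul, ← ml_mul, extU, Matrix.add_mul, Matrix.mul_assoc _ _ I, hI]
  simp [Matrix.mul_sub]

theorem extU_fix {n k : ℕ} {I : Matrix (Fin n) (Fin k) ℂ}
    (g : Matrix (Fin k) (Fin k) ℂ) (x : Cn n) (hx : ml I.conjTranspose x = 0) :
    ml (extU I g) x = x := by
  have : ml (extU I g) x = x + ml (I * (g - 1)) (ml I.conjTranspose x) := by
    rw [← ml_mul]; simp [ml, extU]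
  rw [this, hx, map_zero, add_zero]

end

section basis

variable {E : Type*} [NormedAddCommGroup E] [InnerProductSpace ℝ E] [FiniteDimensional ℝ E]

theorem exists_orth_list (V : Submodule ℝ E) (A : List E) (hA : ∀ a ∈ A, a ∈ V) :
    ∃ C : List E, C.length + Module.finrank ℝ (Submodule.span ℝ {x | x ∈ A}) = Module.finrank ℝ V ∧
      (∀ c ∈ C, c ∈ V ∧ ∀ a ∈ A, ⟪a, c⟫ = 0) ∧ V ≤ Submodule.span ℝ {x | x ∈ A ++ C} := by
  set W := Submodule.span ℝ {x | x ∈ A}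
  have hW : W ≤ V := Submodule.span_le.2 hA
  set U := Wᗮ ⊓ V
  set b := Module.finBasis ℝ U
  refine ⟨List.ofFn fun i => (b i : E), ?_, ?_, ?_⟩
  · rw [List.length_ofFn, add_comm]
    exact Submodule.finrank_add_inf_finrank_orthogonal hW
  · intro c hc
    obtain ⟨i, rfl⟩ := (List.mem_ofFn' _ _).1 hc
    have := (b i).2
    exact ⟨this.2, fun a ha => (Submodule.mem_orthogonal _ _).1 this.1 a (Submodule.subset_span ha)⟩
  · have h1 : W ≤ Submodule.span ℝ {x | x ∈ A ++ List.ofFn fun i => (b i : E)} :=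
      Submodule.span_mono fun x hx => List.mem_append_left _ hx
    have h2 : U ≤ Submodule.span ℝ {x | x ∈ A ++ List.ofFn fun i => (b i : E)} := by
      intro x hx
      have e := b.sum_repr ⟨x, hx⟩
      have e2 : x = ∑ i, b.repr ⟨x, hx⟩ i • (b i : E) := by
        have := congrArg U.subtype e
        rw [map_sum] at this
        simp only [map_smul, Submodule.subtype_apply] at this
        exact this.symm
      rw [e2]
      refine Submodule.sum_mem _ fun i _ => Submodule.smul_mem _ _ (Submodule.subset_span ?_)
      exact List.mem_append_right _ ((List.mem_ofFn' _ _).2 ⟨i, rfl⟩)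
    exact (Submodule.sup_orthogonal_inf_of_hasOrthogonalProjection hW).symm.le.trans (sup_le h1 h2)

theorem finrank_span_list_le (L : List E) :
    Module.finrank ℝ (Submodule.span ℝ {x | x ∈ L}) ≤ L.length := by
  classical
  have : {x | x ∈ L} = (L.toFinset : Set E) := by ext; simp
  rw [this]
  exact (finrank_span_finset_le_card _).trans (List.toFinset_card_le L)

theorem finrank_span_pair_orth {v w : E} (hv : v ≠ 0) (hw : w ≠ 0) (h : ⟪v, w⟫ = 0) :
    Module.finrank ℝ (Submodule.span ℝ {x | x ∈ [v, w]}) = 2 := by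
  have hl : LinearIndependent ℝ ![v, w] := by
    rw [LinearIndependent.pair_iff]
    intro s t hst
    have h1 : ⟪v, s • v + t • w⟫ = 0 := by rw [hst, inner_zero_right]
    have h2 : ⟪w, s • v + t • w⟫ = 0 := by rw [hst, inner_zero_right]
    rw [inner_add_right, inner_smul_right, inner_smul_right] at h1 h2
    rw [h] at h1
    rw [real_inner_comm, h] at h2
    simp [hv, hw] at h1 h2
    exact ⟨h1, h2⟩
  have e : {x | x ∈ [v, w]} = range ![v, w] := by ext x; simp [eq_comm, or_comm]
  rw [e, finrank_span_eq_card hl]; simp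

theorem finrank_span_single {v : E} (hv : v ≠ 0) :
    Module.finrank ℝ (Submodule.span ℝ {x | x ∈ [v]}) = 1 := by
  have e : {x | x ∈ [v]} = {v} := by ext x; simp
  rw [e, finrank_span_singleton hv]

/-- Directions may be replaced by other directions spanning the same space. -/
theorem CTV.dls_adapt {μ : ConvexBody E → ℂ} (h : CTV μ) (K : ConvexBody E) (L A : List E)
    (hA : ∀ a ∈ A, a ∈ Submodule.span ℝ {x | x ∈ L})
    (hr : Module.finrank ℝ (Submodule.span ℝ {x | x ∈ A}) = A.length)
    (h0 : ∀ C : List E, A.length + C.length = L.length →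
      (∀ c ∈ C, c ∈ Submodule.span ℝ {x | x ∈ L} ∧ ∀ a ∈ A, ⟪a, c⟫ = 0) →
      _root_.dls (A ++ C) μ K = 0) : _root_.dls L μ K = 0 := by
  by_contra hne
  have h1 := h.length_le_of_dls_ne L fun h2 => hne (by rw [h2]; rfl)
  have h2 := finrank_span_list_le L
  obtain ⟨C, hC, hC2, hC3⟩ := exists_orth_list _ A hA
  have hl : A.length + C.length = L.length := by omega
  refine hne ?_
  have := h.dls_exchange K [] L (A ++ C) (by simp; omega) (fun b hb => hC3 (Submodule.subset_span hb))
    (h0 C hl hC2)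
  simpa using this

end basis

section

/-- The matrix with given columns. -/
def colM {n k : ℕ} (u : Fin k → Cn n) : Matrix (Fin n) (Fin k) ℂ := fun i j => u j i

theorem colM_orth {n k : ℕ} {u : Fin k → Cn n} (hu : Orthonormal ℂ u) :
    (colM u).conjTranspose * colM u = 1 := by
  ext i j
  have := orthonormal_iff_ite.1 hu i j
  rw [PiLp.inner_apply] at this
  simp only [RCLike.inner_apply] at this
  rw [Matrix.mul_apply, Matrix.one_apply, ← this]
  refine Finset.sum_congr rfl fun l _ => ?_
  simp [colM, mul_comm]

theorem ml_colM {n k : ℕ} (u : Fin k → Cn n) (x : Cn k) : ml (colM u) x = ∑ j, x j • u j := by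
  ext i
  simp [ml, Matrix.toLpLin_apply, Matrix.mulVec, dotProduct, colM, mul_comm]

theorem ml_colM_conj {n k : ℕ} (u : Fin k → Cn n) (x : Cn n) (j : Fin k) :
    ml (colM u).conjTranspose x j = inner ℂ (u j) x := by
  simp [ml, Matrix.toLpLin_apply, Matrix.mulVec, dotProduct, colM, PiLp.inner_apply, mul_comm]

theorem ml_smul {m n : ℕ} (M : Matrix (Fin m) (Fin n) ℂ) (c : ℂ) (x : Cn n) :
    ml M (c • x) = c • ml M x := map_smul (Matrix.toEuclideanLin M) c x

theorem exists_reflection {n : ℕ} {w : Cn n} (hw : ‖w‖ = 1) {c : ℂ} (hc : ‖c‖ = 1) :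
    ∃ g ∈ Matrix.unitaryGroup (Fin n) ℂ, g.det = c ∧ ml g w = c • w ∧
      ∀ x, inner ℂ w x = 0 → ml g x = x := by
  have ho : Orthonormal ℂ (fun _ : Fin 1 => w) :=
    ⟨fun _ => hw, fun i j h => absurd (Subsingleton.elim i j) h⟩
  have hI := colM_orth ho
  set I := colM fun _ : Fin 1 => w
  have hg : !![c] ∈ Matrix.unitaryGroup (Fin 1) ℂ := by
    rw [Matrix.mem_unitaryGroup_iff]
    ext i j
    fin_cases i; fin_cases j
    simp [Matrix.mul_apply, Complex.mul_conj, Complex.normSq_eq_norm_sq, hc]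
  refine ⟨extU I !![c], extU_mem hI hg, by rw [det_extU hI]; simp, ?_, fun x hx => ?_⟩
  · have h1 := extU_image hI !![c] (EuclideanSpace.single 0 1)
    have h2 : ml I (EuclideanSpace.single 0 1) = w := by rw [ml_colM]; simp
    have h3 : ml !![c] (EuclideanSpace.single 0 1) = c • EuclideanSpace.single (0 : Fin 1) (1 : ℂ) := by
      ext i; fin_cases i; rw [Fin.zero_eta, ml_single]; simp
    rwa [h3, ml_smul, h2] at h1
  · refine extU_fix _ _ ?_
    ext j
    rw [ml_colM_conj, hx]; rfl

theorem List.map_fix {α : Type*} {f : α → α} {L : List α} (h : ∀ x ∈ L, f x = x) : L.map f = L := by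
  conv_rhs => rw [← List.map_id L]
  exact List.map_congr_left fun x hx => h x hx

theorem W2.dls_eq_zero_of_orth {n : ℕ} {μ : ConvexBody (Cn n) → ℂ} (h : W2 μ) {w : Cn n} (hw : w ≠ 0)
    {L : List (Cn n)} (hL : ∀ x ∈ L, inner ℂ w x = 0) : dls L μ 0 = 0 := by
  set w' := ((‖w‖⁻¹ : ℝ) : ℂ) • w
  have hw' : ‖w'‖ = 1 := by
    rw [norm_smul]; simp [hw]
  obtain ⟨g, hg, hd, -, hf⟩ := exists_reflection hw' Complex.norm_I
  have h1 := h.dls_image hg L 0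
  rw [lmap_zero, List.map_fix fun x hx => hf x (by rw [inner_smul_left, hL x hx, mul_zero]), hd,
    Complex.I_sq] at h1
  linear_combination (1 / 2 : ℂ) * h1

theorem W2.dls_eq_zero_of_complex_orth {n : ℕ} {μ : ConvexBody (Cn n) → ℂ} (h : W2 μ) {w : Cn n}
    (hw : ‖w‖ = 1) {L : List (Cn n)} (hL : ∀ x ∈ L, inner ℂ w x = 0) :
    dls (w :: (Complex.I • w) :: L) μ 0 = 0 := by
  obtain ⟨g, hg, hd, hgw, hf⟩ := exists_reflection hw Complex.norm_I
  have h1 := h.dls_image hg (w :: (Complex.I • w) :: L) 0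
  rw [lmap_zero, List.map_cons, List.map_cons, List.map_fix fun x hx => hf x (hL x hx), hd, ml_smul,
    hgw, smul_smul, Complex.I_mul_I, Complex.I_sq, neg_one_smul, dls_cons, dls_cons, (h.ctv.dls L).dl_neg,
    dl_comm] at h1
  rw [dls_cons, dls_cons] at h1 ⊢
  linear_combination (1 / 2 : ℂ) * h1

theorem inner_I_smul {n : ℕ} (w : Cn n) : ⟪w, Complex.I • w⟫ = 0 := by
  rw [inner_re, inner_smul_right, inner_self_eq_norm_sq_to_K]
  simp [← Complex.ofReal_pow]

theorem inner_complex_eq_zero {n : ℕ} {w x : Cn n} (h1 : ⟪w, x⟫ = 0) (h2 : ⟪Complex.I • w, x⟫ = 0) :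
    inner ℂ w x = 0 := by
  rw [inner_re] at h1 h2
  rw [inner_smul_left] at h2
  refine Complex.ext h1 ?_
  simpa using h2

theorem W2.dls_eq_zero_of_complex {n : ℕ} {μ : ConvexBody (Cn n) → ℂ} (h : W2 μ) {w : Cn n}
    (hw : w ≠ 0) {L : List (Cn n)} (h1 : w ∈ Submodule.span ℝ {x | x ∈ L})
    (h2 : Complex.I • w ∈ Submodule.span ℝ {x | x ∈ L}) : dls L μ 0 = 0 := by
  set w' := ‖w‖⁻¹ • w with hw'
  have hn : ‖w'‖ = 1 := by rw [norm_smul]; simp [hw]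
  have e : Complex.I • w' = ‖w‖⁻¹ • Complex.I • w := smul_comm _ _ _
  have hne : w' ≠ 0 := fun h0 => by simp [h0] at hn
  have hne2 : Complex.I • w' ≠ 0 := smul_ne_zero Complex.I_ne_zero hne
  refine h.ctv.dls_adapt 0 L [w', Complex.I • w'] ?_ ?_ fun C _ hC => ?_
  · intro a ha
    rcases List.mem_pair.1 ha with rfl | rfl
    · exact Submodule.smul_mem _ _ h1
    · rw [e]; exact Submodule.smul_mem _ _ h2
  · exact finrank_span_pair_orth hne hne2 (inner_I_smul w')
  · refine h.dls_eq_zero_of_complex_orth hn fun x hx => ?_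
    exact inner_complex_eq_zero ((hC x hx).2 _ (by simp)) ((hC x hx).2 _ (by simp))

end

section

/-- The standard frame of `ℂⁿ`. -/
def frame (n : ℕ) : List (Cn n) := List.ofFn fun j : Fin n => EuclideanSpace.single j (1 : ℂ)

theorem orthonormal_get {n k : ℕ} {u : List (Cn n)} (hk : u.length = k) (h1 : ∀ x ∈ u, ‖x‖ = 1)
    (h2 : u.Pairwise fun x y => inner ℂ x y = 0) :
    Orthonormal ℂ fun j : Fin k => u.get (Fin.cast hk.symm j) := by
  refine ⟨fun i => h1 _ (List.get_mem _ _), fun i j hij => ?_⟩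
  rw [List.pairwise_iff_get] at h2
  rcases lt_or_gt_of_ne hij with h | h
  · exact h2 _ _ h
  · exact inner_eq_zero_symm.1 (h2 _ _ h)

theorem W2.dls_unitary {n : ℕ} {μ : ConvexBody (Cn n) → ℂ} (h : W2 μ) (h0 : dls (frame n) μ 0 = 0)
    {u : List (Cn n)} (hk : u.length = n) (h1 : ∀ x ∈ u, ‖x‖ = 1)
    (h2 : u.Pairwise fun x y => inner ℂ x y = 0) : dls u μ 0 = 0 := by
  have ho := orthonormal_get hk h1 h2
  set g := colM fun j : Fin n => u.get (Fin.cast hk.symm j)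
  have hg : g ∈ Matrix.unitaryGroup (Fin n) ℂ := by
    rw [Matrix.mem_unitaryGroup_iff', Matrix.star_eq_conjTranspose]
    exact colM_orth ho
  have h3 := h.dls_image hg (frame n) 0
  rw [lmap_zero, h0, mul_zero, frame, List.map_ofFn] at h3
  have e : (List.ofFn (ml g ∘ fun j : Fin n => EuclideanSpace.single j (1 : ℂ))) = u := by
    have : (ml g ∘ fun j : Fin n => EuclideanSpace.single j (1 : ℂ)) =
        fun j => u.get (Fin.cast hk.symm j) := by
      funext j
      rw [Function.comp_apply, ml_colM]
      simp
    rw [this]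
    exact List.ext_getElem (by simp [hk]) (by simp)
  rwa [e] at h3

theorem W2.pullback {n : ℕ} {μ : ConvexBody (Cn n) → ℂ} (h : W2 μ) {k : ℕ} {u : Fin k → Cn n}
    (hu : Orthonormal ℂ u) {L : List (Cn n)} (hL : ∀ x ∈ L, ∀ j, inner ℂ (u j) x = 0) :
    W2 fun K => dls L μ (lmap (ml (colM u)) K) := by
  have hI := colM_orth hu
  refine ⟨(h.ctv.dls L).comp _, fun g hg K => ?_⟩
  have h1 := h.dls_image (extU_mem hI hg) L (lmap (ml (colM u)) K)
  rw [det_extU hI, List.map_fix fun x hx => extU_fix g x ?_] at h1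
  · rw [← h1]
    congr 1
    refine SetLike.coe_injective ?_
    simp only [coe_lmap, image_image, extU_image hI]
  · ext j
    rw [ml_colM_conj, hL x hx]; rfl

/-- A skew map has an eigenvector of its square. -/
theorem exists_plane {n : ℕ} (V : Submodule ℝ (Cn n)) (hV : 0 < Module.finrank ℝ V) :
    ∃ v ∈ V, v ≠ 0 ∧ ∃ w ∈ V, ⟪v, w⟫ = 0 ∧ (∀ y ∈ V, ⟪Complex.I • v, y⟫ = ⟪w, y⟫) ∧
      ∃ c : ℝ, ∀ y ∈ V, ⟪Complex.I • w, y⟫ = c * ⟪v, y⟫ := by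
  have hJ : ∀ x y : Cn n, ⟪Complex.I • x, y⟫ = -⟪x, Complex.I • y⟫ := by
    intro x y
    rw [inner_re, inner_re, inner_smul_left, inner_smul_right]; simp
  let J : Cn n →ₗ[ℝ] Cn n :=
    { toFun := fun x => Complex.I • x, map_add' := fun x y => smul_add _ _ _,
      map_smul' := fun c x => smul_comm _ _ _ }
  let A : V →ₗ[ℝ] V := V.orthogonalProjectionOnto.toLinearMap ∘ₗ J ∘ₗ V.subtype
  have hA : ∀ x y : V, ⟪A x, y⟫ = ⟪Complex.I • (x : Cn n), (y : Cn n)⟫ := by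
    intro x y
    exact Submodule.inner_orthogonalProjectionOnto_eq_of_mem_right y _
  have hA2 : ∀ x y : V, ⟪A x, y⟫ = -⟪x, A y⟫ := by
    intro x y
    rw [hA, hJ, real_inner_comm (A y), hA, real_inner_comm]
  have hT : LinearMap.IsSymmetric (𝕜 := ℝ) (E := V) (A ∘ₗ A) := by
    intro x y
    change ⟪A (A x), y⟫ = ⟪x, A (A y)⟫
    rw [hA2, hA2, neg_neg]
  set b := hT.eigenvectorBasis rfl
  set i : Fin (Module.finrank ℝ V) := ⟨0, hV⟩
  have hb : A (A (b i)) = (hT.eigenvalues rfl i) • b i := hT.apply_eigenvectorBasis rfl i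
  refine ⟨b i, (b i).2, ?_, A (b i), (A (b i)).2, ?_, fun y hy => ?_, hT.eigenvalues rfl i, fun y hy => ?_⟩
  · exact fun h0 => b.orthonormal.ne_zero i (Subtype.ext h0)
  · have := hA2 (b i) (b i)
    rw [real_inner_comm] at this
    have h2 : ⟪b i, A (b i)⟫ = 0 := by linarith
    exact h2
  · exact (hA (b i) ⟨y, hy⟩).symm
  · have := hA (A (b i)) ⟨y, hy⟩
    rw [hb] at this
    exact this.symm.trans (real_inner_smul_left (b i : Cn n) y _)

theorem list_map_pair {α β : Type*} (f : α → β) (a b : α) : [a, b].map f = [f a, f b] := rfl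

theorem W2.dls_eq_zero_aux
    (crux : ∀ μ : ConvexBody (Cn 2) → ℂ, W2 μ → dls (frame 2) μ 0 = 0 → ∀ v w, dls [v, w] μ 0 = 0)
    {n : ℕ} {μ : ConvexBody (Cn n) → ℂ} (h : W2 μ) (h0 : dls (frame n) μ 0 = 0) (m : ℕ) :
    ∀ u L : List (Cn n), u.length + L.length = n → L.length = m → (∀ x ∈ u, ‖x‖ = 1) →
      (u.Pairwise fun x y => inner ℂ x y = 0) → (∀ x ∈ u, ∀ y ∈ L, inner ℂ x y = 0) →
      dls L (dls u μ) 0 = 0 := by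
  induction m using Nat.strong_induction_on with
  | _ m ih =>
  intro u L hlen hm h1 h2 h3
  rcases Nat.eq_zero_or_pos m with rfl | hpos
  · obtain rfl := List.length_eq_zero_iff.1 hm
    exact h.dls_unitary h0 (by simpa using hlen) h1 h2
  set V := Submodule.span ℝ {x | x ∈ L} with hVdef
  have huV : ∀ x ∈ u, ∀ y ∈ V, inner ℂ x y = 0 := by
    intro x hx y hy
    induction hy using Submodule.span_induction with
    | mem y hy => exact h3 x hx y hy
    | zero => simp
    | add y z _ _ hy hz => rw [inner_add_right, hy, hz, add_zero]
    | smul c y _ hy =>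
      have : c • y = (c : ℂ) • y := by ext i; simp
      rw [this, inner_smul_right, hy, mul_zero]
  rcases Nat.eq_zero_or_pos (Module.finrank ℝ V) with hV | hV
  · by_contra hne
    have := (h.ctv.dls u).length_le_of_dls_ne L fun h2 => hne (by rw [h2]; rfl)
    change L.length ≤ Module.finrank ℝ V at this
    omega
  obtain ⟨v, hv, hv0, w, hw, hvw, hJv, c, hJw⟩ := exists_plane V hV
  have hcoe : ∀ (r : ℝ) (x : Cn n), (r : ℂ) • x = r • x := fun r x => by ext i; simp
  have hnorm : ∀ {x : Cn n}, x ≠ 0 → ‖‖x‖⁻¹ • x‖ = 1 := fun {x} hx => by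
    rw [norm_smul]; simp [hx]
  by_cases hw0 : w = 0
  · -- the vector `v` is complex orthogonal to its complement
    refine (h.ctv.dls u).dls_adapt 0 L [v] (by simpa using hv) (by simpa using finrank_span_single hv0)
      fun C hC hCV => ?_
    have hvn := hnorm hv0
    have e : v = ‖v‖ • (‖v‖⁻¹ • v) := by
      rw [smul_smul, mul_inv_cancel₀ (norm_ne_zero_iff.2 hv0), one_smul]
    have hCv : ∀ y ∈ C, inner ℂ v y = 0 := fun y hy =>
      inner_complex_eq_zero ((hCV y hy).2 v (by simp)) (by rw [hJv y (hCV y hy).1, hw0, inner_zero_left])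
    have hC1 : C.length + 1 = L.length := by simpa [add_comm] using hC
    have := ih C.length (by omega) ((‖v‖⁻¹ • v) :: u) C (by simp; omega) rfl ?_ ?_ ?_
    · rw [List.singleton_append, dls_cons, e, ((h.ctv.dls u).dls C).dl_smul, ← dls_dl, ← dls_cons, this,
        mul_zero]
    · simp only [List.mem_cons, forall_eq_or_imp]; exact ⟨hvn, h1⟩
    · refine List.pairwise_cons.2 ⟨fun x hx => ?_, h2⟩
      rw [← hcoe, inner_smul_left, inner_eq_zero_symm.1 (huV x hx v hv), mul_zero]
    · intro x hx y hy
      rcases List.mem_cons.1 hx with rfl | hx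
      · rw [← hcoe, inner_smul_left, hCv y hy, mul_zero]
      · exact huV x hx y (hCV y hy).1
  refine (h.ctv.dls u).dls_adapt 0 L [v, w] ?_ (by simpa using finrank_span_pair_orth hv0 hw0 hvw)
    fun C hC hCV => ?_
  · intro a ha
    rcases List.mem_pair.1 ha with rfl | rfl <;> assumption
  have hC2 : C.length + 2 = L.length := by simpa [add_comm] using hC
  have hCv : ∀ y ∈ C, inner ℂ v y = 0 := fun y hy =>
    inner_complex_eq_zero ((hCV y hy).2 v (by simp))
      (by rw [hJv y (hCV y hy).1]; exact (hCV y hy).2 w (by simp))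
  have hCw : ∀ y ∈ C, inner ℂ w y = 0 := fun y hy =>
    inner_complex_eq_zero ((hCV y hy).2 w (by simp))
      (by rw [hJw y (hCV y hy).1, (hCV y hy).2 v (by simp), mul_zero])
  have huv : ∀ x ∈ u, inner ℂ x v = 0 := fun x hx => huV x hx v hv
  have huw : ∀ x ∈ u, inner ℂ x w = 0 := fun x hx => huV x hx w hw
  -- a unitary basis of the complex span of `v` and `w`
  have hvn := hnorm hv0
  set f1 := ‖v‖⁻¹ • v with hf1
  have ev : v = (‖v‖ : ℂ) • f1 := by
    rw [hcoe, hf1, smul_smul, mul_inv_cancel₀ (norm_ne_zero_iff.2 hv0), one_smul]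
  set w1 := w - inner ℂ f1 w • f1 with hw1
  have hf1w1 : inner ℂ f1 w1 = 0 := by
    rw [hw1, inner_sub_right, inner_smul_right, inner_self_eq_norm_sq_to_K, hvn]; simp
  have hortho : ∀ x : Cn n, inner ℂ x v = 0 → inner ℂ x f1 = 0 := fun x hx => by
    rw [hf1, ← hcoe, inner_smul_right, hx, mul_zero]
  have hortho2 : ∀ x : Cn n, inner ℂ x v = 0 → inner ℂ x w = 0 → inner ℂ x w1 = 0 := fun x hx hx2 => by
    rw [hw1, inner_sub_right, inner_smul_right, hortho x hx, hx2]; simp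
  by_cases hw10 : w1 = 0
  · rw [← dls_append]
    refine h.dls_eq_zero_of_complex hv0 (Submodule.subset_span (by simp)) ?_
    have e1 : w = (inner ℂ f1 w) • f1 := by rw [hw1, sub_eq_zero] at hw10; exact hw10
    set z : ℂ := inner ℂ f1 w with hz
    have hzre : z.re = 0 := by
      rw [hz, ← inner_re, hf1, inner_smul_left, hvw]; simp
    have hzim : z.im ≠ 0 := fun hi => by
      have : z = 0 := Complex.ext hzre hi
      rw [this, zero_smul] at e1; exact hw0 e1
    have e2 : Complex.I • v = (‖v‖ / z.im) • w := by
      have e3 : z = z.im * Complex.I := by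
        apply Complex.ext <;> simp [hzre]
      rw [e1, ← hcoe, smul_smul, e3]
      nth_rewrite 1 [ev]
      rw [smul_smul]
      congr 1
      have : (z.im : ℂ) ≠ 0 := by exact_mod_cast hzim
      simp only [Complex.mul_im, Complex.ofReal_re, Complex.I_im, Complex.ofReal_im, Complex.I_re]
      push_cast
      field_simp
      simp
      rw [mul_div_assoc, div_self this, mul_one]
    rw [e2]
    exact Submodule.smul_mem _ _ (Submodule.subset_span (by simp))
  have hwn := hnorm hw10
  set f2 := ‖w1‖⁻¹ • w1 with hf2
  have hortho3 : ∀ x : Cn n, inner ℂ x v = 0 → inner ℂ x w = 0 → inner ℂ x f2 = 0 := fun x hx hx2 => by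
    rw [hf2, ← hcoe, inner_smul_right, hortho2 x hx hx2, mul_zero]
  have hf12 : inner ℂ f1 f2 = 0 := by rw [hf2, ← hcoe, inner_smul_right, hf1w1, mul_zero]
  have ew : w = (inner ℂ f1 w) • f1 + (‖w1‖ : ℂ) • f2 := by
    rw [hcoe ‖w1‖, hf2, smul_smul, mul_inv_cancel₀ (norm_ne_zero_iff.2 hw10), one_smul, hw1]; abel
  have ho : Orthonormal ℂ ![f1, f2] := by
    refine ⟨fun i => ?_, fun i j hij => ?_⟩
    · fin_cases i
      · exact hvn
      · exact hwn
    · fin_cases i <;> fin_cases j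
      · exact absurd rfl hij
      · exact hf12
      · exact inner_eq_zero_symm.1 hf12
      · exact absurd rfl hij
  have hLx : ∀ x ∈ C ++ u, ∀ j, inner ℂ (![f1, f2] j) x = 0 := by
    intro x hx
    have : inner ℂ x v = 0 ∧ inner ℂ x w = 0 := by
      rcases List.mem_append.1 hx with hx | hx
      · exact ⟨inner_eq_zero_symm.1 (hCv x hx), inner_eq_zero_symm.1 (hCw x hx)⟩
      · exact ⟨huv x hx, huw x hx⟩
    intro j
    fin_cases j
    · exact inner_eq_zero_symm.1 (hortho x this.1)
    · exact inner_eq_zero_symm.1 (hortho3 x this.1 this.2)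
  have hp := h.pullback ho hLx
  have hc := crux _ hp ?_ (EuclideanSpace.single 0 (‖v‖ : ℂ))
    (EuclideanSpace.single 0 (inner ℂ f1 w) + EuclideanSpace.single 1 (‖w1‖ : ℂ))
  · rw [dls_comp, lmap_zero, list_map_pair, map_add, ml_colM, ml_colM, ml_colM] at hc
    simp only [Fin.sum_univ_two] at hc
    simp at hc
    rw [← hcoe, ← hcoe, ← ew, ← ev, dls_append] at hc
    exact hc
  · rw [dls_comp, lmap_zero, frame, List.map_ofFn]
    have e : (List.ofFn (ml (colM ![f1, f2]) ∘ fun j : Fin 2 => EuclideanSpace.single j (1 : ℂ))) =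
        [f1, f2] := by
      simp [ml_colM]
    rw [e, ← dls_append, dls_perm (M := C ++ (f1 :: f2 :: u))]
    · rw [dls_append]
      refine ih C.length (by omega) _ C (by simp; omega) rfl ?_ ?_ ?_
      · simp only [List.mem_cons, forall_eq_or_imp]; exact ⟨hvn, hwn, h1⟩
      · refine List.pairwise_cons.2 ⟨fun x hx => ?_, List.pairwise_cons.2 ⟨fun x hx => ?_, h2⟩⟩
        · rcases List.mem_cons.1 hx with rfl | hx
          · exact hf12
          · exact inner_eq_zero_symm.1 (hortho x (huv x hx))
        · exact inner_eq_zero_symm.1 (hortho3 x (huv x hx) (huw x hx))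
      · intro x hx y hy
        have := hLx y (List.mem_append_left _ hy)
        rcases List.mem_cons.1 hx with rfl | hx
        · exact this 0
        rcases List.mem_cons.1 hx with rfl | hx
        · exact this 1
        · exact huV x hx y (hCV y hy).1
    · rw [← List.append_assoc]
      exact (List.perm_append_comm (l₁ := [f1, f2]) (l₂ := C)).append_right u |>.trans (by simp)

theorem W2.dls_eq_zero_of_length_ne {n : ℕ} {μ : ConvexBody (Cn n) → ℂ} (h : W2 μ) (L : List (Cn n))
    (hL : L.length ≠ n) : dls L μ 0 = 0 := by
  rcases lt_or_gt_of_ne hL with hL | hL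
  · set S := Submodule.span ℂ {x | x ∈ L}
    have hS : Module.finrank ℂ S < n := by
      classical
      have : {x | x ∈ L} = (L.toFinset : Set (Cn n)) := by ext; simp
      refine lt_of_le_of_lt ?_ hL
      change Module.finrank ℂ (Submodule.span ℂ {x | x ∈ L}) ≤ _
      rw [this]
      exact (finrank_span_finset_le_card _).trans (List.toFinset_card_le L)
    have h1 := Submodule.finrank_add_finrank_orthogonal S
    rw [finrank_euclideanSpace_fin] at h1
    have : Nontrivial Sᗮ := Module.nontrivial_of_finrank_pos (R := ℂ) (by omega)
    obtain ⟨⟨w, hw⟩, hw0⟩ := exists_ne (0 : Sᗮ)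
    refine h.dls_eq_zero_of_orth (w := w) (fun e => hw0 (Subtype.ext e)) fun x hx => ?_
    exact (Submodule.mem_orthogonal' _ _).1 hw x (Submodule.subset_span hx)
  · by_contra hne
    have h1 := h.ctv.length_le_of_dls_ne L fun h2 => hne (by rw [h2]; rfl)
    set V := Submodule.span ℝ {x | x ∈ L} with hV
    let J : Cn n ≃ₗ[ℝ] Cn n := ((LinearEquiv.smulOfNeZero ℂ (Cn n) Complex.I Complex.I_ne_zero)).restrictScalars ℝ
    have h2 := Submodule.finrank_sup_add_finrank_inf_eq V (V.map J.toLinearMap)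
    have h3 : Module.finrank ℝ (V.map J.toLinearMap) = Module.finrank ℝ V :=
      LinearEquiv.finrank_map_eq J V
    have h4 : Module.finrank ℝ (Cn n) = 2 * n := by
      rw [← Module.finrank_mul_finrank ℝ ℂ (Cn n), finrank_euclideanSpace_fin, Complex.finrank_real_complex]
    have h5 := Submodule.finrank_le (V ⊔ V.map J.toLinearMap)
    have : Nontrivial (V ⊓ V.map J.toLinearMap : Submodule ℝ (Cn n)) :=
      Module.nontrivial_of_finrank_pos (R := ℝ) (by omega)
    obtain ⟨⟨w, hw⟩, hw0⟩ := exists_ne (0 : (V ⊓ V.map J.toLinearMap : Submodule ℝ (Cn n)))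
    obtain ⟨hw1, x, hx, hxw⟩ := hw
    have hxw : Complex.I • x = w := hxw
    refine hne (h.dls_eq_zero_of_complex (w := x) ?_ hx (by rw [hxw]; exact hw1))
    intro hx0
    refine hw0 (Subtype.ext ?_)
    change w = 0
    rw [← hxw, hx0, smul_zero]

theorem W2.eq_zero
    (crux : ∀ μ : ConvexBody (Cn 2) → ℂ, W2 μ → dls (frame 2) μ 0 = 0 → ∀ v w, dls [v, w] μ 0 = 0)
    {n : ℕ} {μ : ConvexBody (Cn n) → ℂ} (h : W2 μ) (h0 : dls (frame n) μ 0 = 0) (K : ConvexBody (Cn n)) :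
    μ K = 0 := by
  refine h.ctv.eq_zero_of_dls h.even (fun L => ?_) K
  by_cases hL : L.length = n
  · exact h.dls_eq_zero_aux crux h0 L.length [] L (by simpa using hL) rfl (by simp) (by simp) (by simp)
  · exact h.dls_eq_zero_of_length_ne L hL

end

section

open scoped Quaternion

theorem dls_pair {E : Type*} [NormedAddCommGroup E] [InnerProductSpace ℝ E] [FiniteDimensional ℝ E]
    (x y : E) (μ : ConvexBody E → ℂ) (K : ConvexBody E) : dls [x, y] μ K = dl x (dl y μ) K := rfl

theorem continuous_dl {E : Type*} [NormedAddCommGroup E] [InnerProductSpace ℝ E] [FiniteDimensional ℝ E]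
    {μ : ConvexBody E → ℂ} (h : CTV μ) : Continuous fun p : E × ConvexBody E => dl p.1 μ p.2 := by
  unfold dl
  exact (h.cont.comp (continuous_snd.add (continuous_seg.comp continuous_fst))).sub
    (h.cont.comp continuous_snd)

theorem continuous_dl_left {E : Type*} [NormedAddCommGroup E] [InnerProductSpace ℝ E] [FiniteDimensional ℝ E]
    {μ : ConvexBody E → ℂ} (h : CTV μ) (K : ConvexBody E) : Continuous fun v : E => dl v μ K :=
  (continuous_dl h).comp (Continuous.prodMk_left K)

theorem dls_const {E : Type*} [NormedAddCommGroup E] [InnerProductSpace ℝ E] [FiniteDimensional ℝ E]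
    (c : ℂ) (L : List E) (hL : L ≠ []) (K : ConvexBody E) : dls L (fun _ => c) K = 0 := by
  obtain ⟨L, v, rfl⟩ := List.eq_nil_or_concat L |>.resolve_left hL
  have : dl v (fun _ : ConvexBody E => c) = 0 := by ext; simp [dl]
  rw [List.concat_eq_append, dls_append]
  have h2 : dls [v] (fun _ : ConvexBody E => c) = 0 := this
  rw [h2, dls_zero_fun]; rfl

theorem dls_sub_const {E : Type*} [NormedAddCommGroup E] [InnerProductSpace ℝ E] [FiniteDimensional ℝ E]
    (μ : ConvexBody E → ℂ) (c : ℂ) (L : List E) (hL : L ≠ []) :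
    dls L (fun K => μ K - c) = dls L μ := by
  have : (fun K => μ K - c) = μ + fun _ => -c := by ext; simp [sub_eq_add_neg]
  rw [this, dls_add_fun]
  ext K
  simp [dls_const _ L hL]

variable {E : Type*} [NormedAddCommGroup E] [InnerProductSpace ℝ E] [FiniteDimensional ℝ E]
  [MeasurableSpace E] [BorelSpace E]

/-- The quaternion with given coordinates. -/
def mkq (a b c d : ℝ) : ℍ := ⟨a, b, c, d⟩

section
variable (a b c d : ℝ)
@[simp] theorem mkq_re : (mkq a b c d).re = a := rfl
@[simp] theorem mkq_imI : (mkq a b c d).imI = b := rfl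
@[simp] theorem mkq_imJ : (mkq a b c d).imJ = c := rfl
@[simp] theorem mkq_imK : (mkq a b c d).imK = d := rfl
end

/-- The properties of a weight two valuation on the quaternions with vanishing value on the frame. -/
structure Q2 (e : ℍ ≃ₗᵢ[ℝ] E) (μ : ConvexBody E → ℂ) : Prop where
  ctv : CTV μ
  even : Ev μ
  length : ∀ L : List E, L.length ≠ 2 → dls L μ 0 = 0
  left : ∀ a : ℍ, ‖a‖ = 1 → ∀ x y, dls [e (a * x), e (a * y)] μ 0 = dls [e x, e y] μ 0
  pole : dls [e 1, e (mkq 0 1 0 0)] μ 0 = 0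
  equator : ∀ b c : ℝ, dls [e 1, e (mkq 0 0 b c)] μ 0 = 0
  half : ∀ a b c : ℝ, dls [e 1, e (mkq 0 a (-b) (-c))] μ 0 = dls [e 1, e (mkq 0 a b c)] μ 0

/-- The Klain function as a function of one quaternion. -/
def kf (e : ℍ ≃ₗᵢ[ℝ] E) (μ : ConvexBody E → ℂ) (w : ℍ) : ℂ := dls [e 1, e w] μ 0

variable {e : ℍ ≃ₗᵢ[ℝ] E} {μ : ConvexBody E → ℂ}

theorem kf_eq (w : ℍ) : kf e μ w = dl (e w) (dl (e 1) μ) 0 := by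
  rw [kf, dls_pair, dl_comm]

theorem Q2.continuous_kf (h : Q2 e μ) : Continuous (kf e μ) := by
  have h2 := (continuous_dl_left (h.ctv.dl (e 1)) 0).comp e.continuous
  exact h2.congr fun w => (kf_eq w).symm

theorem Q2.kf_smul (h : Q2 e μ) (t : ℝ) (w : ℍ) : kf e μ (t • w) = |t| * kf e μ w := by
  rw [kf_eq, kf_eq, map_smul]
  exact (h.ctv.dl (e 1)).dl_smul t (e w) 0

theorem Q2.kf_neg (h : Q2 e μ) (w : ℍ) : kf e μ (-w) = kf e μ w := by
  rw [← neg_one_smul ℝ, h.kf_smul]; simp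

theorem Q2.kf_add_real (h : Q2 e μ) (w : ℍ) (t : ℝ) : kf e μ (w + t) = kf e μ w := by
  rw [kf_eq, kf_eq, map_add]
  have := h.ctv.dl_dls_add_of_span (L := [e 1]) (v := e (t : ℍ)) ?_ (e w)
  · exact congrFun this 0
  · have : (t : ℍ) = t • (1 : ℍ) := by
      rw [← Quaternion.coe_mul_eq_smul, mul_one]
    rw [this, map_smul]
    exact Submodule.smul_mem _ _ (Submodule.subset_span (by simp))

theorem Q2.kf_congr (h : Q2 e μ) {v w : ℍ} (hi : v.im = w.im) : kf e μ v = kf e μ w := by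
  rw [← Quaternion.re_add_im v, ← Quaternion.re_add_im w, add_comm, h.kf_add_real, add_comm,
    h.kf_add_real, hi]

theorem Q2.dls_two (h : Q2 e μ) (x y : ℍ) : dls [e x, e y] μ 0 = kf e μ (star x * y) := by
  rcases eq_or_ne x 0 with rfl | hx
  · rw [dls_pair, map_zero, dl_zero_vec, star_zero, zero_mul]
    have := h.kf_smul 0 0
    simp only [smul_zero, abs_zero, Complex.ofReal_zero, zero_mul] at this
    rw [this]; rfl
  have hn : ‖x‖ ≠ 0 := by simpa using hx
  have h1 := h.left (‖x‖⁻¹ • x) (by rw [norm_smul]; simp [hn]) (‖x‖ • 1) (‖x‖⁻¹ • (star x * y))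
  have e1 : ‖x‖⁻¹ • x * (‖x‖ • 1) = x := by simp [smul_smul, hn]
  have e2 : ‖x‖⁻¹ • x * (‖x‖⁻¹ • (star x * y)) = y := by
    rw [smul_mul_smul_comm, ← mul_assoc, Quaternion.self_mul_star, Quaternion.normSq_eq_norm_mul_self,
      Quaternion.coe_mul_eq_smul, smul_smul]
    field_simp; simp
  rw [e1, e2] at h1
  rw [h1, dls_pair, map_smul, map_smul, h.ctv.dl _ |>.dl_smul, dl_comm, (h.ctv.dl (e 1)).dl_smul, kf_eq]
  rw [abs_norm, abs_inv, abs_norm, ← mul_assoc]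
  norm_cast
  rw [mul_inv_cancel₀ hn]; simp

theorem Q2.dls_pair_const (h : Q2 e μ) (x y : ℍ) (K : ConvexBody E) :
    dls [e x, e y] μ K = kf e μ (star x * y) := by
  rw [← h.dls_two, ← sub_eq_zero]
  have hc : CTV (fun K => dls [e x, e y] μ K - dls [e x, e y] μ 0) := (h.ctv.dls _).sub (CTV.const _)
  have he : Ev (fun K => dls [e x, e y] μ K - dls [e x, e y] μ 0) := fun K L hKL => by
    beta_reduce
    rw [h.even.dls h.ctv [e x, e y] K L hKL]
  refine hc.eq_zero_of_dls he (fun L => ?_) K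
  rcases eq_or_ne L [] with rfl | hL
  · simp [dls]
  · rw [dls_sub_const _ _ _ hL, ← dls_append]
    refine h.length _ ?_
    have := List.length_pos_iff.2 hL
    simp; omega

/-- The mixed value `dl z μ` is additive along segments. -/
theorem Q2.dl_add_seg (h : Q2 e μ) (z v : ℍ) (K : ConvexBody E) :
    dl (e z) μ (K + seg (e v)) = dl (e z) μ K + kf e μ (star z * v) := by
  rw [← h.dls_pair_const z v K, dls_pair, dl_comm]
  simp [dl]

theorem Q2.dl_zero (h : Q2 e μ) (z : E) : dl z μ 0 = 0 := h.length [z] (by simp)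

end

section

section zonoid

variable {E : Type*} [NormedAddCommGroup E] [InnerProductSpace ℝ E] [FiniteDimensional ℝ E]

theorem exists_bound_of_homog {d : E → ℂ} (hd : Continuous d)
    (hs : ∀ (t : ℝ) v, 0 ≤ t → d (t • v) = t * d v) : ∃ C : ℝ, ∀ v, ‖d v‖ ≤ C * ‖v‖ := by
  obtain ⟨C, hC⟩ := (isCompact_closedBall (0 : E) 1).exists_bound_of_continuousOn hd.continuousOn
  refine ⟨C, fun v => ?_⟩
  rcases eq_or_ne v 0 with rfl | hv
  · have := hs 0 0 le_rfl
    simp only [smul_zero, Complex.ofReal_zero, zero_mul] at this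
    simp [this]
  have hn : ‖v‖ ≠ 0 := by simpa using hv
  have h1 := hs ‖v‖ (‖v‖⁻¹ • v) (norm_nonneg _)
  rw [smul_smul, mul_inv_cancel₀ hn, one_smul] at h1
  rw [h1, norm_mul, mul_comm]
  have h2 := hC (‖v‖⁻¹ • v) (by rw [mem_closedBall_zero_iff, norm_smul]; simp [hn])
  have h3 : ‖((‖v‖ : ℝ) : ℂ)‖ = ‖v‖ := by simp
  rw [h3]
  gcongr

theorem exists_list_near {Ω : Type*} [MeasurableSpace Ω] {P : Measure Ω} [IsProbabilityMeasure P]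
    {V : Ω → E} (hV : Integrable V P) {d : E → ℂ} (hd : Continuous d)
    (hs : ∀ (t : ℝ) v, 0 ≤ t → d (t • v) = t * d v) {ε : ℝ} (hε : 0 < ε) :
    ∃ L : List E, (∀ u, ‖u‖ = 1 → |(L.map fun v => |⟪v, u⟫|).sum - ∫ ω, |⟪V ω, u⟫| ∂P| ≤ ε) ∧
      ‖(L.map d).sum - ∫ ω, d (V ω) ∂P‖ ≤ ε := by
  obtain ⟨C, hC⟩ := exists_bound_of_homog hd hs
  let A : Set (C(Metric.sphere (0 : E) 1, ℝ) × ℂ) :=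
    {g | ∃ L : List E, (∀ u, g.1 u = (L.map fun v => |⟪v, (u : E)⟫|).sum) ∧ g.2 = (L.map d).sum}
  have hA : Convex ℝ A := by
    rintro g ⟨L, hL, hL'⟩ k ⟨M, hM, hM'⟩ a b ha hb _
    refine ⟨L.map (a • ·) ++ M.map (b • ·), fun u => ?_, ?_⟩
    · have hs : ∀ (c : ℝ) (hc : 0 ≤ c) (N : List E),
          ((N.map (c • ·)).map fun v => |⟪v, (u : E)⟫|).sum = c * (N.map fun v => |⟪v, (u : E)⟫|).sum := by
        intro c hc N
        rw [← List.sum_map_mul_left, List.map_map]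
        congr 1
        refine List.map_congr_left fun v _ => ?_
        simp [inner_smul_left, abs_mul, abs_of_nonneg hc]
      rw [List.map_append, List.sum_append, hs a ha, hs b hb]
      simp [hL, hM]
    · have hs : ∀ (c : ℝ) (hc : 0 ≤ c) (N : List E),
          ((N.map (c • ·)).map d).sum = c * (N.map d).sum := by
        intro c hc N
        rw [← List.sum_map_mul_left, List.map_map]
        congr 1
        exact List.map_congr_left fun v _ => hs c v hc
      rw [List.map_append, List.sum_append, hs a ha, hs b hb]
      simp [hL', hM']
  have hi : Integrable (fun ω => cosf (V ω)) P := by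
    refine (hV.norm).mono' (continuous_cosf.comp_aestronglyMeasurable hV.1)
      (Eventually.of_forall fun ω => ?_)
    have := dist_cosf_le (V ω) 0
    have h0 : cosf (0 : E) = 0 := by ext u; simp [cosf]
    rwa [h0, dist_zero_right, dist_zero_right, one_mul] at this
  have hi2 : Integrable (fun ω => d (V ω)) P :=
    (hV.norm.const_mul C).mono' (hd.comp_aestronglyMeasurable hV.1) (Eventually.of_forall fun ω => hC _)
  have hmem := hA.closure.integral_mem isClosed_closure
    (Eventually.of_forall fun ω => subset_closure
      (⟨[V ω], fun u => by simp [cosf], by simp⟩ : (cosf (V ω), d (V ω)) ∈ A)) (hi.prodMk hi2)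
  rw [Metric.mem_closure_iff] at hmem
  obtain ⟨g, ⟨L, hL, hL'⟩, hg⟩ := hmem ε hε
  rw [integral_pair hi hi2, Prod.dist_eq, max_lt_iff] at hg
  refine ⟨L, fun u hu => ?_, ?_⟩
  · have h1 := (ContinuousMap.dist_apply_le_dist (f := ∫ ω, cosf (V ω) ∂P) (g := g.1) ⟨u, by simpa using hu⟩).trans hg.1.le
    rw [hL, dist_comm, Real.dist_eq] at h1
    have h2 : (∫ ω, cosf (V ω) ∂P) ⟨u, by simpa using hu⟩ = ∫ ω, |⟪V ω, u⟫| ∂P :=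
      ((ContinuousMap.evalCLM ℝ (⟨u, by simpa using hu⟩ : Metric.sphere (0 : E) 1)).integral_comp_comm hi).symm
    rwa [h2] at h1
  · rw [← hL', ← dist_eq_norm, dist_comm]
    exact hg.2.le

theorem eval_zonoid_integral {Ω : Type*} [MeasurableSpace Ω] {P : Measure Ω} [IsProbabilityMeasure P]
    {V : Ω → E} (hV : Integrable V P) {d : E → ℂ} (hd : Continuous d)
    (hs : ∀ (t : ℝ) v, 0 ≤ t → d (t • v) = t * d v) {D : ConvexBody E → ℂ} (hc : Continuous D)
    (hD : ∀ L : List E, D (zon (L ++ L.map Neg.neg)) = D 0 + (L.map d).sum) {Z : ConvexBody E}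
    (hZ : ∀ u, supp Z u = ∫ ω, |⟪V ω, u⟫| ∂P) : D Z = D 0 + ∫ ω, d (V ω) ∂P := by
  choose L hL1 hL2 using fun k : ℕ =>
    exists_list_near hV hd hs (Nat.one_div_pos_of_nat (α := ℝ) (n := k))
  have hlim := tendsto_one_div_add_atTop_nhds_zero_nat (𝕜 := ℝ)
  have t1 : Tendsto (fun k => zon (L k ++ (L k).map Neg.neg)) atTop (𝓝 Z) := by
    rw [tendsto_iff_dist_tendsto_zero]
    refine squeeze_zero (fun _ => dist_nonneg) (fun k => ?_) hlim
    refine dist_le_of_supp (Nat.one_div_pos_of_nat (α := ℝ)).le fun u hu => ?_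
    rw [supp_zon_symm, hZ]
    exact hL1 k u hu
  have t2 : Tendsto (fun k => ((L k).map d).sum) atTop (𝓝 (∫ ω, d (V ω) ∂P)) := by
    rw [tendsto_iff_norm_sub_tendsto_zero]
    exact squeeze_zero (fun _ => norm_nonneg _) hL2 hlim
  have t3 := (hc.tendsto Z).comp t1
  refine tendsto_nhds_unique t3 ?_
  simp only [Function.comp_def, hD]
  exact tendsto_const_nhds.add t2

end zonoid

open scoped Quaternion

variable {E : Type*} [NormedAddCommGroup E] [InnerProductSpace ℝ E] [FiniteDimensional ℝ E]
  [MeasurableSpace E] [BorelSpace E]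
variable {e : ℍ ≃ₗᵢ[ℝ] E} {μ : ConvexBody E → ℂ}

theorem Q2.dl_add_seg' (h : Q2 e μ) (z v : E) (K : ConvexBody E) :
    dl z μ (K + seg v) = dl z μ K + kf e μ (star (e.symm z) * e.symm v) := by
  have := h.dl_add_seg (e.symm z) (e.symm v) K
  simpa only [LinearIsometryEquiv.apply_symm_apply] using this

theorem Q2.sub_zon (h : Q2 e μ) (L : List E) (K M : ConvexBody E) :
    μ (K + zon L) - μ (M + zon L) = μ K - μ M + (L.map fun v => dl v μ K - dl v μ M).sum := by
  induction L generalizing K M with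
  | nil => simp [zon]
  | cons v L ih =>
    have h1 : zon (v :: L) = seg v + zon L := by simp [zon]
    have h2 : ∀ w, dl w μ (K + seg v) - dl w μ (M + seg v) = dl w μ K - dl w μ M := fun w => by
      rw [h.dl_add_seg', h.dl_add_seg']; ring
    rw [h1, ← add_assoc, ← add_assoc, ih]
    simp only [h2, List.map_cons, List.sum_cons]
    simp only [dl]
    ring

theorem Q2.sub_zonoid (h : Q2 e μ) {Ω : Type*} [MeasurableSpace Ω] {P : Measure Ω} [IsProbabilityMeasure P]
    {V : Ω → E} (hV : Integrable V P) {Z : ConvexBody E} (hZ : ∀ u, supp Z u = ∫ ω, |⟪V ω, u⟫| ∂P)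
    (K M : ConvexBody E) :
    μ (K + Z) - μ (M + Z) = μ K - μ M + ∫ ω, 2 * (dl (V ω) μ K - dl (V ω) μ M) ∂P := by
  have hc : Continuous fun Z => μ (K + Z) - μ (M + Z) :=
    (h.ctv.cont.comp (continuous_const.add continuous_id)).sub
      (h.ctv.cont.comp (continuous_const.add continuous_id))
  have hd : Continuous fun v : E => 2 * (dl v μ K - dl v μ M) :=
    continuous_const.mul ((continuous_dl_left h.ctv K).sub (continuous_dl_left h.ctv M))
  have := eval_zonoid_integral hV hd (fun t v ht => ?_) hc (fun L => ?_) hZ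
  · simpa using this
  · rw [h.ctv.dl_smul, h.ctv.dl_smul, abs_of_nonneg ht]; ring
  · rw [h.sub_zon, List.map_append, List.sum_append, List.map_map, add_zero, add_zero,
      List.sum_map_mul_left, two_mul]
    congr 3
    refine List.map_congr_left fun v _ => ?_
    simp [h.ctv.dl_neg]

/-- Locality: only the values of the support function where `K` and `M` differ matter. -/
theorem Q2.local (h : Q2 e μ) {Ω : Type*} [MeasurableSpace Ω] {P : Measure Ω} [IsProbabilityMeasure P]
    {V W : Ω → E} (hV : Integrable V P) (hW : Integrable W P) {K M : ConvexBody E}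
    (hKM : ∀ u, supp M u ≤ supp K u)
    (heq : ∀ u, supp M u ≠ supp K u → ∫ ω, |⟪V ω, u⟫| ∂P = ∫ ω, |⟪W ω, u⟫| ∂P) :
    ∫ ω, (dl (V ω) μ K - dl (V ω) μ M) ∂P = ∫ ω, (dl (W ω) μ K - dl (W ω) μ M) ∂P := by
  obtain ⟨X, -, hX⟩ := exists_zonoid hV
  obtain ⟨Y, -, hY⟩ := exists_zonoid hW
  obtain ⟨U, hU⟩ := ((supp_sublin X).sup (supp_sublin Y)).exists_body
  have key : ∀ Z : ConvexBody E, (∀ u, supp Z u ≤ supp U u) → (∀ u, supp M u ≠ supp K u → supp Z u = supp U u) →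
      μ (K + Z) - μ (M + Z) = μ (K + U) - μ (M + U) := by
    intro Z h1 h2
    have h3 := h.ctv.val_supp (K := K + Z) (L := M + U) (U := K + U) (I := M + Z) (fun u => ?_) fun u => ?_
    · linear_combination -h3
    all_goals
      rw [supp_add, supp_add, supp_add]
      by_cases hu : supp M u = supp K u
      · have := h1 u
        rw [hu]; simp [this]
      · have := hKM u
        rw [h2 u hu]; simp [this]
  have h1 := key X (fun u => by rw [hU]; exact le_max_left _ _) fun u hu => by
    rw [hU, hX, hY, heq u hu, max_self]
  have h2 := key Y (fun u => by rw [hU]; exact le_max_right _ _) fun u hu => by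
    rw [hU, hX, hY, heq u hu, max_self]
  rw [← h2, h.sub_zonoid hV hX, h.sub_zonoid hW hY, integral_const_mul, integral_const_mul] at h1
  have h3 := add_left_cancel h1
  exact mul_left_cancel₀ two_ne_zero h3

end

section

open scoped Quaternion

/-- The group of unit quaternions. -/
abbrev UQ := Metric.sphere (0 : ℍ) 1

instance : MeasurableSpace UQ := borel UQ
instance : BorelSpace UQ := ⟨rfl⟩

/-- The Haar probability measure on the unit quaternions. -/
def haarQ : Measure UQ := Measure.haarMeasure ⊤

instance : haarQ.IsHaarMeasure := by unfold haarQ; infer_instance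

instance : IsProbabilityMeasure haarQ := ⟨Measure.haarMeasure_self⟩

instance : haarQ.IsMulRightInvariant := by
  refine ⟨fun g => ?_⟩
  have : IsProbabilityMeasure (Measure.map (· * g) haarQ) :=
    Measure.isProbabilityMeasure_map (measurable_mul_const g).aemeasurable
  have : (Measure.map (· * g) haarQ).IsHaarMeasure := inferInstance
  exact Measure.isHaarMeasure_eq_of_isProbabilityMeasure _ _

theorem Continuous.integrable_compact {Ω F : Type*} [TopologicalSpace Ω] [CompactSpace Ω]
    [MeasurableSpace Ω] [BorelSpace Ω] {P : Measure Ω} [IsFiniteMeasure P] [NormedAddCommGroup F]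
    [SecondCountableTopology F]
    {f : Ω → F} (hf : Continuous f) : Integrable f P :=  by
  borelize F
  exact hf.integrable_of_hasCompactSupport (HasCompactSupport.of_compactSpace f)

/-- The first imaginary unit. -/
def qi : ℍ := mkq 0 1 0 0

/-- Conjugation `a x ā`. -/
def cq (a x : ℍ) : ℍ := a * x * star a

theorem cq_mul (a b x : ℍ) : cq (a * b) x = cq a (cq b x) := by
  simp only [cq, star_mul, mul_assoc]

theorem cq_smul (a x : ℍ) (t : ℝ) : cq a (t • x) = t • cq a x := by
  simp only [cq, smul_mul_assoc, mul_smul_comm]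

theorem cq_add (a x y : ℍ) : cq a (x + y) = cq a x + cq a y := by
  simp only [cq, mul_add, add_mul]

theorem cq_neg (a x : ℍ) : cq a (-x) = -cq a x := by simp [cq]

theorem cq_zero (a : ℍ) : cq a 0 = 0 := by simp [cq]

theorem inner_cq (a x y : ℍ) : ⟪cq a x, y⟫ = ⟪x, cq (star a) y⟫ := by
  simp only [Quaternion.inner_def, cq, star_mul, star_star]
  simp only [Quaternion.re_mul, Quaternion.imI_mul, Quaternion.imJ_mul, Quaternion.imK_mul,
    Quaternion.re_star, Quaternion.imI_star, Quaternion.imJ_star, Quaternion.imK_star]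
  ring

theorem uq_norm (a : UQ) : ‖(a : ℍ)‖ = 1 := by simp

theorem uq_star_mul (a : UQ) : star (a : ℍ) * a = 1 := by
  rw [Quaternion.star_mul_self, Quaternion.normSq_eq_norm_mul_self, uq_norm a]; simp

theorem uq_mul_star (a : UQ) : (a : ℍ) * star (a : ℍ) = 1 := by
  rw [Quaternion.self_mul_star, Quaternion.normSq_eq_norm_mul_self, uq_norm a]; simp

theorem cq_star_cq (a : UQ) (x : ℍ) : cq (star (a : ℍ)) (cq a x) = x := by
  rw [← cq_mul, uq_star_mul a]; simp [cq]

theorem cq_cq_star (a : UQ) (x : ℍ) : cq a (cq (star (a : ℍ)) x) = x := by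
  rw [← cq_mul, uq_mul_star a]; simp [cq]

theorem cq_real (a : UQ) (t : ℝ) : cq a (t : ℍ) = t := by
  rw [cq, ← Quaternion.coe_commutes, mul_assoc, uq_mul_star a, mul_one]

theorem norm_cq (a : UQ) (x : ℍ) : ‖cq a x‖ = ‖x‖ := by
  simp [cq, uq_norm a]

theorem re_cq (a : UQ) (x : ℍ) : (cq a x).re = x.re := by
  have h1 : ∀ z : ℍ, z.re = ⟪z, ((1 : ℝ) : ℍ)⟫ := fun z => by simp [Quaternion.inner_def]
  rw [h1, inner_cq, cq, star_star, ← Quaternion.coe_commutes, mul_assoc, uq_star_mul a, mul_one, ← h1]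

theorem cq_mul_distrib (a : UQ) (x y : ℍ) : cq a (x * y) = cq a x * cq a y := by
  simp only [cq]
  rw [← mul_assoc, mul_assoc (↑a * x) (star ↑a), ← mul_assoc (star (a : ℍ)), ← mul_assoc (star (a : ℍ)),
    uq_star_mul a, one_mul]
  simp only [mul_assoc]

/-- There is a rotation interchanging two given imaginary units. -/
theorem exists_conj_swap (X : ℍ) (h0 : X.re = 0) (h1 : ‖X‖ = 1) (h2 : X ≠ -qi) :
    ∃ c : UQ, cq c qi = X ∧ cq c X = qi := by
  obtain ⟨b, c, d, rfl⟩ : ∃ b c d, X = mkq 0 b c d := ⟨X.imI, X.imJ, X.imK, by ext <;> simp [h0]⟩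
  have hn : b ^ 2 + c ^ 2 + d ^ 2 = 1 := by
    have := Quaternion.normSq_eq_norm_mul_self (mkq 0 b c d)
    rw [h1, Quaternion.normSq_def'] at this
    simpa using this
  have hb : -1 < b := by
    rcases lt_or_ge (-1) b with h | h
    · exact h
    exfalso; apply h2
    have hb : b = -1 := by nlinarith [sq_nonneg c, sq_nonneg d]
    have hc : c = 0 := by subst hb; nlinarith [sq_nonneg c, sq_nonneg d]
    have hd : d = 0 := by subst hb; nlinarith [sq_nonneg c, sq_nonneg d]
    subst hb hc hd
    ext <;> simp [qi]
  set Y : ℍ := mkq 0 (1 + b) c d with hY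
  have hYn : ‖Y‖ * ‖Y‖ = 2 + 2 * b := by
    rw [← Quaternion.normSq_eq_norm_mul_self, Quaternion.normSq_def', hY]
    simp
    linear_combination hn
  have hY0 : ‖Y‖ ≠ 0 := fun h => by rw [h] at hYn; linarith
  have e1 : cq Y qi = (‖Y‖ * ‖Y‖) • (mkq 0 b c d) := by
    rw [hYn]
    ext <;> simp [cq, qi, hY]
    · ring
    · linear_combination (-1) * hn
    · ring
    · ring
  have e2 : cq Y (mkq 0 b c d) = (‖Y‖ * ‖Y‖) • qi := by
    rw [hYn]
    ext <;> simp [cq, qi, hY]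
    · ring
    · linear_combination (2 + b) * hn
    · linear_combination (c) * hn
    · linear_combination (d) * hn
  have hs : ∀ x, cq (‖Y‖⁻¹ • Y) x = (‖Y‖⁻¹ * ‖Y‖⁻¹) • cq Y x := fun x => by
    simp only [cq, Quaternion.star_smul, smul_mul_assoc, mul_smul_comm, smul_smul]
  refine ⟨⟨‖Y‖⁻¹ • Y, by simp [norm_smul, hY0]⟩, ?_, ?_⟩
  · rw [hs, e1, smul_smul]; field_simp; simp
  · rw [hs, e2, smul_smul]; field_simp; simp

section swap
variable {E : Type*} [NormedAddCommGroup E] [InnerProductSpace ℝ E] [FiniteDimensional ℝ E]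
  [MeasurableSpace E] [BorelSpace E]
variable {e : ℍ ≃ₗᵢ[ℝ] E} {μ : ConvexBody E → ℂ}

theorem continuous_cq_left (x : ℍ) : Continuous fun a : UQ => cq (a : ℍ) x := by
  have h1 : Continuous fun a : UQ => (a : ℍ) := continuous_subtype_val
  exact (h1.mul continuous_const).mul h1.star

theorem Q2.swap (h : Q2 e μ) (y X : ℍ) (hX : X.re = 0) :
    ∫ a : UQ, ((|⟪cq a qi, y⟫| : ℝ) : ℂ) * kf e μ (cq a X) ∂haarQ =
      ∫ a : UQ, ((|⟪cq a X, y⟫| : ℝ) : ℂ) * kf e μ (cq a qi) ∂haarQ := by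
  have key : ∀ X : ℍ, X.re = 0 → ‖X‖ = 1 →
      ∫ a : UQ, ((|⟪cq a qi, y⟫| : ℝ) : ℂ) * kf e μ (cq a X) ∂haarQ =
      ∫ a : UQ, ((|⟪cq a X, y⟫| : ℝ) : ℂ) * kf e μ (cq a qi) ∂haarQ := by
    intro X h0 h1
    by_cases h2 : X = -qi
    · subst h2
      simp only [cq_neg, h.kf_neg, inner_neg_left, abs_neg]
    obtain ⟨c, hc1, hc2⟩ := exists_conj_swap X h0 h1 h2
    rw [← integral_mul_right_eq_self (fun a : UQ => ((|⟪cq a qi, y⟫| : ℝ) : ℂ) * kf e μ (cq a X)) c]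
    refine integral_congr_ae (Eventually.of_forall fun a => ?_)
    have : ((a * c : UQ) : ℍ) = a * c := rfl
    simp only [this, cq_mul, hc1, hc2]
  rcases eq_or_ne X 0 with rfl | hX0
  · have hk : kf e μ 0 = 0 := by simpa using h.kf_smul 0 0
    simp [cq_zero, hk]
  have hn : ‖X‖ ≠ 0 := by simpa using hX0
  have h1 := key (‖X‖⁻¹ • X) (by simp [hX]) (by simp [norm_smul, hn])
  have h2 : X = ‖X‖ • (‖X‖⁻¹ • X) := by rw [smul_smul, mul_inv_cancel₀ hn, one_smul]
  rw [h2]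
  generalize ‖X‖⁻¹ • X = Z at *
  simp only [cq_smul _ Z, h.kf_smul, inner_smul_left, abs_mul]
  simp only [Complex.ofReal_mul, mul_assoc, mul_left_comm _ ((|‖X‖| : ℝ) : ℂ), RCLike.conj_to_real]
  rw [integral_const_mul, integral_const_mul, h1]

end swap

end

section

open scoped Quaternion

variable {E : Type*} [NormedAddCommGroup E] [InnerProductSpace ℝ E] [FiniteDimensional ℝ E]
  [MeasurableSpace E] [BorelSpace E]

section param
variable {Ω : Type*} [TopologicalSpace Ω] [CompactSpace Ω] [MeasurableSpace Ω] [BorelSpace Ω]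
  {P : Measure Ω} [IsFiniteMeasure P]

theorem continuous_integral_compact {X : Type*} [TopologicalSpace X] {F : X → Ω → ℂ}
    (hF : Continuous fun p : X × Ω => F p.1 p.2) : Continuous fun x => ∫ ω, F x ω ∂P := by
  have h1 : Continuous fun f : C(Ω, ℂ) => ∫ ω, f ω ∂P := by
    refine (LipschitzWith.of_dist_le_mul (K := (P.real univ).toNNReal) fun f g => ?_).continuous
    rw [dist_eq_norm, ← integral_sub f.continuous.integrable_compact g.continuous.integrable_compact,
      Real.coe_toNNReal _ measureReal_nonneg, mul_comm]
    refine norm_integral_le_of_norm_le_const (Eventually.of_forall fun ω => ?_)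
    rw [← dist_eq_norm]
    exact ContinuousMap.dist_apply_le_dist ω
  exact h1.comp (ContinuousMap.curry ⟨_, hF⟩).continuous

theorem CTV.integral {F : Ω → ConvexBody E → ℂ} (h : ∀ ω, CTV (F ω))
    (hF : Continuous fun p : ConvexBody E × Ω => F p.2 p.1) : CTV fun K => ∫ ω, F ω K ∂P := by
  have hi : ∀ K, Integrable (fun ω => F ω K) P := fun K =>
    (hF.comp (Continuous.prodMk_right K)).integrable_compact
  refine ⟨fun K L U I hU hI => ?_, continuous_integral_compact hF, fun x K => ?_⟩
  · rw [← integral_add (hi _) (hi _), ← integral_add (hi _) (hi _)]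
    exact integral_congr_ae (Eventually.of_forall fun ω => (h ω).val K L U I hU hI)
  · exact integral_congr_ae (Eventually.of_forall fun ω => (h ω).tinv x K)

end param

variable (e : ℍ ≃ₗᵢ[ℝ] E)

/-- The action of conjugation on `E`. -/
def cj (a : ℍ) : E →ₗ[ℝ] E where
  toFun x := e (cq a (e.symm x))
  map_add' x y := by rw [map_add, cq_add, map_add]
  map_smul' t x := by rw [map_smul, cq_smul, map_smul]; rfl

theorem cj_apply (a : ℍ) (x : ℍ) : cj e a (e x) = e (cq a x) := by simp [cj]

theorem supp_cj (a : ℍ) (K : ConvexBody E) (u : E) :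
    supp (lmap (cj e a) K) u = supp K (e (cq (star a) (e.symm u))) := by
  rw [supp_lmap]
  congr 1
  refine ext_inner_left ℝ fun v => ?_
  rw [LinearMap.adjoint_inner_right]
  have h1 : ⟪cj e a v, u⟫ = ⟪cq a (e.symm v), e.symm u⟫ := by
    rw [← e.inner_map_map]; simp [cj]
  rw [h1, inner_cq, ← e.inner_map_map]
  simp

theorem norm_cq_star (a : UQ) (x : ℍ) : ‖cq (star (a : ℍ)) x‖ = ‖x‖ := by
  simp [cq, norm_star]

theorem norm_cq_sub_le (a b : UQ) (x : ℍ) :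
    ‖cq (star (a : ℍ)) x - cq (star (b : ℍ)) x‖ ≤ 2 * ‖(a : ℍ) - b‖ * ‖x‖ := by
  have : cq (star (a : ℍ)) x - cq (star (b : ℍ)) x =
      star ((a : ℍ) - b) * x * a + star (b : ℍ) * x * (a - b) := by
    simp only [cq, star_star, star_sub]; noncomm_ring
  rw [this]
  refine (norm_add_le _ _).trans ?_
  rw [norm_mul, norm_mul, norm_mul, norm_mul, norm_star, norm_star, uq_norm, uq_norm]
  linarith

theorem continuous_lmap_cj : Continuous fun p : ConvexBody E × UQ => lmap (cj e p.2) p.1 := by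
  have h1 : ∀ a : UQ, LipschitzWith 1 fun K : ConvexBody E => lmap (cj e a) K := fun a => by
    refine LipschitzWith.of_dist_le_mul fun K L => ?_
    rw [NNReal.coe_one, one_mul]
    refine dist_le_of_supp dist_nonneg fun u hu => ?_
    rw [supp_cj, supp_cj]
    refine (abs_supp_sub_le _ _ _).trans ?_
    rw [e.norm_map, norm_cq_star, e.symm.norm_map, hu, mul_one]
  have h2 : ∀ K : ConvexBody E, Continuous fun a : UQ => lmap (cj e a) K := fun K => by
    refine (LipschitzWith.of_dist_le_mul (K := (dist K 0 * 2).toNNReal) fun a b => ?_).continuous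
    rw [Real.coe_toNNReal _ (by positivity)]
    refine dist_le_of_supp (by positivity) fun u hu => ?_
    rw [supp_cj, supp_cj]
    refine ((supp_sublin K).lipschitz_of_bound (fun u => (le_abs_self _).trans (abs_supp_le K u)) _ _).trans ?_
    rw [mul_assoc, ← map_sub, e.norm_map]
    refine mul_le_mul_of_nonneg_left ?_ dist_nonneg
    refine (norm_cq_sub_le a b _).trans ?_
    rw [e.symm.norm_map, hu, mul_one, Subtype.dist_eq, dist_eq_norm]
  exact continuous_prod_of_continuous_lipschitzWith _ 1 h2 h1

/-- The parameter space of the averages. -/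
abbrev OmQ := UQ × unitInterval

/-- The normalized measure on the parameter space. -/
def omQ : Measure OmQ := haarQ.prod volume

instance : IsProbabilityMeasure omQ := by unfold omQ; infer_instance

/-- The symmetric real parameter. -/
def sv (r : unitInterval) : ℝ := 2 * r - 1

theorem continuous_sv : Continuous sv := by unfold sv; fun_prop

/-- The quaternion `s + i`. -/
def zq (r : unitInterval) : ℍ := sv r • 1 + qi

theorem continuous_zq : Continuous zq := (continuous_sv.smul continuous_const).add continuous_const

theorem continuous_coe_uq : Continuous fun a : UQ => (a : ℍ) := continuous_subtype_val

theorem Continuous.cq {X : Type*} [TopologicalSpace X] {f g : X → ℍ} (hf : Continuous f)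
    (hg : Continuous g) : Continuous fun x => _root_.cq (f x) (g x) :=
  (hf.mul hg).mul hf.star

variable {e} {μ : ConvexBody E → ℂ}

theorem ctv_supp_add (u : E) : CTV fun K : ConvexBody E => ((supp K u + supp K (-u) : ℝ) : ℂ) := by
  refine CTV.mk' (fun K L U I hU hI => ?_) ?_ fun x K => ?_
  · rw [hU, hU, hI, hI]
    norm_cast
    linarith [max_add_min (supp K u) (supp L u), max_add_min (supp K (-u)) (supp L (-u))]
  · exact Complex.continuous_ofReal.comp ((continuous_supp_body u).add (continuous_supp_body _))
  · rw [supp_add, supp_add, supp_pt, supp_pt, inner_neg_right]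
    norm_cast; ring

theorem continuous_supp_pair : Continuous fun p : ConvexBody E × E => supp p.1 p.2 := by
  refine continuous_iff_continuousAt.2 fun p => ?_
  rw [ContinuousAt, tendsto_iff_dist_tendsto_zero]
  have h1 : Continuous fun q : ConvexBody E × E => dist q.1 p.1 * ‖q.2‖ + dist p.1 0 * ‖q.2 - p.2‖ := by
    fun_prop
  have h2 := h1.tendsto p
  simp only [dist_self, sub_self, norm_zero, mul_zero, zero_mul, add_zero] at h2
  refine squeeze_zero (fun _ => dist_nonneg) (fun q => ?_) h2
  rw [Real.dist_eq]
  refine (abs_sub_le _ (supp p.1 q.2) _).trans (add_le_add (abs_supp_sub_le _ _ _) ?_)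
  exact (supp_sublin p.1).lipschitz_of_bound (fun u => (le_abs_self _).trans (abs_supp_le p.1 u)) _ _

theorem Q2.kf_cq_im (h : Q2 e μ) (a : UQ) (X : ℍ) : kf e μ (cq a X) = kf e μ (cq a X.im) := by
  conv_lhs => rw [← Quaternion.re_add_im X, cq_add, cq_real, add_comm, h.kf_add_real]

theorem inner_im_left (X w : ℍ) (hw : w.re = 0) : ⟪X.im, w⟫ = ⟪X, w⟫ := by
  simp [Quaternion.inner_def, hw]

/-- The left hand side of the averaged identity. -/
def avL (e : ℍ ≃ₗᵢ[ℝ] E) (μ : ConvexBody E → ℂ) (y : ℍ) (K : ConvexBody E) : ℂ :=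
  ∫ p : OmQ, ((|⟪cq p.1 qi, y⟫| : ℝ) : ℂ) * dl (e (cq p.1 (zq p.2))) μ (lmap (cj e p.1) K) ∂omQ

/-- The right hand side of the averaged identity. -/
def avR (e : ℍ ≃ₗᵢ[ℝ] E) (μ : ConvexBody E → ℂ) (y : ℍ) (K : ConvexBody E) : ℂ :=
  ∫ p : OmQ, kf e μ (cq p.1 qi) * ((supp K (e (zq p.2 * cq (star (p.1 : ℍ)) y)) +
    supp K (-e (zq p.2 * cq (star (p.1 : ℍ)) y)) : ℝ) : ℂ) ∂omQ

theorem Q2.continuous_avL_integrand (h : Q2 e μ) (y : ℍ) : Continuous fun q : ConvexBody E × OmQ =>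
    ((|⟪cq q.2.1 qi, y⟫| : ℝ) : ℂ) * dl (e (cq q.2.1 (zq q.2.2))) μ (lmap (cj e q.2.1) q.1) := by
  have c0 : Continuous fun q : ConvexBody E × OmQ => q.2.1 := continuous_fst.comp continuous_snd
  have c1 : Continuous fun q : ConvexBody E × OmQ => (q.2.1 : ℍ) := continuous_coe_uq.comp c0
  have c2 : Continuous fun q : ConvexBody E × OmQ => cq q.2.1 qi := c1.cq continuous_const
  have c3 : Continuous fun q : ConvexBody E × OmQ => e (cq q.2.1 (zq q.2.2)) :=
    e.continuous.comp (c1.cq (continuous_zq.comp (continuous_snd.comp continuous_snd)))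
  have c4 : Continuous fun q : ConvexBody E × OmQ => lmap (cj e q.2.1) q.1 :=
    (continuous_lmap_cj e).comp (g := fun p : ConvexBody E × UQ => lmap (cj e (p.2 : ℍ)) p.1)
      (f := fun q : ConvexBody E × OmQ => (q.1, q.2.1)) (continuous_fst.prodMk c0)
  have c5 := (continuous_dl h.ctv).comp (c3.prodMk c4)
  exact (Complex.continuous_ofReal.comp (c2.inner continuous_const).abs).mul c5

theorem Q2.continuous_avR_integrand (h : Q2 e μ) (y : ℍ) : Continuous fun q : ConvexBody E × OmQ =>
    kf e μ (cq q.2.1 qi) * ((supp q.1 (e (zq q.2.2 * cq (star (q.2.1 : ℍ)) y)) +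
    supp q.1 (-e (zq q.2.2 * cq (star (q.2.1 : ℍ)) y)) : ℝ) : ℂ) := by
  have c0 : Continuous fun q : ConvexBody E × OmQ => q.2.1 := continuous_fst.comp continuous_snd
  have c1 : Continuous fun q : ConvexBody E × OmQ => (q.2.1 : ℍ) := continuous_coe_uq.comp c0
  have c2 : Continuous fun q : ConvexBody E × OmQ => cq q.2.1 qi := c1.cq continuous_const
  have c3 : Continuous fun q : ConvexBody E × OmQ => e (zq q.2.2 * cq (star (q.2.1 : ℍ)) y) :=
    e.continuous.comp ((continuous_zq.comp (continuous_snd.comp continuous_snd)).mul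
      (c1.star.cq continuous_const))
  exact (h.continuous_kf.comp c2).mul (Complex.continuous_ofReal.comp
    ((continuous_supp_pair.comp (continuous_fst.prodMk c3)).add
      (continuous_supp_pair.comp (continuous_fst.prodMk c3.neg))))

theorem Q2.avL_seg (h : Q2 e μ) (y : ℍ) (hy : y.re = 0) (v : ℍ) (K : ConvexBody E) :
    avL e μ y (K + seg (e v)) - avL e μ y K = avR e μ y (K + seg (e v)) - avR e μ y K := by
  have iL : ∀ K, Integrable (fun p : OmQ => ((|⟪cq p.1 qi, y⟫| : ℝ) : ℂ) *
      dl (e (cq p.1 (zq p.2))) μ (lmap (cj e p.1) K)) omQ := fun K =>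
    ((h.continuous_avL_integrand y).comp (Continuous.prodMk_right K)).integrable_compact
  have iR : ∀ K, Integrable (fun p : OmQ => kf e μ (cq p.1 qi) *
      ((supp K (e (zq p.2 * cq (star (p.1 : ℍ)) y)) +
      supp K (-e (zq p.2 * cq (star (p.1 : ℍ)) y)) : ℝ) : ℂ)) omQ := fun K =>
    ((h.continuous_avR_integrand y).comp (Continuous.prodMk_right K)).integrable_compact
  have i1 := (iL (K + seg (e v))).sub (iL K)
  have i2 := (iR (K + seg (e v))).sub (iR K)
  rw [avL, avL, avR, avR, ← integral_sub (iL _) (iL _), ← integral_sub (iR _) (iR _)]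
  rw [omQ] at i1 i2 ⊢
  refine (integral_prod_symm _ i1).trans (Eq.trans ?_ (integral_prod_symm _ i2).symm)
  refine integral_congr_ae (Eventually.of_forall fun r => ?_)
  simp only [Pi.sub_apply]
  have e1 : ∀ a : UQ, ((|⟪cq a qi, y⟫| : ℝ) : ℂ) * dl (e (cq a (zq r))) μ (lmap (cj e a) (K + seg (e v))) -
      ((|⟪cq a qi, y⟫| : ℝ) : ℂ) * dl (e (cq a (zq r))) μ (lmap (cj e a) K) =
      ((|⟪cq a qi, y⟫| : ℝ) : ℂ) * kf e μ (cq a (star (zq r) * v).im) := fun a => by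
    rw [lmap_add, lmap_seg, cj_apply, h.dl_add_seg, ← h.kf_cq_im, cq_mul_distrib]
    have : star (cq a (zq r)) = cq a (star (zq r)) := by simp [cq, mul_assoc]
    rw [this]; ring
  have e2 : ∀ a : UQ, kf e μ (cq a qi) * ((supp (K + seg (e v)) (e (zq r * cq (star (a : ℍ)) y)) +
      supp (K + seg (e v)) (-e (zq r * cq (star (a : ℍ)) y)) : ℝ) : ℂ) - kf e μ (cq a qi) *
      ((supp K (e (zq r * cq (star (a : ℍ)) y)) + supp K (-e (zq r * cq (star (a : ℍ)) y)) : ℝ) : ℂ) =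
      ((|⟪cq a (star (zq r) * v).im, y⟫| : ℝ) : ℂ) * kf e μ (cq a qi) := fun a => by
    have h1 : ⟪cq a (star (zq r) * v).im, y⟫ = ⟪v, zq r * cq (star (a : ℍ)) y⟫ := by
      rw [inner_cq, inner_im_left _ _ (by rw [← re_cq a, cq_cq_star, hy])]
      rw [Quaternion.inner_def, Quaternion.inner_def, star_mul]
      rw [← star_star (zq r)]
      generalize star (zq r) = A
      generalize star (cq (star (a : ℍ)) y) = B
      rw [star_star, mul_assoc, ← mul_assoc v]
      generalize v * B = C
      simp [Quaternion.re_mul]; ring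
    have h2 : ∀ t : ℝ, max 0 t + max 0 (-t) = |t| := fun t => by
      rcases le_total 0 t with ht | ht
      · rw [max_eq_right ht, max_eq_left (by linarith), abs_of_nonneg ht]; ring
      · rw [max_eq_left ht, max_eq_right (by linarith), abs_of_nonpos ht]; ring
    rw [supp_add, supp_add, supp_seg, supp_seg, inner_neg_right, e.inner_map_map, h1, ← h2]
    push_cast; ring
  simp only [e1, e2]
  exact h.swap y _ (by simp)

theorem Q2.avL_eq_avR (h : Q2 e μ) (y : ℍ) (hy : y.re = 0) (K : ConvexBody E) :
    avL e μ y K = avR e μ y K := by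
  have hc : CTV fun K => avL e μ y K - avR e μ y K := by
    refine CTV.sub (CTV.integral (fun p => ?_) (h.continuous_avL_integrand y))
      (CTV.integral (fun p => ?_) (h.continuous_avR_integrand y))
    · exact ((h.ctv.dl _).comp _).const_mul _
    · exact (ctv_supp_add _).const_mul _
  have he : Ev fun K => avL e μ y K - avR e μ y K := fun K L hKL => by
    have h1 : avL e μ y L = avL e μ y K := by
      refine integral_congr_ae (Eventually.of_forall fun p => ?_)
      beta_reduce
      congr 1
      refine h.even.dl h.ctv _ _ _ fun u => ?_
      rw [supp_lmap, supp_lmap, hKL, map_neg]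
    have h2 : avR e μ y L = avR e μ y K := by
      refine integral_congr_ae (Eventually.of_forall fun p => ?_)
      beta_reduce
      rw [hKL, hKL, neg_neg, add_comm]
    beta_reduce
    rw [h1, h2]
  have h0 : avL e μ y 0 - avR e μ y 0 = 0 := by
    simp [avL, avR, lmap_zero, h.dl_zero, supp_zero]
  rw [← sub_eq_zero]
  refine hc.eq_zero_of_zon he (fun L => ?_) K
  induction L with
  | nil => exact h0
  | cons v L ih =>
    have := h.avL_seg y hy (e.symm v) (zon L)
    rw [e.apply_symm_apply] at this
    rw [zon_cons, add_comm]
    linear_combination this + ih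

/-- The averaged identity for symmetric bodies invariant under conjugation. -/
theorem Q2.averaged (h : Q2 e μ) (y : ℍ) (hy : y.re = 0) (K : ConvexBody E)
    (hK : ∀ (a : UQ) x, supp K (e (cq a x)) = supp K (e x)) (hs : ∀ u, supp K (-u) = supp K u) :
    ∫ p : OmQ, ((|⟪cq p.1 qi, y⟫| : ℝ) : ℂ) * dl (e (cq p.1 (zq p.2))) μ K ∂omQ =
      2 * ∫ p : OmQ, kf e μ (cq p.1 qi) * ((supp K (e (cq p.1 (zq p.2) * y)) : ℝ) : ℂ) ∂omQ := by
  have h1 := h.avL_eq_avR y hy K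
  rw [avL, avR] at h1
  have h2 : ∀ a : UQ, lmap (cj e a) K = K := fun a => supp_inj fun u => by
    rw [supp_cj, ← hK a, cq_cq_star, e.apply_symm_apply]
  simp only [h2] at h1
  rw [h1, ← integral_const_mul]
  refine integral_congr_ae (Eventually.of_forall fun p => ?_)
  beta_reduce
  rw [hs, ← hK p.1, cq_mul_distrib, cq_cq_star]
  push_cast; ring

end

section

open scoped Quaternion

theorem integral_abs_affine {c x : ℝ} (hx : 0 < x) (h : |c| ≤ x) :
    ∫ r in (0:ℝ)..1, |c + (2 * r - 1) * x| = (c ^ 2 + x ^ 2) / (2 * x) := by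
  obtain ⟨h1, h2⟩ := abs_le.1 h
  have hi : ∀ a b : ℝ, IntervalIntegrable (fun r : ℝ => |c + (2 * r - 1) * x|) volume a b :=
    fun a b => (by fun_prop : Continuous fun r : ℝ => |c + (2 * r - 1) * x|).intervalIntegrable a b
  have hr : c + (2 * ((1 - c / x) / 2) - 1) * x = 0 := by field_simp; ring
  have hr0 : 0 ≤ (1 - c / x) / 2 := by
    have : c / x ≤ 1 := by rw [div_le_one hx]; exact h2
    linarith
  have hr1 : (1 - c / x) / 2 ≤ 1 := by
    have : -1 ≤ c / x := by rw [le_div_iff₀ hx]; linarith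
    linarith
  have hF : ∀ (σ a b : ℝ), ∫ r in a..b, σ * (c + (2 * r - 1) * x) =
      σ * (c * b + (b ^ 2 - b) * x) - σ * (c * a + (a ^ 2 - a) * x) := by
    intro σ a b
    refine intervalIntegral.integral_eq_sub_of_hasDerivAt
      (f := fun r => σ * (c * r + (r ^ 2 - r) * x)) (fun r _ => ?_) ?_
    · refine HasDerivAt.congr_deriv
        ((((hasDerivAt_id r).const_mul c).add
          ((((hasDerivAt_id r).pow 2).sub (hasDerivAt_id r)).mul_const x)).const_mul σ) ?_
      simp
    · exact (by fun_prop : Continuous fun r : ℝ => σ * (c + (2 * r - 1) * x)).intervalIntegrable a b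
  rw [← intervalIntegral.integral_add_adjacent_intervals (hi 0 ((1 - c / x) / 2)) (hi _ 1)]
  have e1 : ∫ r in (0:ℝ)..((1 - c / x) / 2), |c + (2 * r - 1) * x| =
      ∫ r in (0:ℝ)..((1 - c / x) / 2), (-1) * (c + (2 * r - 1) * x) := by
    refine intervalIntegral.integral_congr fun r hr' => ?_
    rw [uIcc_of_le hr0] at hr'
    have : c + (2 * r - 1) * x ≤ 0 := by rw [← hr]; have := hr'.2; gcongr
    simp only [abs_of_nonpos this]; ring
  have e2 : ∫ r in ((1 - c / x) / 2)..1, |c + (2 * r - 1) * x| =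
      ∫ r in ((1 - c / x) / 2)..1, 1 * (c + (2 * r - 1) * x) := by
    refine intervalIntegral.integral_congr fun r hr' => ?_
    rw [uIcc_of_le hr1] at hr'
    have : 0 ≤ c + (2 * r - 1) * x := by rw [← hr]; have := hr'.1; gcongr
    simp only [abs_of_nonneg this]; ring
  rw [e1, e2, hF, hF]
  field_simp
  ring

theorem integral_abs_sv {c x : ℝ} (hx : x ≠ 0) (h : |c| ≤ |x|) :
    ∫ r : unitInterval, |c + sv r * x| = (c ^ 2 + x ^ 2) / (2 * |x|) := by
  have key : ∀ {c x : ℝ}, 0 < x → |c| ≤ x →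
      ∫ r : unitInterval, |c + sv r * x| = (c ^ 2 + x ^ 2) / (2 * x) := by
    intro c x hx h
    rw [← integral_abs_affine hx h, intervalIntegral.integral_of_le zero_le_one,
      ← integral_Icc_eq_integral_Ioc]
    exact (unitInterval.measurePreserving_coe.integral_comp unitInterval.measurableEmbedding_coe
      (fun r : ℝ => |c + (2 * r - 1) * x|))
  rcases lt_or_gt_of_ne hx with h0 | h0
  · have := key (c := -c) (x := -x) (by linarith) (by rwa [abs_neg, ← abs_of_neg h0])
    rw [abs_of_neg h0]
    rw [neg_sq, neg_sq] at this
    rw [← this]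
    refine integral_congr_ae (ae_of_all _ fun r => ?_)
    beta_reduce
    rw [← abs_neg]; congr 1; ring
  · rw [abs_of_pos h0] at h ⊢
    exact key h0 h

theorem cq_qi_re (a : UQ) : (cq (a : ℍ) qi).re = 0 := by rw [re_cq]; simp [qi]

theorem norm_qi : ‖qi‖ = 1 := by
  have : ‖qi‖ ^ 2 = 1 := by
    rw [← real_inner_self_eq_norm_sq, Quaternion.inner_def]; simp [qi]
  nlinarith [norm_nonneg qi]

/-- The unit quaternion with the given normalized components. -/
def uqMk (p q r s : ℝ) (h : p ^ 2 + q ^ 2 + r ^ 2 + s ^ 2 = 1) : UQ :=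
  ⟨mkq p q r s, by
    have : ‖mkq p q r s‖ ^ 2 = 1 := by
      rw [← real_inner_self_eq_norm_sq, Quaternion.inner_def]; simp; linarith
    simp only [mem_sphere_iff_norm, sub_zero]
    nlinarith [norm_nonneg (mkq p q r s)]⟩

theorem exists_cq_qi (X : ℍ) (h0 : X.re = 0) (h1 : ‖X‖ = 1) : ∃ b : UQ, cq (b : ℍ) qi = X := by
  by_cases h : X = -qi
  · refine ⟨uqMk 0 0 1 0 (by norm_num), ?_⟩
    rw [h]
    ext <;> simp [uqMk, cq, qi]
  · obtain ⟨c, hc, -⟩ := exists_conj_swap X h0 h1 h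
    exact ⟨c, hc⟩

theorem integral_cq_rotate {F : Type*} [NormedAddCommGroup F] [NormedSpace ℝ F] (f : ℍ → F) (b : UQ) :
    ∫ a : UQ, f (cq (b : ℍ) (cq (a : ℍ) qi)) ∂haarQ = ∫ a : UQ, f (cq (a : ℍ) qi) ∂haarQ := by
  rw [← integral_mul_left_eq_self (μ := haarQ) (fun a : UQ => f (cq (a : ℍ) qi)) b]
  refine integral_congr_ae (ae_of_all _ fun a => ?_)
  beta_reduce
  rw [← cq_mul]; rfl

theorem inner_cq_cq (b : UQ) (x y : ℍ) : ⟪cq (b : ℍ) x, cq (b : ℍ) y⟫ = ⟪x, y⟫ := by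
  rw [inner_cq, cq_star_cq]

theorem inner_qi_right (x : ℍ) : ⟪x, qi⟫ = x.imI := by
  rw [Quaternion.inner_def]; simp [qi]

theorem inner_pure (x y : ℍ) (hx : x.re = 0) :
    ⟪x, y⟫ = x.imI * y.imI + x.imJ * y.imJ + x.imK * y.imK := by
  rw [Quaternion.inner_def]; simp [hx]

theorem exists_abs_moment : ∃ γ : ℝ, ∀ y : ℍ, y.re = 0 → ‖y‖ = 1 →
    ∫ a : UQ, |⟪cq (a : ℍ) qi, y⟫| ∂haarQ = γ := by
  refine ⟨∫ a : UQ, |⟪cq (a : ℍ) qi, qi⟫| ∂haarQ, fun y h0 h1 => ?_⟩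
  obtain ⟨b, rfl⟩ := exists_cq_qi y h0 h1
  rw [← integral_cq_rotate (fun w => |⟪w, cq (b : ℍ) qi⟫|) b]
  simp only [inner_cq_cq]

theorem cont_comp (f : ℍ → ℝ) (hf : Continuous f) :
    Integrable (fun a : UQ => f (cq (a : ℍ) qi)) haarQ :=
  (hf.comp (continuous_cq_left qi)).integrable_compact

theorem integral_add_six {Ω : Type*} [MeasurableSpace Ω] {P : Measure Ω} {f₁ f₂ f₃ f₄ f₅ f₆ : Ω → ℝ}
    (h₁ : Integrable f₁ P) (h₂ : Integrable f₂ P) (h₃ : Integrable f₃ P) (h₄ : Integrable f₄ P)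
    (h₅ : Integrable f₅ P) (h₆ : Integrable f₆ P) :
    ∫ a, (f₁ a + f₂ a + f₃ a + f₄ a + f₅ a + f₆ a) ∂P =
      ∫ a, f₁ a ∂P + ∫ a, f₂ a ∂P + ∫ a, f₃ a ∂P + ∫ a, f₄ a ∂P + ∫ a, f₅ a ∂P + ∫ a, f₆ a ∂P := by
  have h12 : Integrable (fun a => f₁ a + f₂ a) P := h₁.add h₂
  have h13 : Integrable (fun a => f₁ a + f₂ a + f₃ a) P := h12.add h₃
  have h14 : Integrable (fun a => f₁ a + f₂ a + f₃ a + f₄ a) P := h13.add h₄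
  have h15 : Integrable (fun a => f₁ a + f₂ a + f₃ a + f₄ a + f₅ a) P := h14.add h₅
  rw [integral_add h15 h₆, integral_add h14 h₅, integral_add h13 h₄, integral_add h12 h₃,
    integral_add h₁ h₂]

theorem exists_cubic_moment : ∃ α β : ℝ, ∀ y : ℍ, y.re = 0 → ‖y‖ = 1 → ∀ x : ℍ, x.re = 0 →
    ∫ a : UQ, |⟪cq (a : ℍ) qi, y⟫| * ⟪cq (a : ℍ) qi, x⟫ ^ 2 ∂haarQ = α * ‖x‖ ^ 2 + β * ⟪x, y⟫ ^ 2 := by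
  have cI : Continuous fun w : ℍ => w.imI := Quaternion.continuous_imI
  have cJ : Continuous fun w : ℍ => w.imJ := Quaternion.continuous_imJ
  have cK : Continuous fun w : ℍ => w.imK := Quaternion.continuous_imK
  set m : (ℍ → ℝ) → ℝ := fun f => ∫ a : UQ, |(cq (a : ℍ) qi).imI| * f (cq (a : ℍ) qi) ∂haarQ with hm
  have rot : ∀ (f : ℍ → ℝ) (b : UQ), m f =
      ∫ a : UQ, |(cq (b : ℍ) (cq (a : ℍ) qi)).imI| * f (cq (b : ℍ) (cq (a : ℍ) qi)) ∂haarQ :=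
    fun f b => (integral_cq_rotate (fun w => |w.imI| * f w) b).symm
  have r1 : ∀ w : ℍ, w.re = 0 → cq (uqMk 0 1 0 0 (by norm_num) : UQ) w
      = mkq 0 w.imI (-w.imJ) (-w.imK) := by
    intro w hw; ext <;> simp [uqMk, cq, hw]
  have r2 : ∀ w : ℍ, w.re = 0 → cq (uqMk 0 0 1 0 (by norm_num) : UQ) w
      = mkq 0 (-w.imI) (w.imJ) (-w.imK) := by
    intro w hw; ext <;> simp [uqMk, cq, hw]
  have hs : √2 / 2 * (√2 / 2) = 1 / 2 := by
    have := Real.mul_self_sqrt (show (0:ℝ) ≤ 2 by norm_num); nlinarith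
  have r3 : ∀ w : ℍ, w.re = 0 → cq (uqMk (√2 / 2) (√2 / 2) 0 0 (by nlinarith) : UQ) w
      = mkq 0 w.imI (-w.imK) w.imJ := by
    intro w hw
    ext
    · simp [uqMk, cq, hw]
    · simp [uqMk, cq, hw]; linear_combination (2 * w.imI) * hs
    · simp [uqMk, cq, hw]; linear_combination (-2 * w.imK) * hs
    · simp [uqMk, cq, hw]; linear_combination (2 * w.imJ) * hs
  have m12 : m (fun w => w.imI * w.imJ) = 0 := by
    have := rot (fun w => w.imI * w.imJ) (uqMk 0 1 0 0 (by norm_num))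
    simp only [r1 _ (cq_qi_re _), mkq_imI, mkq_imJ, mul_neg, integral_neg] at this
    simp only [hm] at this ⊢; linarith
  have m13 : m (fun w => w.imI * w.imK) = 0 := by
    have := rot (fun w => w.imI * w.imK) (uqMk 0 1 0 0 (by norm_num))
    simp only [r1 _ (cq_qi_re _), mkq_imI, mkq_imK, mul_neg, integral_neg] at this
    simp only [hm] at this ⊢; linarith
  have m23 : m (fun w => w.imJ * w.imK) = 0 := by
    have := rot (fun w => w.imJ * w.imK) (uqMk 0 0 1 0 (by norm_num))
    simp only [r2 _ (cq_qi_re _), mkq_imI, mkq_imJ, mkq_imK, mul_neg, integral_neg, abs_neg] at this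
    simp only [hm] at this ⊢; linarith
  have m33 : m (fun w => w.imK ^ 2) = m (fun w => w.imJ ^ 2) := by
    have := rot (fun w => w.imK ^ 2) (uqMk (√2 / 2) (√2 / 2) 0 0 (by nlinarith))
    simpa only [r3 _ (cq_qi_re _), mkq_imI, mkq_imK] using this
  refine ⟨m fun w => w.imJ ^ 2, m (fun w => w.imI ^ 2) - m (fun w => w.imJ ^ 2), fun y h0 h1 x hx => ?_⟩
  obtain ⟨b, rfl⟩ := exists_cq_qi y h0 h1
  rw [← integral_cq_rotate (fun w => |⟪w, cq (b : ℍ) qi⟫| * ⟪w, x⟫ ^ 2) b]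
  obtain ⟨x, rfl⟩ : ∃ z, x = cq (b : ℍ) z := ⟨_, (cq_cq_star b x).symm⟩
  rw [re_cq] at hx
  simp only [inner_cq_cq, norm_cq, inner_qi_right]
  rw [← real_inner_self_eq_norm_sq, inner_pure x x hx]
  have ig : ∀ f : ℍ → ℝ, Continuous f → ∀ t : ℝ,
      Integrable (fun a : UQ => t * (|(cq (a : ℍ) qi).imI| * f (cq (a : ℍ) qi))) haarQ :=
    fun f hf t => (cont_comp (fun w => |w.imI| * f w) (cI.abs.mul hf)).const_mul t
  have ex : ∀ a : UQ, |(cq (a : ℍ) qi).imI| * ⟪cq (a : ℍ) qi, x⟫ ^ 2 =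
      x.imI ^ 2 * (|(cq (a : ℍ) qi).imI| * (cq (a : ℍ) qi).imI ^ 2) +
      x.imJ ^ 2 * (|(cq (a : ℍ) qi).imI| * (cq (a : ℍ) qi).imJ ^ 2) +
      x.imK ^ 2 * (|(cq (a : ℍ) qi).imI| * (cq (a : ℍ) qi).imK ^ 2) +
      (2 * x.imI * x.imJ) * (|(cq (a : ℍ) qi).imI| * ((cq (a : ℍ) qi).imI * (cq (a : ℍ) qi).imJ)) +
      (2 * x.imI * x.imK) * (|(cq (a : ℍ) qi).imI| * ((cq (a : ℍ) qi).imI * (cq (a : ℍ) qi).imK)) +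
      (2 * x.imJ * x.imK) * (|(cq (a : ℍ) qi).imI| * ((cq (a : ℍ) qi).imJ * (cq (a : ℍ) qi).imK)) := by
    intro a
    rw [inner_pure _ x (cq_qi_re a)]; ring
  simp only [ex]
  have i1 := ig (fun w => w.imI ^ 2) (cI.pow 2) (x.imI ^ 2)
  have i2 := ig (fun w => w.imJ ^ 2) (cJ.pow 2) (x.imJ ^ 2)
  have i3 := ig (fun w => w.imK ^ 2) (cK.pow 2) (x.imK ^ 2)
  have i4 := ig (fun w => w.imI * w.imJ) (cI.mul cJ) (2 * x.imI * x.imJ)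
  have i5 := ig (fun w => w.imI * w.imK) (cI.mul cK) (2 * x.imI * x.imK)
  have i6 := ig (fun w => w.imJ * w.imK) (cJ.mul cK) (2 * x.imJ * x.imK)
  rw [integral_add_six i1 i2 i3 i4 i5 i6]
  simp only [integral_const_mul]
  simp only [hm] at m12 m13 m23 m33 ⊢
  rw [m12, m13, m23, m33]
  ring

end

section

open scoped Quaternion

instance isOpenPosMeasure_unitInterval : (volume : Measure unitInterval).IsOpenPosMeasure := by
  refine ⟨fun U hU hne h0 => ?_⟩
  obtain ⟨V, hV, rfl⟩ := isOpen_induced_iff.1 hU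
  obtain ⟨x, hx⟩ := hne
  have h1 : (V ∩ Ioo (0:ℝ) 1).Nonempty := by
    have : (V ∩ closure (Ioo (0:ℝ) 1)).Nonempty := by
      rw [closure_Ioo zero_ne_one]; exact ⟨x, hx, x.2⟩
    rwa [inter_comm, closure_inter_open_nonempty_iff hV, inter_comm] at this
  have h2 := (hV.inter isOpen_Ioo).measure_pos (volume : Measure ℝ) h1
  have h3 : (volume : Measure unitInterval) ((↑) ⁻¹' V) = volume (V ∩ Icc (0:ℝ) 1) := by
    rw [unitInterval.measurePreserving_coe.measure_preimage hV.measurableSet.nullMeasurableSet]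
    exact Measure.restrict_apply hV.measurableSet
  rw [h3] at h0
  exact h2.ne' (measure_mono_null (inter_subset_inter_right _ Ioo_subset_Icc_self) h0)

theorem one_le_norm_zq (r : unitInterval) : 1 ≤ ‖zq r‖ := by
  have : ‖zq r‖ ^ 2 = 1 + sv r ^ 2 := by
    rw [← real_inner_self_eq_norm_sq, Quaternion.inner_def]; simp [zq, qi]; ring
  nlinarith [norm_nonneg (zq r), sq_nonneg (sv r)]

theorem eq_or_neg_of_abs_inner {x y : ℍ} (hx : ‖x‖ = 1) (hy : ‖y‖ = 1) (h : 1 ≤ |⟪x, y⟫|) :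
    x = y ∨ x = -y := by
  have key : ∀ y : ℍ, ‖y‖ = 1 → 1 ≤ ⟪x, y⟫ → x = y := fun y hy h => by
    have h2 := real_inner_le_norm x y
    rw [hx, hy] at h2
    exact (inner_eq_one_iff_of_norm_eq_one (𝕜 := ℝ) hx hy).1 (by linarith)
  rcases le_abs.1 h with h | h
  · exact Or.inl (key y hy h)
  · exact Or.inr (key (-y) (by rwa [norm_neg]) (by rwa [inner_neg_right]))

theorem integrable_omQ {F : Type*} [NormedAddCommGroup F] [SecondCountableTopology F]
    {f : OmQ → F} (hf : Continuous f) : Integrable f omQ := by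
  have : IsFiniteMeasure omQ := by unfold omQ; infer_instance
  exact hf.integrable_compact

theorem continuous_cq_fst : Continuous fun p : OmQ => cq (p.1 : ℍ) qi :=
  (continuous_cq_left qi).comp continuous_fst

theorem continuous_bump (t : ℝ) (y : ℍ) :
    Continuous fun p : OmQ => max 0 (t * |⟪cq (p.1 : ℍ) qi, y⟫| - ‖zq p.2‖) := by
  have h1 : Continuous fun p : OmQ => ⟪cq (p.1 : ℍ) qi, y⟫ := continuous_cq_fst.inner continuous_const
  have h2 : Continuous fun p : OmQ => ‖zq p.2‖ := (continuous_zq.comp continuous_snd).norm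
  exact continuous_const.max ((continuous_const.mul h1.abs).sub h2)

theorem eq_zero_of_bump {F : ℍ → ℂ} (hF : Continuous F) (hn : ∀ w, F (-w) = F w)
    (h : ∀ t : ℝ, 1 < t → t ^ 2 ≤ 2 → ∫ p : OmQ,
      F (cq p.1 qi) * ((max 0 (t * |⟪cq (p.1 : ℍ) qi, qi⟫| - ‖zq p.2‖) : ℝ) : ℂ) ∂omQ = 0) :
    F qi = 0 := by
  by_contra hc
  set c := F qi with hcdef
  have hcF : Continuous fun a : UQ => (starRingEnd ℂ c * F (cq (a : ℍ) qi)).re :=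
    Complex.continuous_re.comp (continuous_const.mul (hF.comp (continuous_cq_left qi)))
  have hcc : 0 < (starRingEnd ℂ c * c).re := by
    rw [mul_comm, Complex.mul_conj]; exact_mod_cast Complex.normSq_pos.2 hc
  have habs : Continuous fun a : UQ => |⟪cq (a : ℍ) qi, qi⟫| :=
    ((continuous_cq_left qi).inner continuous_const).abs
  obtain ⟨m, hm0, hm1, hm⟩ : ∃ m : ℝ, 0 ≤ m ∧ m < 1 ∧ ∀ a : UQ,
      (starRingEnd ℂ c * F (cq (a : ℍ) qi)).re ≤ 0 → |⟪cq (a : ℍ) qi, qi⟫| ≤ m := by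
    have hZ : IsCompact {a : UQ | (starRingEnd ℂ c * F (cq (a : ℍ) qi)).re ≤ 0} :=
      (isClosed_le hcF continuous_const).isCompact
    by_cases hne : {a : UQ | (starRingEnd ℂ c * F (cq (a : ℍ) qi)).re ≤ 0}.Nonempty
    · obtain ⟨a0, ha0, hmax⟩ := hZ.exists_isMaxOn hne habs.continuousOn
      refine ⟨_, abs_nonneg _, ?_, fun a ha => hmax ha⟩
      by_contra! hge
      rw [mem_ofPred_eq] at ha0
      rcases eq_or_neg_of_abs_inner (by rw [norm_cq, norm_qi]) norm_qi hge with h1 | h1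
      · rw [h1] at ha0; linarith
      · rw [h1, hn] at ha0; linarith
    · refine ⟨0, le_rfl, zero_lt_one, fun a ha => (hne ⟨a, ha⟩).elim⟩
  obtain ⟨t, ht1, ht2, htm⟩ : ∃ t : ℝ, 1 < t ∧ t ^ 2 ≤ 2 ∧ t * m ≤ 1 := by
    have h1 : 1 < 2 / (1 + m) := by rw [lt_div_iff₀ (by linarith)]; linarith
    have h3 : 1 < min (5/4) (2 / (1 + m)) := lt_min (by norm_num) h1
    refine ⟨min (5/4) (2 / (1 + m)), h3, ?_, ?_⟩
    · have := min_le_left (5/4) (2 / (1 + m)); nlinarith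
    · refine (mul_le_mul_of_nonneg_right (min_le_right _ _) hm0).trans ?_
      rw [div_mul_eq_mul_div, div_le_one (by linarith)]; linarith
  have hb := continuous_bump t qi
  have hg : Continuous fun p : OmQ => (starRingEnd ℂ c * F (cq (p.1 : ℍ) qi)).re *
      max 0 (t * |⟪cq (p.1 : ℍ) qi, qi⟫| - ‖zq p.2‖) := (hcF.comp continuous_fst).mul hb
  have : IsFiniteMeasure omQ := by unfold omQ; infer_instance
  have : omQ.IsOpenPosMeasure := by unfold omQ; infer_instance
  have hpos := hg.integral_pos_of_hasCompactSupport_nonneg_nonzero (μ := omQ)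
    (HasCompactSupport.of_compactSpace _) (x := ((1 : UQ), ⟨1/2, by norm_num, by norm_num⟩)) ?_ ?_
  · have hz := congrArg (fun z => (starRingEnd ℂ c * z).re) (h t ht1 ht2)
    simp only [mul_zero, Complex.zero_re] at hz
    have hi : Integrable (fun p : OmQ => starRingEnd ℂ c * (F (cq p.1 qi) *
        ((max 0 (t * |⟪cq (p.1 : ℍ) qi, qi⟫| - ‖zq p.2‖) : ℝ) : ℂ))) omQ :=
      integrable_omQ (continuous_const.mul ((hF.comp continuous_cq_fst).mul
        (Complex.continuous_ofReal.comp hb)))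
    have he : ∫ p : OmQ, (starRingEnd ℂ c * F (cq (p.1 : ℍ) qi)).re *
      max 0 (t * |⟪cq (p.1 : ℍ) qi, qi⟫| - ‖zq p.2‖) ∂omQ = 0 := by
      refine Eq.trans ?_ hz
      rw [← integral_const_mul, ← RCLike.re_eq_complex_re, ← integral_re hi]
      refine integral_congr_ae (ae_of_all _ fun p => ?_)
      beta_reduce
      rw [RCLike.re_eq_complex_re, ← mul_assoc, Complex.re_mul_ofReal]
    linarith
  · intro p
    simp only [Pi.zero_apply]
    by_cases hp : (starRingEnd ℂ c * F (cq (p.1 : ℍ) qi)).re ≤ 0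
    · have h1 := hm _ hp
      have h2 := one_le_norm_zq p.2
      have h3 : t * |⟪cq (p.1 : ℍ) qi, qi⟫| ≤ t * m := by gcongr
      rw [max_eq_left (by linarith), mul_zero]
    · exact mul_nonneg (not_le.1 hp).le (le_max_left _ _)
  · have hz : zq (⟨1/2, by norm_num, by norm_num⟩ : unitInterval) = qi := by
      simp [zq, sv]
    have h1 : cq ((1 : UQ) : ℍ) qi = qi := by simp [cq]
    simp only [h1, hz, norm_qi, real_inner_self_eq_norm_sq]
    rw [max_eq_right (by norm_num; linarith)]
    norm_num
    refine ⟨?_, by linarith⟩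
    have := hcc.ne'
    rw [← hcdef]
    simpa using this

end

section

open scoped Quaternion

variable {E : Type*} [NormedAddCommGroup E] [InnerProductSpace ℝ E] [FiniteDimensional ℝ E]
  [MeasurableSpace E] [BorelSpace E] {e : ℍ ≃ₗᵢ[ℝ] E} {μ : ConvexBody E → ℂ}

theorem continuous_cq_zq : Continuous fun p : OmQ => cq (p.1 : ℍ) (zq p.2) :=
  Continuous.cq (continuous_coe_uq.comp continuous_fst) (continuous_zq.comp continuous_snd)

theorem continuous_inner_fst (y : ℍ) : Continuous fun p : OmQ => ⟪cq (p.1 : ℍ) qi, y⟫ :=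
  continuous_cq_fst.inner continuous_const

theorem cq_zq (a : UQ) (r : unitInterval) : cq (a : ℍ) (zq r) = (sv r : ℍ) + cq (a : ℍ) qi := by
  rw [zq, cq_add]
  congr 1
  rw [cq_smul, cq, mul_one, uq_mul_star]
  ext <;> simp

theorem inner_cq_zq (a : UQ) (r : unitInterval) (x : ℍ) :
    ⟪cq (a : ℍ) (zq r), x⟫ = ⟪cq (a : ℍ) qi, x.im⟫ + sv r * x.re := by
  rw [cq_zq, inner_add_left, real_inner_comm x.im, inner_im_left x _ (cq_qi_re a),
    real_inner_comm x (cq _ _), Quaternion.inner_def (sv r : ℍ)]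
  simp; ring

theorem exists_moment_omQ : ∃ α β γ : ℝ, ∀ y : ℍ, y.re = 0 → ‖y‖ = 1 → ∀ x : ℍ, x.re ≠ 0 →
    ‖x.im‖ ≤ |x.re| → ∫ p : OmQ, |⟪cq (p.1 : ℍ) qi, y⟫| * |⟪cq (p.1 : ℍ) (zq p.2), x⟫| ∂omQ =
      (α * ‖x.im‖ ^ 2 + β * ⟪x, y⟫ ^ 2 + γ * x.re ^ 2) / (2 * |x.re|) := by
  obtain ⟨γ, hγ⟩ := exists_abs_moment
  obtain ⟨α, β, hαβ⟩ := exists_cubic_moment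
  refine ⟨α, β, γ, fun y h0 h1 x hx hxi => ?_⟩
  have h_integrable : Integrable (fun p : OmQ => |⟪cq (p.1 : ℍ) qi, y⟫| * |⟪cq (p.1 : ℍ) (zq p.2), x⟫|) omQ :=
    integrable_omQ ((continuous_inner_fst y).abs.mul (continuous_cq_zq.inner continuous_const).abs)
  rw [omQ] at h_integrable ⊢
  rw [integral_prod _ h_integrable]
  have hin : ∀ a : UQ, ∫ r : unitInterval, |⟪cq (a : ℍ) qi, y⟫| * |⟪cq (a : ℍ) (zq r), x⟫| =
      (1 / (2 * |x.re|)) * (|⟪cq (a : ℍ) qi, y⟫| * ⟪cq (a : ℍ) qi, x.im⟫ ^ 2) +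
      (x.re ^ 2 / (2 * |x.re|)) * |⟪cq (a : ℍ) qi, y⟫| := by
    intro a
    rw [integral_const_mul]
    simp only [inner_cq_zq]
    rw [integral_abs_sv hx]
    · ring
    · refine (abs_real_inner_le_norm _ _).trans ?_
      rwa [norm_cq, norm_qi, one_mul]
  simp only [hin]
  rw [integral_add, integral_const_mul, integral_const_mul, hγ y h0 h1, hαβ y h0 h1 _ (by simp),
    inner_im_left x y h0]
  · ring
  · exact (cont_comp (fun w => |⟪w, y⟫| * ⟪w, x.im⟫ ^ 2) (by fun_prop)).const_mul _
  · exact (cont_comp (fun w => |⟪w, y⟫|) (by fun_prop)).const_mul _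

/-- The weighted pair of directions used to test locality. -/
def tw (c₁ c₂ : ℝ) (y₁ y₂ : ℍ) (p : OmQ) : ℝ :=
  c₁ * |⟪cq (p.1 : ℍ) qi, y₁⟫| + c₂ * |⟪cq (p.1 : ℍ) qi, y₂⟫|

theorem continuous_tw (c₁ c₂ : ℝ) (y₁ y₂ : ℍ) : Continuous (tw c₁ c₂ y₁ y₂) := by
  unfold tw
  exact (continuous_const.mul (continuous_inner_fst y₁).abs).add
    (continuous_const.mul (continuous_inner_fst y₂).abs)

theorem tw_nonneg {c₁ c₂ : ℝ} (h1 : 0 ≤ c₁) (h2 : 0 ≤ c₂) (y₁ y₂ : ℍ) (p : OmQ) :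
    0 ≤ tw c₁ c₂ y₁ y₂ p := by
  unfold tw; positivity

theorem integral_abs_tw {α β γ : ℝ} (hm : ∀ y : ℍ, y.re = 0 → ‖y‖ = 1 → ∀ x : ℍ, x.re ≠ 0 →
    ‖x.im‖ ≤ |x.re| → ∫ p : OmQ, |⟪cq (p.1 : ℍ) qi, y⟫| * |⟪cq (p.1 : ℍ) (zq p.2), x⟫| ∂omQ =
      (α * ‖x.im‖ ^ 2 + β * ⟪x, y⟫ ^ 2 + γ * x.re ^ 2) / (2 * |x.re|))
    {c₁ c₂ : ℝ} (h1 : 0 ≤ c₁) (h2 : 0 ≤ c₂) {y₁ y₂ : ℍ} (hy₁ : y₁.re = 0) (hn₁ : ‖y₁‖ = 1)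
    (hy₂ : y₂.re = 0) (hn₂ : ‖y₂‖ = 1) {x : ℍ} (hx : x.re ≠ 0) (hxi : ‖x.im‖ ≤ |x.re|) :
    ∫ p : OmQ, |⟪tw c₁ c₂ y₁ y₂ p • e (cq (p.1 : ℍ) (zq p.2)), e x⟫| ∂omQ =
      ((c₁ + c₂) * (α * ‖x.im‖ ^ 2 + γ * x.re ^ 2) +
        β * (c₁ * ⟪x, y₁⟫ ^ 2 + c₂ * ⟪x, y₂⟫ ^ 2)) / (2 * |x.re|) := by
  have hi : ∀ (c : ℝ) (y : ℍ), Integrable (fun p : OmQ =>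
      c * (|⟪cq (p.1 : ℍ) qi, y⟫| * |⟪cq (p.1 : ℍ) (zq p.2), x⟫|)) omQ := fun c y =>
    (integrable_omQ ((continuous_inner_fst y).abs.mul
      (continuous_cq_zq.inner continuous_const).abs)).const_mul c
  have he : ∀ p : OmQ, |⟪tw c₁ c₂ y₁ y₂ p • e (cq (p.1 : ℍ) (zq p.2)), e x⟫| =
      c₁ * (|⟪cq (p.1 : ℍ) qi, y₁⟫| * |⟪cq (p.1 : ℍ) (zq p.2), x⟫|) +
      c₂ * (|⟪cq (p.1 : ℍ) qi, y₂⟫| * |⟪cq (p.1 : ℍ) (zq p.2), x⟫|) := by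
    intro p
    rw [real_inner_smul_left, abs_mul, abs_of_nonneg (tw_nonneg h1 h2 _ _ p), e.inner_map_map, tw]
    ring
  simp only [he]
  rw [integral_add (hi _ _) (hi _ _), integral_const_mul, integral_const_mul, hm _ hy₁ hn₁ _ hx hxi,
    hm _ hy₂ hn₂ _ hx hxi]
  ring

/-- The pairing of the Klain function with the support function of a body. -/
def kp (e : ℍ ≃ₗᵢ[ℝ] E) (μ : ConvexBody E → ℂ) (y : ℍ) (K : ConvexBody E) : ℂ :=
  ∫ p : OmQ, kf e μ (cq p.1 qi) * ((supp K (e (cq p.1 (zq p.2) * y)) : ℝ) : ℂ) ∂omQ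

theorem Q2.integral_dl_tw (h : Q2 e μ) {c₁ c₂ : ℝ} (h1 : 0 ≤ c₁) (h2 : 0 ≤ c₂) {y₁ y₂ : ℍ}
    (hy₁ : y₁.re = 0) (hy₂ : y₂.re = 0) (K : ConvexBody E)
    (hK : ∀ (a : UQ) x, supp K (e (cq a x)) = supp K (e x)) (hs : ∀ u, supp K (-u) = supp K u) :
    ∫ p : OmQ, dl (tw c₁ c₂ y₁ y₂ p • e (cq (p.1 : ℍ) (zq p.2))) μ K ∂omQ =
      2 * (c₁ * kp e μ y₁ K + c₂ * kp e μ y₂ K) := by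
  have hd : Continuous fun p : OmQ => dl (e (cq (p.1 : ℍ) (zq p.2))) μ K :=
    (continuous_dl_left h.ctv K).comp (e.continuous.comp continuous_cq_zq)
  have hi : ∀ (c : ℝ) (y : ℍ), Integrable (fun p : OmQ =>
      (c : ℂ) * (((|⟪cq p.1 qi, y⟫| : ℝ) : ℂ) * dl (e (cq p.1 (zq p.2))) μ K)) omQ := fun c y =>
    (integrable_omQ ((Complex.continuous_ofReal.comp (continuous_inner_fst y).abs).mul
      hd)).const_mul _
  have he : ∀ p : OmQ, dl (tw c₁ c₂ y₁ y₂ p • e (cq (p.1 : ℍ) (zq p.2))) μ K =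
      (c₁ : ℂ) * (((|⟪cq p.1 qi, y₁⟫| : ℝ) : ℂ) * dl (e (cq p.1 (zq p.2))) μ K) +
      (c₂ : ℂ) * (((|⟪cq p.1 qi, y₂⟫| : ℝ) : ℂ) * dl (e (cq p.1 (zq p.2))) μ K) := by
    intro p
    rw [h.ctv.dl_smul, abs_of_nonneg (tw_nonneg h1 h2 _ _ p), tw]
    push_cast; ring
  simp only [he]
  rw [integral_add (hi _ _) (hi _ _), integral_const_mul, integral_const_mul,
    h.averaged y₁ hy₁ K hK hs, h.averaged y₂ hy₂ K hK hs, kp, kp]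
  ring

theorem continuous_tw_smul (c₁ c₂ : ℝ) (y₁ y₂ : ℍ) :
    Continuous fun p : OmQ => tw c₁ c₂ y₁ y₂ p • e (cq (p.1 : ℍ) (zq p.2)) :=
  (continuous_tw c₁ c₂ y₁ y₂).smul (e.continuous.comp continuous_cq_zq)

theorem integrable_tw_smul (c₁ c₂ : ℝ) (y₁ y₂ : ℍ) :
    Integrable (fun p : OmQ => tw c₁ c₂ y₁ y₂ p • e (cq (p.1 : ℍ) (zq p.2))) omQ := by
  have : IsFiniteMeasure omQ := by unfold omQ; infer_instance
  exact (continuous_tw_smul (e := e) c₁ c₂ y₁ y₂).integrable_compact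

/-- The pairing of the Klain function with the bump. -/
def kb (e : ℍ ≃ₗᵢ[ℝ] E) (μ : ConvexBody E → ℂ) (t : ℝ) (y : ℍ) : ℂ :=
  ∫ p : OmQ, kf e μ (cq p.1 qi) * ((max 0 (t * |⟪cq (p.1 : ℍ) qi, y⟫| - ‖zq p.2‖) : ℝ) : ℂ) ∂omQ

theorem re_cq_zq_mul (a : UQ) (r : unitInterval) {y : ℍ} (hy : y.re = 0) :
    |(cq (a : ℍ) (zq r) * y).re| = |⟪cq (a : ℍ) qi, y⟫| := by
  rw [cq_zq, inner_pure _ _ (cq_qi_re a), ← abs_neg]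
  congr 1
  simp [hy, re_cq, qi]
  ring

theorem Q2.kb_relation (h : Q2 e μ) {c₁ c₂ c₃ c₄ : ℝ} (h1 : 0 ≤ c₁) (h2 : 0 ≤ c₂) (h3 : 0 ≤ c₃)
    (h4 : 0 ≤ c₄) (hc : c₁ + c₂ = c₃ + c₄) {y₁ y₂ y₃ y₄ : ℍ} (hy₁ : y₁.re = 0) (hn₁ : ‖y₁‖ = 1)
    (hy₂ : y₂.re = 0) (hn₂ : ‖y₂‖ = 1) (hy₃ : y₃.re = 0) (hn₃ : ‖y₃‖ = 1) (hy₄ : y₄.re = 0)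
    (hn₄ : ‖y₄‖ = 1)
    (hq : ∀ x : ℍ, c₁ * ⟪x, y₁⟫ ^ 2 + c₂ * ⟪x, y₂⟫ ^ 2 = c₃ * ⟪x, y₃⟫ ^ 2 + c₄ * ⟪x, y₄⟫ ^ 2)
    {t : ℝ} (ht : 1 < t) (ht2 : t ^ 2 ≤ 2) :
    c₁ * kb e μ t y₁ + c₂ * kb e μ t y₂ = c₃ * kb e μ t y₃ + c₄ * kb e μ t y₄ := by
  obtain ⟨M, hM⟩ := (sublin_norm (E := E)).exists_body
  have hsub := (sublin_norm (E := E)).sup ((sublin_abs_inner (e 1)).const_mul (zero_le_one.trans ht.le))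
  obtain ⟨K, hK⟩ := hsub.exists_body
  have hMe : ∀ x, supp M (e x) = ‖x‖ := fun x => by rw [hM, e.norm_map]
  have hKe : ∀ x, supp K (e x) = max ‖x‖ (t * |x.re|) := fun x => by
    rw [hK, e.norm_map, e.inner_map_map, Quaternion.inner_def]; simp
  have : IsProbabilityMeasure omQ := by unfold omQ; infer_instance
  have hloc := h.local (P := omQ) (integrable_tw_smul (e := e) c₁ c₂ y₁ y₂)
    (integrable_tw_smul (e := e) c₃ c₄ y₃ y₄) (K := K) (M := M)
    (fun u => by rw [hM, hK]; exact le_max_left _ _) ?_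
  · have hid : ∀ (c c' : ℝ) (y y' : ℍ) (L : ConvexBody E), Integrable (fun p : OmQ =>
        dl (tw c c' y y' p • e (cq (p.1 : ℍ) (zq p.2))) μ L) omQ := fun c c' y y' L =>
      integrable_omQ ((continuous_dl_left h.ctv L).comp (continuous_tw_smul c c' y y'))
    rw [integral_sub (hid _ _ _ _ _) (hid _ _ _ _ _), integral_sub (hid _ _ _ _ _) (hid _ _ _ _ _)] at hloc
    have sK : ∀ u, supp K (-u) = supp K u := fun u => by rw [hK, hK, norm_neg, inner_neg_left, abs_neg]
    have sM : ∀ u, supp M (-u) = supp M u := fun u => by rw [hM, hM, norm_neg]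
    have rK : ∀ (a : UQ) x, supp K (e (cq a x)) = supp K (e x) := fun a x => by
      rw [hKe, hKe, norm_cq, re_cq]
    have rM : ∀ (a : UQ) x, supp M (e (cq a x)) = supp M (e x) := fun a x => by
      rw [hMe, hMe, norm_cq]
    rw [h.integral_dl_tw h1 h2 hy₁ hy₂ K rK sK, h.integral_dl_tw h1 h2 hy₁ hy₂ M rM sM,
      h.integral_dl_tw h3 h4 hy₃ hy₄ K rK sK, h.integral_dl_tw h3 h4 hy₃ hy₄ M rM sM] at hloc
    have hkb : ∀ y : ℍ, y.re = 0 → ‖y‖ = 1 → kb e μ t y = kp e μ y K - kp e μ y M := by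
      intro y hy hn
      have hcm : Continuous fun p : OmQ => e (cq (p.1 : ℍ) (zq p.2) * y) :=
        e.continuous.comp (continuous_cq_zq.mul continuous_const)
      have hi : ∀ L : ConvexBody E, Integrable (fun p : OmQ => kf e μ (cq p.1 qi) *
          ((supp L (e (cq p.1 (zq p.2) * y)) : ℝ) : ℂ)) omQ := fun L =>
        integrable_omQ ((h.continuous_kf.comp continuous_cq_fst).mul
          (Complex.continuous_ofReal.comp ((continuous_supp L).comp hcm)))
      rw [kp, kp, ← integral_sub (hi K) (hi M), kb]
      refine integral_congr_ae (ae_of_all _ fun p => ?_)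
      beta_reduce
      rw [hKe, hMe, norm_mul, hn, mul_one, norm_cq, re_cq_zq_mul _ _ hy, ← mul_sub,
        ← Complex.ofReal_sub, ← max_sub_sub_right, sub_self]
    rw [hkb _ hy₁ hn₁, hkb _ hy₂ hn₂, hkb _ hy₃ hn₃, hkb _ hy₄ hn₄]
    linear_combination hloc / 2
  · intro u hu
    obtain ⟨x, rfl⟩ := e.surjective u
    rw [hMe, hKe] at hu
    have hlt : ‖x‖ < t * |x.re| := by
      by_contra! hle
      exact hu (max_eq_left hle).symm
    have hre : x.re ≠ 0 := by
      rintro h0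
      rw [h0, abs_zero, mul_zero] at hlt
      exact absurd (norm_nonneg x) (not_le.2 hlt)
    have him : ‖x.im‖ ≤ |x.re| := by
      have e1 : ‖x‖ ^ 2 = x.re ^ 2 + ‖x.im‖ ^ 2 := by
        rw [← real_inner_self_eq_norm_sq, ← real_inner_self_eq_norm_sq, Quaternion.inner_def,
          Quaternion.inner_def]
        simp; ring
      have e2 : ‖x‖ ^ 2 ≤ (t * |x.re|) ^ 2 := by gcongr
      rw [mul_pow, sq_abs] at e2
      have e3 : t ^ 2 * x.re ^ 2 ≤ 2 * x.re ^ 2 := by gcongr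
      refine (le_abs_self _).trans (sq_le_sq.1 ?_)
      linarith
    obtain ⟨α, β, γ, hm⟩ := exists_moment_omQ
    rw [integral_abs_tw hm h1 h2 hy₁ hn₁ hy₂ hn₂ hre him,
      integral_abs_tw hm h3 h4 hy₃ hn₃ hy₄ hn₄ hre him, hc, hq]

theorem Q2.kb_rotate (h : Q2 e μ) (t : ℝ) (b : UQ) :
    kb e μ t (cq (b : ℍ) qi) = ∫ p : OmQ, kf e μ (cq (b : ℍ) (cq p.1 qi)) *
      ((max 0 (t * |⟪cq (p.1 : ℍ) qi, qi⟫| - ‖zq p.2‖) : ℝ) : ℂ) ∂omQ := by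
  have i1 : Integrable (fun p : OmQ => kf e μ (cq p.1 qi) *
      ((max 0 (t * |⟪cq (p.1 : ℍ) qi, cq (b : ℍ) qi⟫| - ‖zq p.2‖) : ℝ) : ℂ)) omQ :=
    integrable_omQ ((h.continuous_kf.comp continuous_cq_fst).mul
      (Complex.continuous_ofReal.comp (continuous_bump t _)))
  have hb : Continuous fun w : ℍ => cq (b : ℍ) w := Continuous.cq continuous_const continuous_id
  have i2 : Integrable (fun p : OmQ => kf e μ (cq (b : ℍ) (cq p.1 qi)) *
      ((max 0 (t * |⟪cq (p.1 : ℍ) qi, qi⟫| - ‖zq p.2‖) : ℝ) : ℂ)) omQ :=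
    integrable_omQ (((h.continuous_kf.comp hb).comp continuous_cq_fst).mul
      (Complex.continuous_ofReal.comp (continuous_bump t _)))
  rw [kb]
  rw [omQ] at i1 i2 ⊢
  rw [integral_prod_symm _ i1, integral_prod_symm _ i2]
  refine integral_congr_ae (ae_of_all _ fun r => ?_)
  beta_reduce
  rw [← integral_cq_rotate (fun w => kf e μ w *
      ((max 0 (t * |⟪w, cq (b : ℍ) qi⟫| - ‖zq r‖) : ℝ) : ℂ)) b]
  simp only [inner_cq_cq]

theorem Q2.kf_relation (h : Q2 e μ) {c₁ c₂ c₃ c₄ : ℝ} (h1 : 0 ≤ c₁) (h2 : 0 ≤ c₂) (h3 : 0 ≤ c₃)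
    (h4 : 0 ≤ c₄) (hc : c₁ + c₂ = c₃ + c₄) {y₁ y₂ y₃ y₄ : ℍ} (hy₁ : y₁.re = 0) (hn₁ : ‖y₁‖ = 1)
    (hy₂ : y₂.re = 0) (hn₂ : ‖y₂‖ = 1) (hy₃ : y₃.re = 0) (hn₃ : ‖y₃‖ = 1) (hy₄ : y₄.re = 0)
    (hn₄ : ‖y₄‖ = 1)
    (hq : ∀ x : ℍ, c₁ * ⟪x, y₁⟫ ^ 2 + c₂ * ⟪x, y₂⟫ ^ 2 = c₃ * ⟪x, y₃⟫ ^ 2 + c₄ * ⟪x, y₄⟫ ^ 2) :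
    c₁ * kf e μ y₁ + c₂ * kf e μ y₂ = c₃ * kf e μ y₃ + c₄ * kf e μ y₄ := by
  obtain ⟨b₁, rfl⟩ := exists_cq_qi y₁ hy₁ hn₁
  obtain ⟨b₂, rfl⟩ := exists_cq_qi y₂ hy₂ hn₂
  obtain ⟨b₃, rfl⟩ := exists_cq_qi y₃ hy₃ hn₃
  obtain ⟨b₄, rfl⟩ := exists_cq_qi y₄ hy₄ hn₄
  have hb : ∀ b : UQ, Continuous fun w : ℍ => kf e μ (cq (b : ℍ) w) := fun b =>
    h.continuous_kf.comp (Continuous.cq continuous_const continuous_id)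
  have key := eq_zero_of_bump (F := fun w => (c₁ * kf e μ (cq b₁ w) + c₂ * kf e μ (cq b₂ w)) -
    (c₃ * kf e μ (cq b₃ w) + c₄ * kf e μ (cq b₄ w))) ?_ ?_ ?_
  · exact sub_eq_zero.1 key
  · exact ((continuous_const.mul (hb _)).add (continuous_const.mul (hb _))).sub
      ((continuous_const.mul (hb _)).add (continuous_const.mul (hb _)))
  · intro w
    simp only [cq_neg, h.kf_neg]
  · intro t ht ht2
    have hr := h.kb_relation h1 h2 h3 h4 hc hy₁ hn₁ hy₂ hn₂ hy₃ hn₃ hy₄ hn₄ hq ht ht2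
    have hi : ∀ (c : ℝ) (b : UQ), Integrable (fun p : OmQ => (c : ℂ) * (kf e μ (cq (b : ℍ) (cq p.1 qi)) *
      ((max 0 (t * |⟪cq (p.1 : ℍ) qi, qi⟫| - ‖zq p.2‖) : ℝ) : ℂ))) omQ := fun c b =>
      (integrable_omQ (((hb b).comp continuous_cq_fst).mul
      (Complex.continuous_ofReal.comp (continuous_bump t _)))).const_mul _
    have i12 : Integrable (fun p : OmQ => (c₁ : ℂ) * (kf e μ (cq (b₁ : ℍ) (cq p.1 qi)) *
      ((max 0 (t * |⟪cq (p.1 : ℍ) qi, qi⟫| - ‖zq p.2‖) : ℝ) : ℂ)) + (c₂ : ℂ) * (kf e μ (cq (b₂ : ℍ) (cq p.1 qi)) *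
      ((max 0 (t * |⟪cq (p.1 : ℍ) qi, qi⟫| - ‖zq p.2‖) : ℝ) : ℂ))) omQ := (hi c₁ b₁).add (hi c₂ b₂)
    have i34 : Integrable (fun p : OmQ => (c₃ : ℂ) * (kf e μ (cq (b₃ : ℍ) (cq p.1 qi)) *
      ((max 0 (t * |⟪cq (p.1 : ℍ) qi, qi⟫| - ‖zq p.2‖) : ℝ) : ℂ)) + (c₄ : ℂ) * (kf e μ (cq (b₄ : ℍ) (cq p.1 qi)) *
      ((max 0 (t * |⟪cq (p.1 : ℍ) qi, qi⟫| - ‖zq p.2‖) : ℝ) : ℂ))) omQ := (hi c₃ b₃).add (hi c₄ b₄)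
    rw [h.kb_rotate, h.kb_rotate, h.kb_rotate, h.kb_rotate, ← sub_eq_zero, ← integral_const_mul,
      ← integral_const_mul, ← integral_const_mul, ← integral_const_mul,
      ← integral_add (hi c₁ b₁) (hi c₂ b₂), ← integral_add (hi c₃ b₃) (hi c₄ b₄),
      ← integral_sub i12 i34] at hr
    rw [← hr]
    refine integral_congr_ae (ae_of_all _ fun p => ?_)
    beta_reduce
    ring

theorem norm_mkq_eq_one {p q r : ℝ} (h : p ^ 2 + q ^ 2 + r ^ 2 = 1) : ‖mkq 0 p q r‖ = 1 := by
  have : ‖mkq 0 p q r‖ ^ 2 = 1 := by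
    rw [← real_inner_self_eq_norm_sq, Quaternion.inner_def]; simp; linarith
  nlinarith [norm_nonneg (mkq 0 p q r)]

theorem Q2.kf_eq_zero_unit (h : Q2 e μ) {p q r : ℝ} (hn : p ^ 2 + q ^ 2 + r ^ 2 = 1) :
    kf e μ (mkq 0 p q r) = 0 := by
  obtain ⟨q', r', h1, hq, hr⟩ : ∃ q' r' : ℝ, q' ^ 2 + r' ^ 2 = 1 ∧
      q = √(q ^ 2 + r ^ 2) * q' ∧ r = √(q ^ 2 + r ^ 2) * r' := by
    by_cases h0 : q ^ 2 + r ^ 2 = 0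
    · refine ⟨1, 0, by norm_num, ?_, ?_⟩ <;> rw [h0] <;> simp <;> nlinarith [sq_nonneg q, sq_nonneg r]
    · have hp : 0 < q ^ 2 + r ^ 2 := lt_of_le_of_ne (by positivity) (Ne.symm h0)
      have hs := Real.sqrt_pos.2 hp
      refine ⟨q / √(q ^ 2 + r ^ 2), r / √(q ^ 2 + r ^ 2), ?_, ?_, ?_⟩
      · rw [div_pow, div_pow, Real.sq_sqrt hp.le]; field_simp
      · field_simp
      · field_simp
  set ρ := √(q ^ 2 + r ^ 2) with hρ
  have hρ2 : ρ ^ 2 = q ^ 2 + r ^ 2 := Real.sq_sqrt (by positivity)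
  have key := h.kf_relation (c₁ := 1) (c₂ := 1) (c₃ := 2 * p ^ 2) (c₄ := 2 * ρ ^ 2)
    (y₁ := mkq 0 p q r) (y₂ := mkq 0 p (-q) (-r)) (y₃ := mkq 0 1 0 0) (y₄ := mkq 0 0 q' r')
    zero_le_one zero_le_one (by positivity) (by positivity) (by rw [hρ2]; linarith) (by simp)
    (norm_mkq_eq_one hn) (by simp) (norm_mkq_eq_one (by linarith)) (by simp)
    (norm_mkq_eq_one (by norm_num)) (by simp) (norm_mkq_eq_one (by linarith)) (fun x => by
      simp only [Quaternion.inner_def]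
      simp
      rw [hq, hr]; ring)
  have e1 : kf e μ (mkq 0 1 0 0) = 0 := h.pole
  have e2 : kf e μ (mkq 0 0 q' r') = 0 := h.equator _ _
  have e3 : kf e μ (mkq 0 p (-q) (-r)) = kf e μ (mkq 0 p q r) := h.half _ _ _
  rw [e1, e2, e3] at key
  have : (2 : ℂ) * kf e μ (mkq 0 p q r) = 0 := by
    simp only [Complex.ofReal_one] at key
    linear_combination key
  simpa using this

theorem Q2.kf_eq_zero (h : Q2 e μ) (w : ℍ) : kf e μ w = 0 := by
  have h1 : kf e μ w = kf e μ (mkq 0 w.imI w.imJ w.imK) := h.kf_congr (by ext <;> simp)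
  rw [h1]
  by_cases h0 : w.imI ^ 2 + w.imJ ^ 2 + w.imK ^ 2 = 0
  · have e1 : w.imI = 0 := by nlinarith [sq_nonneg w.imI, sq_nonneg w.imJ, sq_nonneg w.imK]
    have e2 : w.imJ = 0 := by nlinarith [sq_nonneg w.imI, sq_nonneg w.imJ, sq_nonneg w.imK]
    have e3 : w.imK = 0 := by nlinarith [sq_nonneg w.imI, sq_nonneg w.imJ, sq_nonneg w.imK]
    have : mkq 0 w.imI w.imJ w.imK = (0:ℝ) • (0:ℍ) := by ext <;> simp [e1, e2, e3]
    rw [this, h.kf_smul]; simp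
  · have hp : 0 < w.imI ^ 2 + w.imJ ^ 2 + w.imK ^ 2 := lt_of_le_of_ne (by positivity) (Ne.symm h0)
    have hs := Real.sqrt_pos.2 hp
    set s := √(w.imI ^ 2 + w.imJ ^ 2 + w.imK ^ 2) with hsd
    have hs2 : s ^ 2 = w.imI ^ 2 + w.imJ ^ 2 + w.imK ^ 2 := Real.sq_sqrt hp.le
    have : mkq 0 w.imI w.imJ w.imK = s • mkq 0 (w.imI / s) (w.imJ / s) (w.imK / s) := by
      ext <;> simp <;> field_simp
    rw [this, h.kf_smul, h.kf_eq_zero_unit, mul_zero]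
    rw [div_pow, div_pow, div_pow, hs2]; field_simp

theorem Q2.dls_pair_eq_zero (h : Q2 e μ) (v w : E) : dls [v, w] μ 0 = 0 := by
  have := h.dls_two (e.symm v) (e.symm w)
  rw [e.apply_symm_apply, e.apply_symm_apply] at this
  rw [this, h.kf_eq_zero]

end

section

open scoped Quaternion

/-- The identification of `ℍ` with `ℂ²` for which right multiplication by `i` is the complex
structure. -/
def qeq : ℍ ≃ₗᵢ[ℝ] Cn 2 where
  toFun q := !₂[⟨q.re, q.imI⟩, ⟨q.imJ, -q.imK⟩]
  invFun z := mkq (z 0).re (z 0).im (z 1).re (-(z 1).im)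
  map_add' x y := by ext i; fin_cases i <;> apply Complex.ext <;> simp; ring
  map_smul' t x := by ext i; fin_cases i <;> apply Complex.ext <;> simp
  left_inv x := by ext <;> simp
  right_inv z := by ext i; fin_cases i <;> apply Complex.ext <;> simp
  norm_map' x := by
    have h : ‖(!₂[⟨x.re, x.imI⟩, ⟨x.imJ, -x.imK⟩] : Cn 2)‖ ^ 2 = ‖x‖ ^ 2 := by
      rw [← real_inner_self_eq_norm_sq x, Quaternion.inner_def, EuclideanSpace.norm_sq_eq]
      simp only [Fin.sum_univ_two, ← Complex.normSq_eq_norm_sq, Complex.normSq_apply]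
      simp; ring
    exact (sq_eq_sq₀ (norm_nonneg _) (norm_nonneg _)).1 h

theorem qeq_apply (q : ℍ) : qeq q = !₂[⟨q.re, q.imI⟩, ⟨q.imJ, -q.imK⟩] := rfl

theorem qeq_one : qeq 1 = EuclideanSpace.single 0 1 := by
  rw [qeq_apply]; ext i; fin_cases i <;> apply Complex.ext <;> simp

theorem qeq_qi : qeq (mkq 0 1 0 0) = Complex.I • qeq 1 := by
  rw [qeq_apply, qeq_apply]; ext i; fin_cases i <;> apply Complex.ext <;> simp

/-- The unitary matrix of left multiplication by a unit quaternion. -/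
def lmq (a : ℍ) : Matrix (Fin 2) (Fin 2) ℂ :=
  !![⟨a.re, a.imI⟩, -⟨a.imJ, a.imK⟩; ⟨a.imJ, -a.imK⟩, ⟨a.re, -a.imI⟩]

theorem normSq_comp {a : ℍ} (ha : ‖a‖ = 1) :
    a.re ^ 2 + a.imI ^ 2 + a.imJ ^ 2 + a.imK ^ 2 = 1 := by
  have : ‖a‖ ^ 2 = 1 := by rw [ha, one_pow]
  rw [← real_inner_self_eq_norm_sq, Quaternion.inner_def] at this
  simp at this; linarith

theorem lmq_mem {a : ℍ} (ha : ‖a‖ = 1) : lmq a ∈ Matrix.unitaryGroup (Fin 2) ℂ := by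
  have h := normSq_comp ha
  rw [Matrix.mem_unitaryGroup_iff, Matrix.star_eq_conjTranspose]
  ext i j
  fin_cases i <;> fin_cases j <;> apply Complex.ext <;>
    simp [lmq, Matrix.mul_apply, Fin.sum_univ_two] <;> nlinarith

theorem lmq_det {a : ℍ} (ha : ‖a‖ = 1) : (lmq a).det = 1 := by
  have h := normSq_comp ha
  rw [lmq, Matrix.det_fin_two_of]
  apply Complex.ext <;> simp <;> nlinarith

theorem ml_lmq (a x : ℍ) : ml (lmq a) (qeq x) = qeq (a * x) := by
  rw [qeq_apply, qeq_apply]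
  ext i
  fin_cases i <;> apply Complex.ext <;>
    simp [ml, lmq, Matrix.toLpLin_apply] <;> ring

theorem W2.q2 {μ : ConvexBody (Cn 2) → ℂ} (h : W2 μ) (h0 : dls (frame 2) μ 0 = 0) : Q2 qeq μ := by
  have left : ∀ a : ℍ, ‖a‖ = 1 → ∀ x y, dls [qeq (a * x), qeq (a * y)] μ 0 = dls [qeq x, qeq y] μ 0 := by
    intro a ha x y
    have := h.dls_image (lmq_mem ha) [qeq x, qeq y] 0
    rw [lmap_zero, lmq_det ha] at this
    simpa [ml_lmq] using this
  refine ⟨h.ctv, h.even, fun L hL => h.dls_eq_zero_of_length_ne L hL, left, ?_, ?_, ?_⟩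
  · have hne : qeq 1 ≠ 0 := by simp
    refine h.dls_eq_zero_of_complex hne (Submodule.subset_span (by simp)) ?_
    rw [← qeq_qi]
    exact Submodule.subset_span (by simp)
  · intro b c
    have hfr : frame 2 = [EuclideanSpace.single 0 1, EuclideanSpace.single 1 1] := by
      simp [frame, List.ofFn_succ]
    rw [hfr] at h0
    set β : ℂ := ⟨b, -c⟩ with hβ
    have e1 : qeq (mkq 0 0 b c) = β • EuclideanSpace.single 1 1 := by
      rw [qeq_apply]; ext i; fin_cases i <;> apply Complex.ext <;> simp [hβ]
    rw [qeq_one, e1]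
    obtain ⟨u, hu, hβu⟩ : ∃ u : ℂ, ‖u‖ = 1 ∧ β = ‖β‖ * u := by
      by_cases hz : β = 0
      · exact ⟨1, by simp, by simp [hz]⟩
      · have hz' : (‖β‖ : ℂ) ≠ 0 := by simpa using hz
        exact ⟨β / ‖β‖, by simp [hz], by field_simp⟩
    have hg : (Matrix.diagonal ![1, u]) ∈ Matrix.unitaryGroup (Fin 2) ℂ := by
      rw [Matrix.mem_unitaryGroup_iff, Matrix.star_eq_conjTranspose, Matrix.diagonal_conjTranspose,
        Matrix.diagonal_mul_diagonal, ← Matrix.diagonal_one]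
      congr 1
      ext i; fin_cases i <;> simp [Complex.mul_conj, Complex.normSq_eq_norm_sq, hu]
    have := h.dls_image hg [EuclideanSpace.single 0 1, EuclideanSpace.single 1 1] 0
    rw [lmap_zero, h0, mul_zero] at this
    have e2 : ml (Matrix.diagonal ![1, u]) (EuclideanSpace.single 0 1) = EuclideanSpace.single 0 1 := by
      ext i; rw [ml_single]; fin_cases i <;> simp
    have e3 : ml (Matrix.diagonal ![1, u]) (EuclideanSpace.single 1 1) = u • EuclideanSpace.single 1 1 := by
      ext i; rw [ml_single]; fin_cases i <;> simp
    rw [List.map_cons, List.map_cons, List.map_nil, e2, e3] at this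
    have e4 : β • (EuclideanSpace.single 1 1 : Cn 2) = ‖β‖ • (u • EuclideanSpace.single 1 1 : Cn 2) := by
      conv_lhs => rw [hβu]
      rw [mul_smul]; rfl
    rw [e4, dls_pair, dl_comm, (h.ctv.dl _).dl_smul, dl_comm, ← dls_pair, this, mul_zero]
  · intro a b c
    have hg : (Matrix.diagonal ![Complex.I, Complex.I]) ∈ Matrix.unitaryGroup (Fin 2) ℂ := by
      rw [Matrix.mem_unitaryGroup_iff, Matrix.star_eq_conjTranspose, Matrix.diagonal_conjTranspose,
        Matrix.diagonal_mul_diagonal, ← Matrix.diagonal_one]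
      congr 1
      ext i; fin_cases i <;> simp
    have hI : ∀ x : ℍ, ml (Matrix.diagonal ![Complex.I, Complex.I]) (qeq x) = qeq (x * mkq 0 1 0 0) := by
      intro x
      rw [qeq_apply, qeq_apply]
      ext i
      fin_cases i <;> apply Complex.ext <;>
        simp [ml, Matrix.toLpLin_apply]
    have h2 := h.dls_image hg [qeq 1, qeq (mkq 0 a b c)] 0
    rw [lmap_zero] at h2
    have hd : (Matrix.diagonal ![Complex.I, Complex.I]).det ^ 2 = 1 := by
      rw [Matrix.det_diagonal]; simp [Fin.prod_univ_two]
    rw [hd, one_mul, List.map_cons, List.map_cons, List.map_nil, hI, hI] at h2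
    rw [← h2]
    have hn : ‖mkq 0 (-1) 0 0‖ = 1 := norm_mkq_eq_one (by norm_num)
    rw [← left _ hn (1 * mkq 0 1 0 0)]
    congr 3
    · ext <;> simp
    · congr 1; ext <;> simp

/-- The frame value determines a weight two valuation. -/
theorem W2.eq_zero_of_frame {n : ℕ} {μ : ConvexBody (Cn n) → ℂ} (h : W2 μ)
    (h0 : dls (frame n) μ 0 = 0) : μ = 0 :=
  funext fun K => W2.eq_zero (fun _ hμ h1 v w => (hμ.q2 h1).dls_pair_eq_zero v w) h h0 K

end

section gauss

variable {E : Type*} [NormedAddCommGroup E] [InnerProductSpace ℝ E] [FiniteDimensional ℝ E]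
  [MeasurableSpace E] [BorelSpace E]

theorem map_proj_stdGaussian (S : Submodule ℝ E) :
    ((stdGaussian E).prod (stdGaussian E)).map
      (fun p => S.starProjection p.1 + Sᗮ.starProjection p.2) = stdGaussian E := by
  have hm : Continuous fun p : E × E => S.starProjection p.1 + Sᗮ.starProjection p.2 := by fun_prop
  have : IsProbabilityMeasure (((stdGaussian E).prod (stdGaussian E)).map
      fun p => S.starProjection p.1 + Sᗮ.starProjection p.2) :=
    Measure.isProbabilityMeasure_map hm.measurable.aemeasurable
  refine Measure.ext_of_charFun (funext fun t => ?_)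
  rw [ProbabilityTheory.charFun_stdGaussian, charFun_apply,
    integral_map hm.measurable.aemeasurable (by fun_prop)]
  have : ∀ p : E × E,
      Complex.exp (⟪S.starProjection p.1 + Sᗮ.starProjection p.2, t⟫ * Complex.I) =
      Complex.exp (⟪p.1, S.starProjection t⟫ * Complex.I) *
        Complex.exp (⟪p.2, Sᗮ.starProjection t⟫ * Complex.I) := by
    intro p
    rw [← Complex.exp_add, inner_add_left, Submodule.inner_starProjection_left_eq_right,
      Submodule.inner_starProjection_left_eq_right]
    congr 1; push_cast; ring
  simp only [this]
  rw [integral_prod_mul (fun a : E => Complex.exp (⟪a, S.starProjection t⟫ * Complex.I))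
    (fun b : E => Complex.exp (⟪b, Sᗮ.starProjection t⟫ * Complex.I)), charFun_gauss_inner,
    charFun_gauss_inner, ← Complex.exp_add]
  congr 1
  have := S.norm_sq_eq_add_norm_sq_projection t
  have h2 : (‖t‖ : ℂ) ^ 2 = (‖S.starProjection t‖ : ℂ) ^ 2 + (‖Sᗮ.starProjection t‖ : ℂ) ^ 2 := by
    exact_mod_cast this
  rw [h2]; ring

theorem integral_proj_stdGaussian {F : Type*} [NormedAddCommGroup F] [NormedSpace ℝ F]
    (S : Submodule ℝ E) {f : E → F} (hf : AEStronglyMeasurable f (stdGaussian E)) :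
    ∫ y, f y ∂stdGaussian E = ∫ p, f (S.starProjection p.1 + Sᗮ.starProjection p.2)
      ∂((stdGaussian E).prod (stdGaussian E)) := by
  have hm : Continuous fun p : E × E => S.starProjection p.1 + Sᗮ.starProjection p.2 := by fun_prop
  rw [← integral_map hm.measurable.aemeasurable (by rwa [map_proj_stdGaussian]),
    map_proj_stdGaussian]

theorem integrable_proj_stdGaussian {F : Type*} [NormedAddCommGroup F] (S : Submodule ℝ E)
    {f : E → F} (hf : Integrable f (stdGaussian E)) :
    Integrable (fun p : E × E => f (S.starProjection p.1 + Sᗮ.starProjection p.2))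
      ((stdGaussian E).prod (stdGaussian E)) := by
  have hm : Continuous fun p : E × E => S.starProjection p.1 + Sᗮ.starProjection p.2 := by fun_prop
  rw [← map_proj_stdGaussian S] at hf
  exact hf.comp_measurable hm.measurable

theorem map_orthogonalProjection_stdGaussian (S : Submodule ℝ E) :
    (stdGaussian E).map (fun x => S.orthogonalProjectionOnto x) = stdGaussian S := by
  have hm : Continuous fun x : E => S.orthogonalProjectionOnto x := by fun_prop
  have : IsProbabilityMeasure ((stdGaussian E).map fun x => S.orthogonalProjectionOnto x) :=
    Measure.isProbabilityMeasure_map hm.measurable.aemeasurable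
  refine Measure.ext_of_charFun (funext fun t => ?_)
  rw [ProbabilityTheory.charFun_stdGaussian, charFun_apply,
    integral_map hm.measurable.aemeasurable (by fun_prop)]
  have : ∀ x : E, ⟪S.orthogonalProjectionOnto x, t⟫ = ⟪x, (t : E)⟫ := fun x => by
    rw [Submodule.inner_orthogonalProjectionOnto_eq_of_mem_right]
  simp only [this]
  rw [charFun_gauss_inner]; rfl

/-- The law of the norm of a projection depends only on the rank. -/
theorem integral_norm_proj (S : Submodule ℝ E) {m : ℕ} (hm : Module.finrank ℝ S = m) {f : ℝ → ℝ}
    (hf : Continuous f) : ∫ x, f ‖S.starProjection x‖ ∂stdGaussian E =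
      ∫ x, f ‖x‖ ∂stdGaussian (EuclideanSpace ℝ (Fin m)) := by
  have h1 : ∫ x, f ‖x‖ ∂stdGaussian S = ∫ x, f ‖S.starProjection x‖ ∂stdGaussian E := by
    rw [← map_orthogonalProjection_stdGaussian, integral_map (by fun_prop) (by fun_prop)]
    rfl
  rw [← h1]
  let e : S ≃ₗᵢ[ℝ] EuclideanSpace ℝ (Fin m) :=
    ((stdOrthonormalBasis ℝ S).reindex (finCongr hm)).repr
  rw [← ProbabilityTheory.stdGaussian_map e, integral_map (by fun_prop) (by fun_prop)]
  simp only [LinearIsometryEquiv.norm_map]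

theorem integrable_norm_pow (k : ℕ) : Integrable (fun x : E => ‖x‖ ^ k) (stdGaussian E) :=
  integrable_of_poly (by fun_prop) 1 k fun x => by
    rw [norm_pow, norm_norm, one_mul]
    exact pow_le_pow_left₀ (norm_nonneg _) (by linarith) k

theorem integral_nu1_sq : ∫ t, t ^ 2 ∂nu1 = 1 := by
  have := nu1_ibp (f := fun x => x) (f' := fun _ => 1) (fun x => hasDerivAt_id x)
    (integrable_nu1_poly continuous_id 1 1 fun x => by simp)
    (integrable_const _) (integrable_nu1_poly (by fun_prop) 1 2 fun x => by
      rw [abs_mul]; nlinarith [abs_nonneg x])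
  simpa [pow_two] using this

theorem integral_inner_sq (q : E) : ∫ y, ⟪y, q⟫ ^ 2 ∂stdGaussian E = ‖q‖ ^ 2 := by
  rcases eq_or_ne q 0 with rfl | hq
  · simp
  have hq' : ‖q‖ ≠ 0 := norm_ne_zero_iff.2 hq
  have h1 : ‖‖q‖⁻¹ • q‖ = 1 := norm_smul_inv_norm hq
  have := integral_inner_unit (E := E) h1 (f := fun t => t ^ 2) (by fun_prop)
  rw [integral_nu1_sq] at this
  simp only [inner_smul_right, mul_pow] at this
  rw [integral_const_mul] at this
  field_simp at this
  exact this

theorem integral_norm_sq : ∫ y, ‖y‖ ^ 2 ∂stdGaussian E = Module.finrank ℝ E := by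
  have e : ∀ y : E, ‖y‖ ^ 2 = ∑ i, ⟪y, stdOrthonormalBasis ℝ E i⟫ ^ 2 := fun y => by
    rw [← (stdOrthonormalBasis ℝ E).sum_sq_norm_inner_left y]
    simp
  simp only [e]
  rw [integral_finsetSum]
  · simp [integral_inner_sq]
  · intro i _
    refine integrable_of_poly (by fun_prop) 1 2 fun x => ?_
    have := abs_real_inner_le_norm x (stdOrthonormalBasis ℝ E i)
    rw [OrthonormalBasis.norm_eq_one, mul_one] at this
    rw [norm_pow, one_mul]
    exact pow_le_pow_left₀ (norm_nonneg _) (this.trans (by linarith)) 2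

/-- The constants of the Gaussian recursion. -/
def gconst (m : ℕ) : ℝ := ∫ x, (‖x‖ ^ 3 - ‖x‖) ∂stdGaussian (EuclideanSpace ℝ (Fin m))

theorem gconst_pos {m : ℕ} (hm : 0 < m) : 0 < gconst m := by
  set V := EuclideanSpace ℝ (Fin m)
  rcases Nat.lt_or_ge 1 m with h | h
  · have h1 : ∫ x, (‖x‖ ^ 2 - 1) ∂stdGaussian V ≤ gconst m := by
      refine integral_mono ((integrable_norm_pow 2).sub (integrable_const _))
        ((integrable_norm_pow 3).sub (by simpa using integrable_norm_pow (E := V) 1)) fun x => ?_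
      have := mul_nonneg (sq_nonneg (‖x‖ - 1)) (by positivity : 0 ≤ ‖x‖ + 1)
      simp only
      nlinarith
    rw [integral_sub (integrable_norm_pow 2) (integrable_const _), integral_norm_sq] at h1
    simp only [integral_const, probReal_univ, smul_eq_mul, mul_one] at h1
    have : (1 : ℝ) < m := by exact_mod_cast h
    simp [V] at h1
    linarith
  · obtain rfl : m = 1 := by omega
    have h1 : gconst 1 = ∫ t, (|t| ^ 3 - |t|) ∂nu1 := by
      have hx : ‖(EuclideanSpace.single 0 1 : V)‖ = 1 := by
        rw [PiLp.norm_single]; simp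
      rw [gconst, ← integral_inner_unit (E := V) hx (by fun_prop)]
      congr 1; ext x
      have : ‖x‖ = |x 0| := by rw [EuclideanSpace.norm_eq]; simp [Real.sqrt_sq_eq_abs]
      rw [this, real_inner_comm, EuclideanSpace.inner_single_left]; simp
    have i1 : Integrable (fun t : ℝ => t ^ 2) nu1 := integrable_nu1_poly (by fun_prop) 1 2 fun x => by
      rw [abs_pow]; nlinarith [abs_nonneg x]
    have i2 : Integrable (fun t : ℝ => t ^ 2 - 1) nu1 := i1.sub (integrable_const _)
    have i3 : Integrable (fun t : ℝ => |t| ^ 3 - |t|) nu1 :=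
      integrable_nu1_poly (by fun_prop) 2 3 fun x => by
        have := abs_nonneg x
        rw [abs_le]; constructor <;> nlinarith [pow_nonneg this 3, pow_nonneg this 2]
    have h2 : 0 < ∫ t : ℝ, ((|t| ^ 3 - |t|) - (t ^ 2 - 1)) ∂nu1 := by
      have e : ∀ t : ℝ, (|t| ^ 3 - |t|) - (t ^ 2 - 1) = (|t| - 1) ^ 2 * (|t| + 1) := fun t => by
        rw [← sq_abs t]; ring
      rw [integral_pos_iff_support_of_nonneg]
      · rw [pos_iff_ne_zero]
        have : Function.support (fun t : ℝ => (|t| ^ 3 - |t|) - (t ^ 2 - 1)) = ({1, -1} : Set ℝ)ᶜ := by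
          ext t
          rw [Function.mem_support, e]
          have : |t| + 1 ≠ 0 := by positivity
          simp only [ne_eq, mul_eq_zero, this, or_false, mem_compl_iff, mem_insert_iff,
            mem_singleton_iff, pow_eq_zero_iff two_ne_zero, sub_eq_zero]
          rw [abs_eq zero_le_one]
        have h0 : nu1 ({1, -1} : Set ℝ) = 0 := by
          rw [nu1_eq]
          exact withDensity_absolutelyContinuous _ _ ((Set.toFinite _).measure_zero volume)
        rw [this, prob_compl_eq_one_sub (by measurability), h0]; simp
      · intro t
        simp only [e, Pi.zero_apply]; positivity
      · exact i3.sub i2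
    rw [integral_sub i3 i2, integral_sub i1 (integrable_const _),
      integral_nu1_sq] at h2
    simp at h2
    rw [h1]; linarith
end gauss

section gauss

variable {E : Type*} [NormedAddCommGroup E] [InnerProductSpace ℝ E] [FiniteDimensional ℝ E]
  [MeasurableSpace E] [BorelSpace E]

theorem integrable_one_add_norm_pow (k : ℕ) :
    Integrable (fun x : E => (1 + ‖x‖) ^ k) (stdGaussian E) :=
  integrable_of_poly (by fun_prop) 1 k fun x => by
    rw [one_mul, Real.norm_of_nonneg (by positivity)]

theorem integrable_prod_of_poly {f : E × E → ℂ} (hf : Measurable f) (c : ℝ) (k l : ℕ)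
    (h : ∀ p, ‖f p‖ ≤ c * ((1 + ‖p.1‖) ^ k * (1 + ‖p.2‖) ^ l)) :
    Integrable f ((stdGaussian E).prod (stdGaussian E)) :=
  (((integrable_one_add_norm_pow k).mul_prod (integrable_one_add_norm_pow l)).const_mul c).mono'
    hf.aestronglyMeasurable (Eventually.of_forall h)

theorem exists_linear_bound (l : E →ₗ[ℝ] ℂ) : ∃ c, 0 ≤ c ∧ ∀ y, ‖l y‖ ≤ c * ‖y‖ :=
  ⟨‖l.toContinuousLinearMap‖, norm_nonneg _, fun y => l.toContinuousLinearMap.le_opNorm y⟩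

theorem integrable_linear (l : E →ₗ[ℝ] ℂ) : Integrable (fun y => l y) (stdGaussian E) := by
  obtain ⟨c, hc, h⟩ := exists_linear_bound l
  refine integrable_of_poly l.continuous_of_finiteDimensional.aestronglyMeasurable c 1 fun y => ?_
  rw [pow_one]
  exact (h y).trans (mul_le_mul_of_nonneg_left (by linarith) hc)

theorem integrable_linear_sq (l : E →ₗ[ℝ] ℂ) : Integrable (fun y => l y ^ 2) (stdGaussian E) := by
  obtain ⟨c, hc, h⟩ := exists_linear_bound l
  refine integrable_of_poly (l.continuous_of_finiteDimensional.pow 2).aestronglyMeasurable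
    (c ^ 2) 2 fun y => ?_
  rw [norm_pow, ← mul_pow]
  exact pow_le_pow_left₀ (norm_nonneg _)
    ((h y).trans (mul_le_mul_of_nonneg_left (by linarith) hc)) 2

theorem integral_linear (l : E →ₗ[ℝ] ℂ) : ∫ y, l y ∂stdGaussian E = 0 := by
  have hi : Integrable (fun y : E => y) (stdGaussian E) :=
    integrable_of_poly (by fun_prop) 1 1 fun y => by simp
  have := l.toContinuousLinearMap.integral_comp_comm hi
  rw [ProbabilityTheory.integral_id_stdGaussian, map_zero] at this
  exact this

theorem integral_add_linear_sq (a : ℂ) (l : E →ₗ[ℝ] ℂ) :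
    ∫ y, (a + l y) ^ 2 ∂stdGaussian E = a ^ 2 + ∫ y, l y ^ 2 ∂stdGaussian E := by
  have e : ∀ y, (a + l y) ^ 2 = a ^ 2 + (2 * a * l y + l y ^ 2) := fun y => by ring
  simp only [e]
  have i2 : Integrable (fun y => 2 * a * l y + l y ^ 2) (stdGaussian E) :=
    ((integrable_linear l).const_mul _).add (integrable_linear_sq l)
  rw [integral_add (integrable_const _) i2,
    integral_add ((integrable_linear l).const_mul _) (integrable_linear_sq l), integral_const_mul,
    integral_linear]
  simp

theorem exists_bilinear_bound (B : E →ₗ[ℝ] E →ₗ[ℝ] ℂ) :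
    ∃ c, 0 ≤ c ∧ ∀ x y, ‖B x y‖ ≤ c * ‖x‖ * ‖y‖ := by
  let B' : E →L[ℝ] E →L[ℝ] ℂ :=
    LinearMap.toContinuousLinearMap (LinearMap.toContinuousLinearMap.toLinearMap ∘ₗ B)
  exact ⟨‖B'‖, B'.opNorm_nonneg, fun x y => B'.le_opNorm₂ x y⟩

theorem continuous_bilinear (B : E →ₗ[ℝ] E →ₗ[ℝ] ℂ) : Continuous fun p : E × E => B p.1 p.2 := by
  let B' : E →L[ℝ] E →L[ℝ] ℂ :=
    LinearMap.toContinuousLinearMap (LinearMap.toContinuousLinearMap.toLinearMap ∘ₗ B)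
  exact B'.continuous₂

variable (B : E →ₗ[ℝ] E →ₗ[ℝ] ℂ) (S : Submodule ℝ E) (D : ℂ)

theorem bilinear_proj (h0 : ∀ w, ∀ u ∈ S, B w u = 0) (w u : E) :
    B w u = B w (Sᗮ.starProjection u) := by
  have := S.starProjection_add_starProjection_orthogonal u
  conv_lhs => rw [← this]
  rw [map_add, h0 w _ (S.starProjection_apply_mem u), zero_add]

theorem integral_bilinear_sq (h1 : ∀ w ∈ Sᗮ, ∀ u, B w u = ⟪w, u⟫ * D) {q : E} (hq : q ∈ Sᗮ) :
    ∫ y, B y q ^ 2 ∂stdGaussian E =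
      ∫ y, B (S.starProjection y) q ^ 2 ∂stdGaussian E + D ^ 2 * ‖q‖ ^ 2 := by
  set l1 : E →ₗ[ℝ] ℂ := B.flip q ∘ₗ S.starProjection.toLinearMap
  have hl1 : ∀ y, B (S.starProjection y) q = l1 y := fun y => rfl
  have i0 : Integrable (fun y => B y q ^ 2) (stdGaussian E) := integrable_linear_sq (B.flip q)
  rw [integral_proj_stdGaussian S i0.aestronglyMeasurable]
  have i1 := integrable_proj_stdGaussian S i0
  rw [integral_prod_symm _ i1]
  have e : ∀ y x : E, B (S.starProjection x + Sᗮ.starProjection y) q = ⟪y, q⟫ * D + l1 x := by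
    intro y x
    rw [map_add, LinearMap.add_apply, hl1, h1 _ (Sᗮ.starProjection_apply_mem y),
      Submodule.inner_starProjection_left_eq_right, Submodule.starProjection_eq_self_iff.2 hq,
      add_comm]
  simp only [e, integral_add_linear_sq, hl1]
  have i2 : Integrable (fun y : E => ((⟪y, q⟫ * D) ^ 2 : ℂ)) (stdGaussian E) := by
    have := integrable_linear_sq (E := E) (D • (Complex.ofRealCLM.toLinearMap ∘ₗ (innerₗ E) q))
    simpa [mul_comm, real_inner_comm] using this
  rw [integral_add i2 (integrable_const _)]
  have e2 : ∀ y : E, (⟪y, q⟫ * D : ℂ) ^ 2 = D ^ 2 * ((⟪y, q⟫ ^ 2 : ℝ) : ℂ) := fun y => by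
    push_cast; ring
  simp only [e2]
  rw [integral_const_mul, integral_complex_ofReal, integral_inner_sq]
  simp
  ring

/-- Integration of one Gaussian row. -/
theorem integral_row (h0 : ∀ w, ∀ u ∈ S, B w u = 0) (h1 : ∀ w ∈ Sᗮ, ∀ u, B w u = ⟪w, u⟫ * D) :
    ∫ p : E × E, (B p.1 p.1 + Complex.I * B p.2 p.1) ^ 2 / ‖Sᗮ.starProjection p.1‖
      ∂(stdGaussian E).prod (stdGaussian E) =
    D ^ 2 * (∫ x, (‖Sᗮ.starProjection x‖ ^ 3 - ‖Sᗮ.starProjection x‖) ∂stdGaussian E : ℝ) := by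
  obtain ⟨c, hc, hcB⟩ := exists_bilinear_bound B
  have hcB' : ∀ x y, ‖B x y‖ ≤ c * ‖x‖ * ‖Sᗮ.starProjection y‖ := fun x y => by
    rw [bilinear_proj B S h0]; exact hcB _ _
  have hmB := continuous_bilinear B
  have hQ : ∀ x, ‖Sᗮ.starProjection x‖ ≤ ‖x‖ := fun x => Sᗮ.norm_starProjection_apply_le x
  have key : ∀ (x : E) (z : ℂ) (r : ℝ), 0 ≤ r → ‖z‖ ≤ r ^ 2 * ‖Sᗮ.starProjection x‖ ^ 2 →
      ‖z / ‖Sᗮ.starProjection x‖‖ ≤ r ^ 2 * (1 + ‖x‖) := by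
    intro x z r hr hz
    rw [norm_div, Complex.norm_real, norm_norm]
    rcases eq_or_ne ‖Sᗮ.starProjection x‖ 0 with h | h
    · rw [h, div_zero]; positivity
    · rw [div_le_iff₀ (lt_of_le_of_ne (norm_nonneg _) h.symm)]
      refine hz.trans ?_
      rw [pow_two ‖_‖, ← mul_assoc]
      refine mul_le_mul_of_nonneg_right (mul_le_mul_of_nonneg_left ?_ (by positivity)) (norm_nonneg _)
      linarith [hQ x]
  have i1 : Integrable (fun p : E × E =>
      (B p.1 p.1 + Complex.I * B p.2 p.1) ^ 2 / (‖Sᗮ.starProjection p.1‖ : ℂ))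
      ((stdGaussian E).prod (stdGaussian E)) := by
    refine integrable_prod_of_poly ?_ (c ^ 2) 3 2 fun p => ?_
    · have := hmB.comp (continuous_fst.prodMk continuous_fst : Continuous fun p : E × E => (p.1, p.1))
      have h2 := hmB.comp (continuous_snd.prodMk continuous_fst : Continuous fun p : E × E => (p.2, p.1))
      refine Measurable.div ?_ (by fun_prop)
      exact ((this.add (continuous_const.mul h2)).pow 2).measurable
    · refine (key p.1 _ (c * ((1 + ‖p.1‖) * (1 + ‖p.2‖))) (by positivity) ?_).trans ?_
      · rw [norm_pow, ← mul_pow]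
        refine pow_le_pow_left₀ (norm_nonneg _) ((norm_add_le _ _).trans ?_) 2
        rw [norm_mul, Complex.norm_I, one_mul]
        refine (add_le_add (hcB' _ _) (hcB' _ _)).trans ?_
        rw [← add_mul, ← mul_add]
        refine mul_le_mul_of_nonneg_right (mul_le_mul_of_nonneg_left ?_ hc) (norm_nonneg _)
        nlinarith [norm_nonneg p.1, norm_nonneg p.2]
      · apply le_of_eq; ring
  rw [integral_prod _ i1]
  have s1 : ∀ x, ∫ y, (B x x + Complex.I * B y x) ^ 2 / (‖Sᗮ.starProjection x‖ : ℂ) ∂stdGaussian E =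
      (B x x ^ 2 - ∫ y, B y x ^ 2 ∂stdGaussian E) / (‖Sᗮ.starProjection x‖ : ℂ) := by
    intro x
    rw [integral_div]
    have := integral_add_linear_sq (B x x) (Complex.I • B.flip x)
    simp only [LinearMap.smul_apply, smul_eq_mul, LinearMap.flip_apply, mul_pow, Complex.I_sq,
      integral_const_mul] at this
    rw [this]; ring
  have i2 := i1.integral_prod_left
  simp only [s1] at i2 ⊢
  rw [integral_proj_stdGaussian S i2.aestronglyMeasurable]
  have i3 := integrable_proj_stdGaussian S i2
  rw [integral_prod_symm _ i3]
  have e : ∀ x1 x2 : E, Sᗮ.starProjection (S.starProjection x1 + Sᗮ.starProjection x2) =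
      Sᗮ.starProjection x2 := by
    intro x1 x2
    rw [map_add, Submodule.starProjection_eq_self_iff.2 (Sᗮ.starProjection_apply_mem x2)]
    rw [Submodule.starProjection_orthogonal_apply_eq_zero (S.starProjection_apply_mem x1), zero_add]
  have s2 : ∀ x2, ∫ x1, (B (S.starProjection x1 + Sᗮ.starProjection x2)
      (S.starProjection x1 + Sᗮ.starProjection x2) ^ 2 -
      ∫ y, B y (S.starProjection x1 + Sᗮ.starProjection x2) ^ 2 ∂stdGaussian E) /
      (‖Sᗮ.starProjection (S.starProjection x1 + Sᗮ.starProjection x2)‖ : ℂ) ∂stdGaussian E =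
      D ^ 2 * ((‖Sᗮ.starProjection x2‖ ^ 3 - ‖Sᗮ.starProjection x2‖ : ℝ) : ℂ) := by
    intro x2
    have hq := Sᗮ.starProjection_apply_mem x2
    have e3 : ∀ w x1, B w (S.starProjection x1 + Sᗮ.starProjection x2) =
        B w (Sᗮ.starProjection x2) := fun w x1 => by
      rw [map_add, h0 _ _ (S.starProjection_apply_mem x1), zero_add]
    simp only [e, e3]
    set q := Sᗮ.starProjection x2
    have e4 : ∀ x1, B (S.starProjection x1 + q) q = ‖q‖ ^ 2 * D + B (S.starProjection x1) q :=
      fun x1 => by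
        rw [map_add, LinearMap.add_apply, h1 q hq, real_inner_self_eq_norm_sq]; push_cast; ring
    simp only [e4]
    rw [integral_div, integral_bilinear_sq B S D h1 hq]
    set l1 : E →ₗ[ℝ] ℂ := B.flip q ∘ₗ S.starProjection.toLinearMap
    have hl1 : ∀ y, B (S.starProjection y) q = l1 y := fun y => rfl
    simp only [hl1]
    have i5 : Integrable (fun x1 => (‖q‖ ^ 2 * D + l1 x1) ^ 2) (stdGaussian E) := by
      have := (integrable_linear_sq l1).add (((integrable_linear l1).const_mul
        (2 * (‖q‖ ^ 2 * D))).add (integrable_const ((‖q‖ ^ 2 * D) ^ 2)))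
      refine this.congr (Eventually.of_forall fun x => ?_)
      simp only [Pi.add_apply]; ring
    rw [integral_sub i5 (integrable_const _), integral_add_linear_sq]
    simp only [integral_const, probReal_univ, one_smul]
    rcases eq_or_ne (‖q‖ : ℂ) 0 with h | h
    · have h' : ‖q‖ = 0 := by exact_mod_cast h
      simp [h']
    · push_cast
      field_simp
      ring
  simp only [s2]
  rw [integral_const_mul, integral_complex_ofReal]
end gauss

section gdet

variable {E : Type*} [NormedAddCommGroup E] [InnerProductSpace ℝ E]

/-- The determinant of the pairings of functionals `c` with vectors `x`. -/
def gdet {k : ℕ} (c : Fin k → E →ₗ[ℝ] ℂ) (x : Fin k → E) : ℂ :=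
  (Matrix.of fun i j => c i (x j)).det

/-- The functional `w ↦ ⟪x, w⟫ + i ⟪y, w⟫`. -/
def cfun (x y : E) : E →ₗ[ℝ] ℂ :=
  Complex.ofRealCLM.toLinearMap ∘ₗ innerₗ E x + Complex.I • (Complex.ofRealCLM.toLinearMap ∘ₗ innerₗ E y)

theorem cfun_apply (x y w : E) : cfun x y w = ⟪x, w⟫ + Complex.I * ⟪y, w⟫ := by
  simp [cfun]

theorem gdet_row {k : ℕ} (c : Fin k → E →ₗ[ℝ] ℂ) (x : Fin k → E) (u : E) :
    ∃ d : Fin k → ℂ, ∀ a : E →ₗ[ℝ] ℂ, gdet (Fin.cons a c : Fin (k + 1) → E →ₗ[ℝ] ℂ)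
      (Fin.cons u x : Fin (k + 1) → E) = a u * gdet c x + ∑ j, a (x j) * d j := by
  refine ⟨fun j => (-1) ^ (j.succ : ℕ) * (Matrix.det fun i l => c i
    ((Fin.cons u x : Fin (k + 1) → E) (j.succ.succAbove l))), fun a => ?_⟩
  rw [gdet, Matrix.det_succ_row_zero, Fin.sum_univ_succ]
  congr 1
  · simp [gdet]
    left; congr 1
  · refine Finset.sum_congr rfl fun j _ => ?_
    simp only [Matrix.of_apply, Fin.cons_zero, Fin.cons_succ]
    rw [mul_comm _ (a (x j)), mul_assoc]
    congr 2

theorem gdet_col {k : ℕ} (c : Fin (k + 1) → E →ₗ[ℝ] ℂ) (x : Fin k → E) :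
    ∃ d : Fin (k + 1) → ℂ, ∀ u, gdet c (Fin.cons u x : Fin (k + 1) → E) = ∑ i, c i u * d i := by
  refine ⟨fun i => (-1) ^ (i : ℕ) * (Matrix.det fun a b => c (i.succAbove a) (x b)), fun u => ?_⟩
  rw [gdet, Matrix.det_succ_column_zero]
  refine Finset.sum_congr rfl fun i _ => ?_
  simp only [Matrix.of_apply, Fin.cons_zero]
  rw [mul_comm _ (c i u), mul_assoc]
  congr 2

theorem gdet_eq_zero_of_dependent {k : ℕ} (c : Fin k → E →ₗ[ℝ] ℂ) {x : Fin k → E}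
    (h : ¬ LinearIndependent ℝ x) : gdet c x = 0 := by
  obtain ⟨g, hg, i, hi⟩ := Fintype.not_linearIndependent_iff.1 h
  rw [gdet, ← Matrix.exists_mulVec_eq_zero_iff]
  refine ⟨fun j => (g j : ℂ), fun h0 => hi ?_, ?_⟩
  · have := congrFun h0 i; simpa using this
  · ext i
    have := congrArg (c i) hg
    rw [map_sum, map_zero] at this
    simp only [Matrix.mulVec, dotProduct, Matrix.of_apply, Pi.zero_apply]
    rw [← this]
    refine Finset.sum_congr rfl fun j _ => ?_
    rw [map_smul, mul_comm]; simp

variable [FiniteDimensional ℝ E]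

/-- The dependence of `gdet` on its first row and column. -/
def gbil {k : ℕ} (c : Fin k → E →ₗ[ℝ] ℂ) (x : Fin k → E) : E →ₗ[ℝ] E →ₗ[ℝ] ℂ :=
  LinearMap.mk₂ ℝ (fun w u => gdet (Fin.cons (cfun w 0) c : Fin (k + 1) → E →ₗ[ℝ] ℂ)
      (Fin.cons u x : Fin (k + 1) → E))
    (fun w w' u => by
      obtain ⟨d, hd⟩ := gdet_row c x u
      simp only [hd, cfun_apply, inner_add_left, inner_zero_left]
      push_cast
      simp only [add_mul, Finset.sum_add_distrib, mul_zero, add_zero]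
      ring)
    (fun r w u => by
      obtain ⟨d, hd⟩ := gdet_row c x u
      simp only [hd, cfun_apply, inner_smul_left, inner_zero_left, Complex.real_smul, mul_add,
        Finset.mul_sum]
      simp [mul_assoc])
    (fun w u u' => by
      obtain ⟨d, hd⟩ := gdet_col (Fin.cons (cfun w 0) c : Fin (k + 1) → E →ₗ[ℝ] ℂ) x
      simp only [hd, map_add, add_mul, Finset.sum_add_distrib])
    (fun r w u => by
      obtain ⟨d, hd⟩ := gdet_col (Fin.cons (cfun w 0) c : Fin (k + 1) → E →ₗ[ℝ] ℂ) x
      simp only [hd, map_smul, Complex.real_smul, Finset.mul_sum, mul_assoc])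

theorem gbil_apply {k : ℕ} (c : Fin k → E →ₗ[ℝ] ℂ) (x : Fin k → E) (w u : E) :
    gbil c x w u = gdet (Fin.cons (cfun w 0) c : Fin (k + 1) → E →ₗ[ℝ] ℂ)
      (Fin.cons u x : Fin (k + 1) → E) := rfl

theorem gdet_cons {k : ℕ} (c : Fin k → E →ₗ[ℝ] ℂ) (x : Fin k → E) (a b u : E) :
    gdet (Fin.cons (cfun a b) c : Fin (k + 1) → E →ₗ[ℝ] ℂ) (Fin.cons u x : Fin (k + 1) → E) =
      gbil c x a u + Complex.I * gbil c x b u := by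
  obtain ⟨d, hd⟩ := gdet_row c x u
  simp only [gbil_apply, hd, cfun_apply, inner_zero_left, mul_add, Finset.mul_sum, add_mul,
    Finset.sum_add_distrib]
  simp [mul_assoc]
  ring

theorem gbil_of_mem {k : ℕ} (c : Fin k → E →ₗ[ℝ] ℂ) (x : Fin k → E) (w : E) {u : E}
    (hu : u ∈ Submodule.span ℝ (Set.range x)) : gbil c x w u = 0 := by
  have : Submodule.span ℝ (Set.range x) ≤ LinearMap.ker (gbil c x w) := by
    rw [Submodule.span_le]
    rintro _ ⟨j, rfl⟩
    rw [SetLike.mem_coe, LinearMap.mem_ker, gbil_apply]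
    refine gdet_eq_zero_of_dependent _ fun h => ?_
    have := h.injective (a₁ := 0) (a₂ := j.succ) (by simp)
    exact (Fin.succ_ne_zero j) this.symm
  exact this hu

theorem gbil_of_perp {k : ℕ} (c : Fin k → E →ₗ[ℝ] ℂ) (x : Fin k → E) {w : E}
    (hw : w ∈ (Submodule.span ℝ (Set.range x))ᗮ) (u : E) : gbil c x w u = ⟪w, u⟫ * gdet c x := by
  obtain ⟨d, hd⟩ := gdet_row c x u
  rw [gbil_apply, hd]
  have : ∀ j, ⟪w, x j⟫ = 0 := fun j => by
    rw [real_inner_comm]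
    exact (Submodule.mem_orthogonal _ _).1 hw _ (Submodule.subset_span ⟨j, rfl⟩)
  simp [cfun_apply, this]

/-- The Gram determinant. -/
def gram {k : ℕ} (x : Fin k → E) : ℂ := gdet (fun i => cfun (x i) 0) x

theorem gram_cons {k : ℕ} (x : Fin k → E) (u : E) :
    gram (Fin.cons u x : Fin (k + 1) → E) =
      ‖(Submodule.span ℝ (Set.range x))ᗮ.starProjection u‖ ^ 2 * gram x := by
  have e : (fun i => cfun ((Fin.cons u x : Fin (k + 1) → E) i) 0) =
      (Fin.cons (cfun u 0) fun i => cfun (x i) 0 : Fin (k + 1) → E →ₗ[ℝ] ℂ) := by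
    ext i; refine Fin.cases ?_ (fun i => ?_) i <;> simp
  set S := Submodule.span ℝ (Set.range x)
  rw [gram, e, ← gbil_apply]
  set B := gbil (fun i => cfun (x i) 0) x with hB
  have hu := S.starProjection_add_starProjection_orthogonal u
  have hB0 : ∀ w u, u ∈ S → B w u = 0 := fun w u hu => gbil_of_mem _ _ w hu
  have hB1 : ∀ u, u ∈ S → ∀ w, B u w = B w u := by
    intro u hu w
    rw [hB, gbil_apply, gbil_apply, gdet, gdet, ← Matrix.det_transpose]
    congr 1
    ext i j
    refine Fin.cases ?_ (fun i => ?_) i <;> refine Fin.cases ?_ (fun j => ?_) j <;>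
      simp [cfun_apply, real_inner_comm]
  conv_lhs => rw [← hu]
  rw [map_add, map_add, LinearMap.add_apply, LinearMap.add_apply, hB0 _ _ (S.starProjection_apply_mem u),
    hB0 _ _ (S.starProjection_apply_mem u), hB1 _ (S.starProjection_apply_mem u),
    hB0 _ _ (S.starProjection_apply_mem u), hB, gbil_of_perp _ _ (Sᗮ.starProjection_apply_mem u),
    real_inner_self_eq_norm_sq, gram]
  push_cast; ring

variable [MeasurableSpace E] [BorelSpace E]

/-- Integration of the integrand of the recursion over its first row. -/
theorem integral_gdet_row {k m : ℕ} (hm : Module.finrank ℝ E = k + m) (c : Fin k → E →ₗ[ℝ] ℂ)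
    (x : Fin k → E) :
    ∫ p : E × E, gdet (Fin.cons (cfun p.1 p.2) c : Fin (k + 1) → E →ₗ[ℝ] ℂ)
        (Fin.cons p.1 x : Fin (k + 1) → E) ^ 2 / √‖gram (Fin.cons p.1 x : Fin (k + 1) → E)‖
      ∂(stdGaussian E).prod (stdGaussian E) = gconst m * (gdet c x ^ 2 / √‖gram x‖) := by
  by_cases hx : LinearIndependent ℝ x
  · set S := Submodule.span ℝ (Set.range x) with hS
    have hr : Module.finrank ℝ Sᗮ = m := by
      have h1 := S.finrank_add_finrank_orthogonal
      have h2 : Module.finrank ℝ S = k := by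
        rw [hS, finrank_span_eq_card hx, Fintype.card_fin]
      omega
    have e : ∀ p : E × E, gdet (Fin.cons (cfun p.1 p.2) c : Fin (k + 1) → E →ₗ[ℝ] ℂ)
        (Fin.cons p.1 x : Fin (k + 1) → E) ^ 2 / (√‖gram (Fin.cons p.1 x : Fin (k + 1) → E)‖ : ℂ) =
        (gbil c x p.1 p.1 + Complex.I * gbil c x p.2 p.1) ^ 2 / ‖Sᗮ.starProjection p.1‖ *
          (√‖gram x‖ : ℂ)⁻¹ := by
      intro p
      rw [gdet_cons, gram_cons, norm_mul, norm_pow, Complex.norm_real, norm_norm,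
        Real.sqrt_mul (by positivity), Real.sqrt_sq (norm_nonneg _)]
      push_cast
      rw [div_mul_eq_div_div, div_eq_mul_inv (_ / _)]
    simp only [e]
    rw [integral_mul_const, integral_row (gbil c x) S (gdet c x) (fun w u hu => gbil_of_mem c x w hu)
      fun w hw u => gbil_of_perp c x hw u]
    rw [integral_norm_proj Sᗮ hr (f := fun t => t ^ 3 - t) (by fun_prop), gconst]
    ring
  · have h1 : ∀ u, ¬ LinearIndependent ℝ (Fin.cons u x : Fin (k + 1) → E) := fun u h =>
      hx (by simpa [Function.comp_def] using h.comp Fin.succ (Fin.succ_injective k))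
    simp [gdet_eq_zero_of_dependent _ hx, gdet_eq_zero_of_dependent _ (h1 _)]
end gdet

section recursion

variable {E : Type*} [NormedAddCommGroup E] [InnerProductSpace ℝ E] [FiniteDimensional ℝ E]
  [MeasurableSpace E] [BorelSpace E]

variable (E) in
/-- The law of the pairs of real and imaginary parts of `k` Gaussian rows. -/
def rowLaw (k : ℕ) : Measure (Fin k → E × E) :=
  Measure.pi fun _ => (stdGaussian E).prod (stdGaussian E)

/-- The integrand of the Gaussian recursion. -/
def rowFun {k : ℕ} (p : Fin k → E × E) : ℂ :=
  gdet (fun i => cfun (p i).1 (p i).2) (fun i => (p i).1) ^ 2 / √‖gram fun i => (p i).1‖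

theorem rowFun_cons {k : ℕ} (q : E × E) (p : Fin k → E × E) :
    rowFun (Fin.cons q p : Fin (k + 1) → E × E) =
      gdet (Fin.cons (cfun q.1 q.2) fun i => cfun (p i).1 (p i).2 : Fin (k + 1) → E →ₗ[ℝ] ℂ)
        (Fin.cons q.1 fun i => (p i).1 : Fin (k + 1) → E) ^ 2 /
        √‖gram (Fin.cons q.1 fun i => (p i).1 : Fin (k + 1) → E)‖ := by
  have e1 : (fun i => cfun ((Fin.cons q p : Fin (k + 1) → E × E) i).1
      ((Fin.cons q p : Fin (k + 1) → E × E) i).2) =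
      (Fin.cons (cfun q.1 q.2) fun i => cfun (p i).1 (p i).2 : Fin (k + 1) → E →ₗ[ℝ] ℂ) := by
    ext i; refine Fin.cases ?_ (fun i => ?_) i <;> simp
  have e2 : (fun i => ((Fin.cons q p : Fin (k + 1) → E × E) i).1) =
      (Fin.cons q.1 fun i => (p i).1 : Fin (k + 1) → E) := by
    ext i; refine Fin.cases ?_ (fun i => ?_) i <;> simp
  rw [rowFun, e1, e2]

theorem integral_rowFun_succ {k m : ℕ} (hm : Module.finrank ℝ E = k + m) (hm0 : 0 < m)
    (hi : Integrable (rowFun (E := E) (k := k + 1)) (rowLaw E (k + 1))) :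
    Integrable (rowFun (E := E) (k := k)) (rowLaw E k) ∧
      ∫ p, rowFun p ∂rowLaw E (k + 1) = gconst m * ∫ p, rowFun p ∂rowLaw E k := by
  have mp := (measurePreserving_piFinSuccAbove
    (fun _ : Fin (k + 1) => (stdGaussian E).prod (stdGaussian E)) 0).symm
  have hi' := (mp.integrable_comp_emb (MeasurableEquiv.measurableEmbedding _)).2 hi
  have h1 := mp.integral_comp (MeasurableEquiv.measurableEmbedding _) (rowFun (E := E) (k := k + 1))
  have e : ∀ (q : E × E) (p : Fin k → E × E),
      (MeasurableEquiv.piFinSuccAbove (fun _ : Fin (k + 1) => E × E) 0).symm (q, p) =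
        (Fin.cons q p : Fin (k + 1) → E × E) := by
    intro q p
    simp [MeasurableEquiv.piFinSuccAbove]
    rfl
  have s : ∀ p : Fin k → E × E, ∫ q, rowFun (Fin.cons q p : Fin (k + 1) → E × E)
      ∂(stdGaussian E).prod (stdGaussian E) = gconst m * rowFun p := fun p => by
    simp only [rowFun_cons]
    exact integral_gdet_row hm _ _
  have h2 := hi'.integral_prod_right
  have h0 := integral_prod_symm _ hi'
  simp only [Function.comp_apply] at h0
  rw [h0] at h1
  simp only [Function.comp_apply, e, s] at h1 h2
  have hg : (gconst m : ℂ) ≠ 0 := by exact_mod_cast (gconst_pos hm0).ne'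
  refine ⟨?_, ?_⟩
  · refine (h2.const_mul (gconst m : ℂ)⁻¹).congr (Eventually.of_forall fun p => ?_)
    simp only
    rw [← mul_assoc, inv_mul_cancel₀ hg, one_mul]
  · rw [rowLaw, ← h1, integral_const_mul]; rfl

theorem rowFun_integral {k j : ℕ} (h : Module.finrank ℝ E = k + j)
    (hi : Integrable (rowFun (E := E) (k := k + j)) (rowLaw E (k + j))) :
    Integrable (rowFun (E := E) (k := k)) (rowLaw E k) ∧
      ∃ c : ℝ, 0 < c ∧ ∫ p, rowFun p ∂rowLaw E (k + j) = c * ∫ p, rowFun p ∂rowLaw E k := by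
  induction j generalizing k with
  | zero => exact ⟨hi, 1, one_pos, by simp⟩
  | succ j ih =>
    have e : k + (j + 1) = k + 1 + j := by ring
    rw [e] at hi
    obtain ⟨h1, c, hc, h2⟩ := ih (by omega) hi
    obtain ⟨h3, h4⟩ := integral_rowFun_succ h (Nat.succ_pos j) h1
    refine ⟨h3, c * gconst (j + 1), mul_pos hc (gconst_pos (Nat.succ_pos j)), ?_⟩
    rw [e, h2, h4]; push_cast; ring

/-- The full Gaussian integral is positive. -/
theorem rowFun_integral_pos {n : ℕ} (h : Module.finrank ℝ E = n)
    (hi : Integrable (rowFun (E := E) (k := n)) (rowLaw E n)) :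
    ∃ c : ℝ, 0 < c ∧ ∫ p, rowFun p ∂rowLaw E n = c := by
  have := rowFun_integral (E := E) (k := 0) (j := n) (by omega)
  rw [zero_add] at this
  obtain ⟨-, c, hc, h2⟩ := this hi
  refine ⟨c, hc, h2.trans ?_⟩
  have e : ∀ p : Fin 0 → E × E, rowFun p = 1 := fun p => by
    simp [rowFun, gdet, gram]
  simp only [e]
  simp [rowLaw]
end recursion

section volume

variable {F : Type*} [NormedAddCommGroup F] [InnerProductSpace ℝ F] [FiniteDimensional ℝ F]

theorem norm_le_of_mem {K : ConvexBody F} {x : F} (hx : x ∈ K) : ‖x‖ ≤ dist K 0 := by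
  have h1 := (le_supp K hx x).trans ((le_abs_self _).trans (abs_supp_le K x))
  rw [real_inner_self_eq_norm_sq, pow_two] at h1
  rcases eq_or_ne ‖x‖ 0 with h | h
  · rw [h]; exact dist_nonneg
  · exact le_of_mul_le_mul_right h1 (lt_of_le_of_ne (norm_nonneg _) h.symm)

theorem eventually_notMem {K : ConvexBody F} {x : F} (hx : x ∉ K) : ∀ᶠ L in 𝓝 K, x ∉ L := by
  rw [mem_iff_supp] at hx
  push Not at hx
  obtain ⟨u, hu⟩ := hx
  filter_upwards [(continuous_supp_body u).continuousAt.eventually_lt continuousAt_const hu] with L hL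
  exact fun h => absurd (le_supp L h u) (not_le.2 hL)

theorem eventually_mem_of_mem_interior {K : ConvexBody F} {x : F} (hx : x ∈ interior (K : Set F)) :
    ∀ᶠ L in 𝓝 K, x ∈ L := by
  obtain ⟨ε, hε, hb⟩ := Metric.mem_nhds_iff.1 (mem_interior_iff_mem_nhds.1 hx)
  filter_upwards [Metric.ball_mem_nhds K (half_pos hε)] with L hL
  rw [mem_iff_supp]
  intro u
  rcases eq_or_ne u 0 with rfl | hu
  · rw [inner_zero_right, (supp_sublin L).zero]
  have hu' : 0 < ‖u‖ := norm_pos_iff.2 hu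
  have h1 : x + (ε / 2 * ‖u‖⁻¹) • u ∈ K := by
    refine hb ?_
    rw [mem_ball_iff_norm, add_sub_cancel_left, norm_smul, Real.norm_of_nonneg (by positivity),
      mul_assoc, inv_mul_cancel₀ hu'.ne']
    linarith
  have h2 := le_supp K h1 u
  rw [inner_add_left, inner_smul_left, real_inner_self_eq_norm_sq] at h2
  have h3 : ε / 2 * ‖u‖⁻¹ * ‖u‖ ^ 2 = ε / 2 * ‖u‖ := by field_simp
  simp only [conj_trivial] at h2
  rw [h3] at h2
  have h4 := (abs_le.1 (abs_supp_sub_le L K u)).1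
  have h5 : dist L K * ‖u‖ ≤ ε / 2 * ‖u‖ :=
    mul_le_mul_of_nonneg_right (Metric.mem_ball.1 hL).le hu'.le
  linarith

theorem continuous_lmap_family {A E : Type*} [TopologicalSpace A] [NormedAddCommGroup E]
    [InnerProductSpace ℝ E] [FiniteDimensional ℝ E] {T : A → E →L[ℝ] F}
    (hT : Continuous T) (K : ConvexBody E) : Continuous fun a => lmap (T a).toLinearMap K := by
  have hL : ∀ S R : E →L[ℝ] F, dist (lmap S.toLinearMap K) (lmap R.toLinearMap K) ≤ dist K 0 * dist S R := by
    intro S R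
    have hR : ∀ S R : E →L[ℝ] F, ∀ u : F, ‖u‖ = 1 →
        supp (lmap S.toLinearMap K) u ≤ supp (lmap R.toLinearMap K) u + dist K 0 * dist S R := by
      intro S R u hu
      refine supp_le _ u ?_
      rintro _ ⟨x, hx, rfl⟩
      have h1 : ⟪R x, u⟫ ≤ supp (lmap R.toLinearMap K) u :=
        le_supp _ (mem_image_of_mem R hx : R x ∈ (lmap R.toLinearMap K : Set F)) u
      have h2 : ⟪(S - R) x, u⟫ ≤ dist K 0 * dist S R := by
        refine (real_inner_le_norm _ _).trans ?_
        rw [hu, mul_one, dist_eq_norm, mul_comm]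
        exact ((S - R).le_opNorm x).trans
          (mul_le_mul_of_nonneg_left (norm_le_of_mem hx) (norm_nonneg _))
      rw [sub_apply, inner_sub_left] at h2
      change ⟪S x, u⟫ ≤ _
      linarith
    refine dist_le_of_supp (by positivity) fun u hu => ?_
    rw [abs_le]
    have h1 := hR S R u hu
    have h2 := hR R S u hu
    rw [dist_comm R S] at h2
    constructor <;> linarith
  have : LipschitzWith ⟨dist K 0, dist_nonneg⟩ fun S : E →L[ℝ] F => lmap S.toLinearMap K :=
    LipschitzWith.of_dist_le_mul fun S R => hL S R
  exact this.continuous.comp hT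

variable [MeasurableSpace F] [BorelSpace F] (ν : Measure F) [ν.IsAddHaarMeasure]

theorem continuous_volume : Continuous fun K : ConvexBody F => ν.real K := by
  rw [continuous_iff_continuousAt]
  intro K
  have e : ∀ L : ConvexBody F, ν.real L = ∫ x, (L : Set F).indicator (fun _ => (1 : ℝ)) x ∂ν := fun L => by
    rw [integral_indicator L.isCompact.measurableSet]; simp
  rw [ContinuousAt]
  simp only [e]
  set B := Metric.closedBall (0 : F) (dist K 0 + 1)
  refine tendsto_integral_filter_of_dominated_convergence (B.indicator fun _ => (1 : ℝ)) ?_ ?_ ?_ ?_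
  · exact Eventually.of_forall fun L =>
      (stronglyMeasurable_const.indicator L.isCompact.measurableSet).aestronglyMeasurable
  · filter_upwards [Metric.ball_mem_nhds K one_pos] with L hL
    refine Eventually.of_forall fun x => ?_
    rw [norm_indicator_eq_indicator_norm]
    by_cases hx : x ∈ (L : Set F)
    · have : x ∈ B := by
        rw [mem_closedBall_zero_iff]
        have h1 := norm_le_of_mem (K := L) hx
        have h2 := dist_triangle L K 0
        have h3 := Metric.mem_ball.1 hL
        linarith
      rw [indicator_of_mem hx, indicator_of_mem this]; simp
    · rw [indicator_of_notMem hx]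
      exact indicator_nonneg (fun _ _ => zero_le_one) x
  · exact (integrable_indicator_iff measurableSet_closedBall).2
      (integrableOn_const (isCompact_closedBall _ _).measure_lt_top.ne)
  · have h0 := K.convex.addHaar_frontier ν
    filter_upwards [measure_eq_zero_iff_ae_notMem.1 h0] with x hx
    by_cases hK : x ∈ (K : Set F)
    · have hi : x ∈ interior (K : Set F) := by
        by_contra h
        exact hx ⟨subset_closure hK, h⟩
      refine tendsto_const_nhds.congr' ?_
      filter_upwards [eventually_mem_of_mem_interior hi] with L hL
      rw [indicator_of_mem hK, indicator_of_mem (show x ∈ (L : Set F) from hL)]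
    · refine tendsto_const_nhds.congr' ?_
      filter_upwards [eventually_notMem (K := K) hK] with L hL
      rw [indicator_of_notMem hK, indicator_of_notMem (show x ∉ (L : Set F) from hL)]

theorem ctv_volume : CTV fun K : ConvexBody F => (ν.real K : ℂ) := by
  refine ⟨fun K L U I hU hI => ?_, Complex.continuous_ofReal.comp (continuous_volume ν), fun x K => ?_⟩
  · have h1 := measureReal_union_add_inter (μ := ν) (s := (K : Set F)) L.isCompact.measurableSet
      K.isCompact.measure_lt_top.ne L.isCompact.measure_lt_top.ne
    rw [hU, hI]
    exact_mod_cast h1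
  · have : ((K + pt x : ConvexBody F) : Set F) = (fun y => y + x) '' K := by
      change (K : Set F) + {x} = _
      rw [Set.add_singleton]
    rw [this, Set.image_add_right, Measure.real, measure_preimage_add_right]; rfl

end volume

section kernel

variable {n : ℕ}

/-- The real linear map `z ↦ (Re⟨aᵢ, z⟩)ᵢ`. -/
def tmap (a : Fin n → Cn n) : Cn n →L[ℝ] EuclideanSpace ℝ (Fin n) :=
  (EuclideanSpace.equiv (Fin n) ℝ).symm.toContinuousLinearMap ∘L
    ContinuousLinearMap.pi fun i => innerSL ℝ (a i)

theorem tmap_apply (a : Fin n → Cn n) (z : Cn n) (i : Fin n) : tmap a z i = ⟪a i, z⟫ := rfl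

theorem continuous_tmap : Continuous (tmap (n := n)) := by
  rw [continuous_clm_apply]
  intro z
  refine (PiLp.continuous_toLp 2 _).comp (continuous_pi fun i => ?_)
  exact Continuous.inner (𝕜 := ℝ) (f := fun a : Fin n → Cn n => a i) (continuous_apply i) continuous_const

/-- The Gaussian kernel of the valuation of weight two. -/
def kern (K : ConvexBody (Cn n)) (a : Fin n → Cn n) : ℂ :=
  (Matrix.of fun i j => a i j).det ^ 2 *
    ((volume : Measure (EuclideanSpace ℝ (Fin n))).real (lmap (tmap a).toLinearMap K) : ℂ)

theorem continuous_kern (K : ConvexBody (Cn n)) : Continuous (kern K) := by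
  refine Continuous.mul (Continuous.pow (Continuous.matrix_det ?_) 2) ?_
  · refine continuous_matrix fun i j => ?_
    exact (PiLp.continuous_apply 2 _ j).comp (continuous_apply i)
  · exact Complex.continuous_ofReal.comp
      ((continuous_volume volume).comp (continuous_lmap_family continuous_tmap K))

theorem ctv_kern (a : Fin n → Cn n) : CTV fun K => kern K a := by
  have := ((ctv_volume (volume : Measure (EuclideanSpace ℝ (Fin n)))).comp
    (tmap a).toLinearMap).const_mul ((Matrix.of fun i j => a i j).det ^ 2)
  exact this

theorem norm_le_prod_one_add (a : Fin n → Cn n) (i : Fin n) : ‖a i‖ ≤ ∏ i, (1 + ‖a i‖) := by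
  have h1 : (1 : ℝ) ≤ ∏ j ∈ Finset.univ.erase i, (1 + ‖a j‖) :=
    Finset.one_le_prod fun j => by simp
  rw [← Finset.mul_prod_erase _ _ (Finset.mem_univ i)]
  nlinarith [norm_nonneg (a i)]

theorem norm_tmap_le (a : Fin n → Cn n) (z : Cn n) :
    ‖tmap a z‖ ≤ n * (∏ i, (1 + ‖a i‖)) * ‖z‖ := by
  set P := ∏ i, (1 + ‖a i‖) with hP
  have hP0 : 0 ≤ P := Finset.prod_nonneg fun i _ => by positivity
  refine abs_le_of_sq_le_sq' ?_ (by positivity) |>.2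
  rw [EuclideanSpace.norm_sq_eq]
  have h : ∀ i ∈ Finset.univ, ‖tmap a z i‖ ^ 2 ≤ (P * ‖z‖) ^ 2 := fun i _ => by
    rw [tmap_apply]
    refine pow_le_pow_left₀ (norm_nonneg _) ((abs_real_inner_le_norm _ _).trans ?_) 2
    exact mul_le_mul_of_nonneg_right (norm_le_prod_one_add a i) (norm_nonneg _)
  refine (Finset.sum_le_sum h).trans ?_
  rw [Finset.sum_const, Finset.card_univ, Fintype.card_fin, nsmul_eq_mul, mul_assoc, mul_pow (n : ℝ)]
  refine mul_le_mul_of_nonneg_right ?_ (by positivity)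
  exact_mod_cast Nat.le_self_pow two_ne_zero n

/-- The constant in the polynomial bound of the kernel. -/
def kernConst (n : ℕ) : ℝ :=
  (n.factorial : ℝ) ^ 2 * ((n : ℝ) ^ n *
    (volume : Measure (EuclideanSpace ℝ (Fin n))).real (Metric.ball 0 1))

theorem norm_kern_le (K : ConvexBody (Cn n)) (a : Fin n → Cn n) {R : ℝ} (hR : dist K 0 ≤ R) :
    ‖kern K a‖ ≤ kernConst n * R ^ n * ∏ i, (1 + ‖a i‖) ^ (3 * n) := by
  rw [Finset.prod_pow]
  set P := ∏ i, (1 + ‖a i‖) with hP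
  have hP0 : 0 ≤ P := Finset.prod_nonneg fun i _ => by positivity
  have hR0 : 0 ≤ R := dist_nonneg.trans hR
  have h1 : ‖(Matrix.of fun i j => a i j).det‖ ≤ n.factorial * P ^ n := by
    have := Matrix.det_le (A := Matrix.of fun i j => a i j) (abv := NormedField.toAbsoluteValue ℂ)
      (x := P) fun i j => ((PiLp.norm_apply_le (a i) j).trans (norm_le_prod_one_add a i) :)
    rwa [nsmul_eq_mul, Fintype.card_fin] at this
  have h2 : (volume : Measure (EuclideanSpace ℝ (Fin n))).real (lmap (tmap a).toLinearMap K) ≤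
      (n * P * R) ^ n * (volume : Measure (EuclideanSpace ℝ (Fin n))).real (Metric.ball 0 1) := by
    have hs : (lmap (tmap a).toLinearMap K : Set (EuclideanSpace ℝ (Fin n))) ⊆
        Metric.closedBall 0 (n * P * R) := by
      rintro _ ⟨z, hz, rfl⟩
      rw [mem_closedBall_zero_iff]
      exact (norm_tmap_le a z).trans
        (mul_le_mul_of_nonneg_left ((norm_le_of_mem hz).trans hR) (by positivity))
    refine (measureReal_mono hs (isCompact_closedBall _ _).measure_lt_top.ne).trans ?_
    rw [Measure.addHaar_real_closedBall _ _ (by positivity), finrank_euclideanSpace_fin]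
  rw [kern, norm_mul, norm_pow, Complex.norm_real, Real.norm_of_nonneg measureReal_nonneg]
  refine (mul_le_mul (pow_le_pow_left₀ (norm_nonneg _) h1 2) h2 measureReal_nonneg
    (by positivity)).trans (le_of_eq ?_)
  rw [kernConst, mul_pow, mul_pow, mul_pow]; ring

/-- The law of `n` independent standard Gaussian vectors of `ℂⁿ`. -/
def gaussLaw (n : ℕ) : Measure (Fin n → Cn n) := Measure.pi fun _ => stdGaussian (Cn n)

theorem integrable_kern_bound (c : ℝ) :
    Integrable (fun a : Fin n → Cn n => c * ∏ i, (1 + ‖a i‖) ^ (3 * n)) (gaussLaw n) :=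
  (Integrable.fintype_prod (f := fun _ : Fin n => fun x : Cn n => (1 + ‖x‖) ^ (3 * n))
    fun _ => integrable_one_add_norm_pow _).const_mul c

theorem integrable_kern (K : ConvexBody (Cn n)) : Integrable (kern K) (gaussLaw n) :=
  (integrable_kern_bound _).mono' (continuous_kern K).aestronglyMeasurable
    (Eventually.of_forall fun a => norm_kern_le K a le_rfl)

/-- A valuation of weight two. -/
def gval (K : ConvexBody (Cn n)) : ℂ := ∫ a, kern K a ∂gaussLaw n

theorem continuous_gval : Continuous (gval (n := n)) := by
  rw [continuous_iff_continuousAt]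
  intro K
  refine continuousAt_of_dominated (F := fun K a => kern K a)
    (bound := fun a => kernConst n * (dist K 0 + 1) ^ n * ∏ i, (1 + ‖a i‖) ^ (3 * n))
    (Eventually.of_forall fun L => (continuous_kern L).aestronglyMeasurable) ?_
    (integrable_kern_bound _) (Eventually.of_forall fun a => (ctv_kern a).cont.continuousAt)
  filter_upwards [Metric.ball_mem_nhds K one_pos] with L hL
  refine Eventually.of_forall fun a => norm_kern_le L a ?_
  have h2 := dist_triangle L K 0
  have h3 := Metric.mem_ball.1 hL
  linarith

theorem ctv_gval : CTV (gval (n := n)) := by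
  refine ⟨fun K L U I hU hI => ?_, continuous_gval, fun x K => ?_⟩
  · rw [gval, gval, gval, gval, ← integral_add (integrable_kern _) (integrable_kern _),
      ← integral_add (integrable_kern _) (integrable_kern _)]
    exact integral_congr_ae (Eventually.of_forall fun a => (ctv_kern a).val K L U I hU hI)
  · exact integral_congr_ae (Eventually.of_forall fun a => (ctv_kern a).tinv x K)

/-- A unitary matrix as a real linear isometry. -/
def unitaryIso {g : Matrix (Fin n) (Fin n) ℂ} (hg : g ∈ Matrix.unitaryGroup (Fin n) ℂ) :
    Cn n ≃ₗᵢ[ℝ] Cn n :=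
  LinearIsometry.toLinearIsometryEquiv
    ((ml g).isometryOfInner fun x y => by
      have e : ∀ x, ml g x = Matrix.toEuclideanLin g x := fun x => rfl
      rw [inner_re, inner_re, e, e, ← LinearMap.adjoint_inner_right,
        ← Matrix.toEuclideanLin_conjTranspose_eq_adjoint]
      have h := ml_mul g.conjTranspose g y
      rw [← Matrix.star_eq_conjTranspose, Matrix.mem_unitaryGroup_iff'.1 hg] at h
      have h' : Matrix.toEuclideanLin g.conjTranspose (Matrix.toEuclideanLin g y) = y := by
        refine h.symm.trans ?_
        simp [ml]
      rw [h']) rfl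

theorem unitaryIso_apply {g : Matrix (Fin n) (Fin n) ℂ} (hg : g ∈ Matrix.unitaryGroup (Fin n) ℂ)
    (x : Cn n) : unitaryIso hg x = ml g x := rfl

theorem kern_unitary {g : Matrix (Fin n) (Fin n) ℂ} (hg : g ∈ Matrix.unitaryGroup (Fin n) ℂ)
    (K : ConvexBody (Cn n)) (a : Fin n → Cn n) :
    kern (lmap (ml g) K) (fun i => unitaryIso hg (a i)) = g.det ^ 2 * kern K a := by
  have h1 : (Matrix.of fun i j => unitaryIso hg (a i) j) = (Matrix.of fun i j => a i j) * g.transpose := by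
    ext i j
    simp [Matrix.mul_apply, unitaryIso_apply, ml, Matrix.toLpLin_apply, Matrix.mulVec, dotProduct, mul_comm]
  have h2 : (lmap (tmap fun i => unitaryIso hg (a i)).toLinearMap (lmap (ml g) K) :
      Set (EuclideanSpace ℝ (Fin n))) = lmap (tmap a).toLinearMap K := by
    rw [coe_lmap, coe_lmap, coe_lmap, image_image]
    refine image_congr fun z _ => ?_
    ext i
    change ⟪unitaryIso hg (a i), unitaryIso hg z⟫ = ⟪a i, z⟫
    exact (unitaryIso hg).inner_map_map _ _
  rw [kern, kern, h1, h2, Matrix.det_mul, Matrix.det_transpose]; ring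

theorem gval_unitary {g : Matrix (Fin n) (Fin n) ℂ} (hg : g ∈ Matrix.unitaryGroup (Fin n) ℂ)
    (K : ConvexBody (Cn n)) : gval (lmap (ml g) K) = g.det ^ 2 * gval K := by
  have mp : MeasurePreserving (fun (a : Fin n → Cn n) i => unitaryIso hg (a i)) (gaussLaw n)
      (gaussLaw n) := measurePreserving_pi _ _ fun i =>
    ⟨(unitaryIso hg).continuous.measurable, ProbabilityTheory.stdGaussian_map (unitaryIso hg)⟩
  rw [gval, gval, ← mp.map_eq, integral_map mp.measurable.aemeasurable
    (continuous_kern _).aestronglyMeasurable]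
  simp only [kern_unitary]
  rw [mp.map_eq, integral_const_mul]

theorem w2_gval : W2 (gval (n := n)) := ⟨ctv_gval, fun _ hg K => gval_unitary hg K⟩

end kernel

section nonvanishing

variable {n : ℕ}

/-- The vector of `ℂⁿ` with given real and imaginary parts. -/
def cplx (p : EuclideanSpace ℝ (Fin n) × EuclideanSpace ℝ (Fin n)) : Cn n :=
  WithLp.toLp 2 fun j => (p.1 j : ℂ) + Complex.I * p.2 j

theorem continuous_cplx : Continuous (cplx (n := n)) := by
  unfold cplx
  fun_prop

theorem inner_cplx (p : EuclideanSpace ℝ (Fin n) × EuclideanSpace ℝ (Fin n)) (z : Cn n) :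
    ⟪cplx p, z⟫ = ⟪p.1, WithLp.toLp 2 fun j => (z j).re⟫ + ⟪p.2, WithLp.toLp 2 fun j => (z j).im⟫ := by
  rw [inner_re, PiLp.inner_apply, PiLp.inner_apply, PiLp.inner_apply, Complex.re_sum,
    ← Finset.sum_add_distrib]
  refine Finset.sum_congr rfl fun j _ => ?_
  simp [cplx]

theorem gaussian_map_cplx :
    Measure.map cplx ((stdGaussian (EuclideanSpace ℝ (Fin n))).prod
      (stdGaussian (EuclideanSpace ℝ (Fin n)))) = stdGaussian (Cn n) := by
  have : IsProbabilityMeasure (Measure.map (cplx (n := n))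
      ((stdGaussian (EuclideanSpace ℝ (Fin n))).prod (stdGaussian (EuclideanSpace ℝ (Fin n))))) :=
    Measure.isProbabilityMeasure_map continuous_cplx.measurable.aemeasurable
  refine Measure.ext_of_charFun (funext fun z => ?_)
  rw [ProbabilityTheory.charFun_stdGaussian, charFun_apply, integral_map
    continuous_cplx.measurable.aemeasurable (by fun_prop)]
  simp only [inner_cplx, Complex.ofReal_add, add_mul, Complex.exp_add]
  have h := integral_prod_mul (μ := stdGaussian (EuclideanSpace ℝ (Fin n)))
    (ν := stdGaussian (EuclideanSpace ℝ (Fin n)))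
    (fun x => Complex.exp ((⟪x, WithLp.toLp 2 fun j => (z j).re⟫ : ℝ) * Complex.I))
    (fun x => Complex.exp ((⟪x, WithLp.toLp 2 fun j => (z j).im⟫ : ℝ) * Complex.I))
  rw [h, ← charFun_apply, ← charFun_apply, ProbabilityTheory.charFun_stdGaussian,
    ProbabilityTheory.charFun_stdGaussian, ← Complex.exp_add]
  have e : ‖z‖ ^ 2 = ‖(WithLp.toLp 2 fun j => (z j).re : EuclideanSpace ℝ (Fin n))‖ ^ 2 +
      ‖(WithLp.toLp 2 fun j => (z j).im : EuclideanSpace ℝ (Fin n))‖ ^ 2 := by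
    simp only [EuclideanSpace.norm_sq_eq, ← Finset.sum_add_distrib]
    refine Finset.sum_congr rfl fun j _ => ?_
    rw [← Complex.normSq_eq_norm_sq, Complex.normSq_apply, Real.norm_eq_abs, Real.norm_eq_abs,
      sq_abs, sq_abs]; ring
  have e' := congrArg (fun r : ℝ => (r : ℂ)) e
  push_cast at e'
  rw [e']; congr 1; ring

theorem measurePreserving_cplx :
    MeasurePreserving (fun (p : Fin n → EuclideanSpace ℝ (Fin n) × EuclideanSpace ℝ (Fin n)) i =>
      cplx (p i)) (rowLaw (EuclideanSpace ℝ (Fin n)) n) (gaussLaw n) :=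
  measurePreserving_pi _ _ fun _ => ⟨continuous_cplx.measurable, gaussian_map_cplx⟩

/-- The unit ball of `ℝⁿ`. -/
def unitBody (n : ℕ) : ConvexBody (EuclideanSpace ℝ (Fin n)) :=
  ⟨Metric.closedBall 0 1, convex_closedBall 0 1, isCompact_closedBall 0 1,
    Metric.nonempty_closedBall.2 zero_le_one⟩

/-- The inclusion of `ℝⁿ` in `ℂⁿ`. -/
def incl (n : ℕ) : EuclideanSpace ℝ (Fin n) →ₗ[ℝ] Cn n where
  toFun v := WithLp.toLp 2 fun j => (v j : ℂ)
  map_add' v w := by ext j; simp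
  map_smul' c v := by ext j; simp

theorem tmap_cplx_incl (p : Fin n → EuclideanSpace ℝ (Fin n) × EuclideanSpace ℝ (Fin n))
    (v : EuclideanSpace ℝ (Fin n)) :
    tmap (fun i => cplx (p i)) (incl n v) =
      Matrix.toEuclideanLin (Matrix.of fun i j => (p i).1 j) v := by
  ext i
  rw [tmap_apply, inner_cplx]
  simp [incl, Matrix.toLpLin_apply, Matrix.mulVec, dotProduct, PiLp.inner_apply, mul_comm]

theorem volume_tmap_cplx (p : Fin n → EuclideanSpace ℝ (Fin n) × EuclideanSpace ℝ (Fin n)) :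
    (volume : Measure (EuclideanSpace ℝ (Fin n))).real
      (lmap (tmap fun i => cplx (p i)).toLinearMap (lmap (incl n) (unitBody n))) =
    |(Matrix.of fun i j => (p i).1 j).det| *
      (volume : Measure (EuclideanSpace ℝ (Fin n))).real (Metric.closedBall 0 1) := by
  have h : (lmap (tmap fun i => cplx (p i)).toLinearMap (lmap (incl n) (unitBody n)) :
      Set (EuclideanSpace ℝ (Fin n))) =
      Matrix.toEuclideanLin (Matrix.of fun i j => (p i).1 j) '' Metric.closedBall 0 1 := by
    rw [coe_lmap, coe_lmap, image_image]
    exact image_congr fun v _ => tmap_cplx_incl p v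
  rw [h, Measure.real, Measure.addHaar_image_linearMap, ENNReal.toReal_mul,
    ENNReal.toReal_ofReal (abs_nonneg _)]
  congr 2
  exact LinearMap.det_toLpLin _ _

theorem rowFun_eq (p : Fin n → EuclideanSpace ℝ (Fin n) × EuclideanSpace ℝ (Fin n)) :
    rowFun p = (Matrix.of fun i j => cplx (p i) j).det ^ 2 *
      (|(Matrix.of fun i j => (p i).1 j).det| : ℝ) := by
  set X : Matrix (Fin n) (Fin n) ℝ := Matrix.of fun i j => (p i).1 j with hX
  set Z : Matrix (Fin n) (Fin n) ℂ := Matrix.of fun i j => cplx (p i) j with hZ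
  have hd : (X.map Complex.ofReal).det = (X.det : ℂ) :=
    (RingHom.map_det Complex.ofRealHom X).symm
  have h1 : gdet (fun i => cfun (p i).1 (p i).2) (fun i => (p i).1) = Z.det * X.det := by
    have : (Matrix.of fun i j => cfun (p i).1 (p i).2 (p j).1) = Z * (X.map Complex.ofReal).transpose := by
      ext i j
      rw [Matrix.of_apply, cfun_apply, PiLp.inner_apply, PiLp.inner_apply, Matrix.mul_apply]
      push_cast
      rw [Finset.mul_sum, ← Finset.sum_add_distrib]
      refine Finset.sum_congr rfl fun k _ => ?_
      simp [hX, hZ, cplx]; ring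
    rw [gdet, this, Matrix.det_mul, Matrix.det_transpose, hd]
  have h2 : gram (fun i => (p i).1) = ((X.det ^ 2 : ℝ) : ℂ) := by
    have : (Matrix.of fun i j => cfun (p i).1 0 (p j).1) =
        X.map Complex.ofReal * (X.map Complex.ofReal).transpose := by
      ext i j
      rw [Matrix.of_apply, cfun_apply, PiLp.inner_apply, inner_zero_left, Matrix.mul_apply]
      push_cast
      rw [mul_zero, add_zero]
      refine Finset.sum_congr rfl fun k _ => ?_
      simp [hX, mul_comm]
    rw [gram, gdet, this, Matrix.det_mul, Matrix.det_transpose, hd]; push_cast; ring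
  rw [rowFun, h1, h2, Complex.norm_real, Real.norm_of_nonneg (sq_nonneg _), Real.sqrt_sq_eq_abs]
  rcases eq_or_ne X.det 0 with h | h
  · simp [h]
  · have h3 : ((|X.det| : ℝ) : ℂ) ≠ 0 := by exact_mod_cast abs_ne_zero.2 h
    have h4 : ((|X.det| : ℝ) : ℂ) ^ 2 = (X.det : ℂ) ^ 2 := by exact_mod_cast sq_abs X.det
    rw [div_eq_iff h3, mul_pow, ← h4]; ring

theorem kern_cplx (p : Fin n → EuclideanSpace ℝ (Fin n) × EuclideanSpace ℝ (Fin n)) :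
    kern (lmap (incl n) (unitBody n)) (fun i => cplx (p i)) =
      ((volume : Measure (EuclideanSpace ℝ (Fin n))).real (Metric.closedBall 0 1) : ℂ) * rowFun p := by
  rw [kern, volume_tmap_cplx, rowFun_eq]; push_cast; ring

theorem gval_unitBody_ne_zero : gval (lmap (incl n) (unitBody n)) ≠ 0 := by
  have hq : 0 < (volume : Measure (EuclideanSpace ℝ (Fin n))).real (Metric.closedBall 0 1) :=
    ENNReal.toReal_pos (Metric.measure_closedBall_pos _ _ one_pos).ne'
      (isCompact_closedBall _ _).measure_lt_top.ne
  have hq' : ((volume : Measure (EuclideanSpace ℝ (Fin n))).real (Metric.closedBall 0 1) : ℂ) ≠ 0 := by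
    exact_mod_cast hq.ne'
  have h1 := (measurePreserving_cplx (n := n)).integrable_comp_of_integrable
    (integrable_kern (lmap (incl n) (unitBody n)))
  have h2 : gval (lmap (incl n) (unitBody n)) = ∫ p, kern (lmap (incl n) (unitBody n))
      (fun i => cplx (p i)) ∂rowLaw (EuclideanSpace ℝ (Fin n)) n := by
    rw [gval, ← measurePreserving_cplx.map_eq, integral_map
      measurePreserving_cplx.measurable.aemeasurable (continuous_kern _).aestronglyMeasurable]
  have e : (kern (lmap (incl n) (unitBody n)) ∘ fun p i => cplx (p i)) = fun p =>
      ((volume : Measure (EuclideanSpace ℝ (Fin n))).real (Metric.closedBall 0 1) : ℂ) * rowFun p :=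
    funext kern_cplx
  rw [e] at h1
  have hi : Integrable (rowFun (E := EuclideanSpace ℝ (Fin n)) (k := n))
      (rowLaw (EuclideanSpace ℝ (Fin n)) n) := by
    refine (h1.const_mul ((volume : Measure (EuclideanSpace ℝ (Fin n))).real
      (Metric.closedBall 0 1) : ℂ)⁻¹).congr (Eventually.of_forall fun p => ?_)
    simp only
    rw [inv_mul_cancel_left₀ hq']
  obtain ⟨c, hc, h3⟩ := rowFun_integral_pos finrank_euclideanSpace_fin hi
  simp only [kern_cplx] at h2
  rw [h2, integral_const_mul, h3]
  exact mul_ne_zero hq' (by exact_mod_cast hc.ne')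

theorem gval_ne_zero : (gval : ConvexBody (Cn n) → ℂ) ≠ 0 := fun h =>
  gval_unitBody_ne_zero (congrFun h _)

theorem W2.sub_const_mul {μ ν : ConvexBody (Cn n) → ℂ} (hμ : W2 μ) (hν : W2 ν) (c : ℂ) :
    W2 fun K => μ K - c * ν K :=
  ⟨hμ.ctv.sub (hν.ctv.const_mul c), fun g hg K => by
    rw [hμ.wt g hg, hν.wt g hg]; ring⟩

theorem dls_sub_const_mul {E : Type*} [NormedAddCommGroup E] [InnerProductSpace ℝ E]
    [FiniteDimensional ℝ E] (μ ν : ConvexBody E → ℂ) (c : ℂ) (L : List E) (K : ConvexBody E) :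
    dls L (fun K => μ K - c * ν K) K = dls L μ K - c * dls L ν K := by
  induction L generalizing K with
  | nil => rfl
  | cons v L ih =>
    rw [dls_cons, dls_cons, dls_cons]
    simp only [dl]
    rw [ih, ih]; ring

theorem W2.eq_smul_gval {μ : ConvexBody (Cn n) → ℂ} (h : W2 μ) : ∃ c : ℂ, c • gval = μ := by
  have h0 : dls (frame n) gval 0 ≠ 0 := fun h0 => gval_ne_zero (w2_gval.eq_zero_of_frame h0)
  refine ⟨dls (frame n) μ 0 / dls (frame n) gval 0, ?_⟩
  have h1 := (h.sub_const_mul w2_gval (dls (frame n) μ 0 / dls (frame n) gval 0)).eq_zero_of_frame (by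
    rw [dls_sub_const_mul, div_mul_cancel₀ _ h0, sub_self])
  funext K
  have h2 := congrFun h1 K
  simp only [Pi.zero_apply] at h2
  rw [Pi.smul_apply, smul_eq_mul]
  linear_combination -h2

end nonvanishing

/-- For `n ≥ 2`, the space of continuous, translation invariant valuations on `ℂⁿ` of
weight `2` (i.e. `μ (g K) = (det g)² μ K` for `g ∈ U(n)`) has dimension exactly `1`. -/
theorem dim_weight_two_valuations (n : ℕ) (hn : 2 ≤ n) :
    Module.finrank ℂ ↥(WeightValuations n 2) = 1 := by
  refine finrank_eq_one_iff_of_nonzero' (⟨gval, (mem_weightValuations_iff _).2 w2_gval⟩ :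
    WeightValuations n 2) (fun h => gval_ne_zero (congrArg Subtype.val h)) |>.2 fun w => ?_
  obtain ⟨c, hc⟩ := ((mem_weightValuations_iff _).1 w.2).eq_smul_gval
  exact ⟨c, Subtype.ext hc⟩

end
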